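/- Every connected bridgeless cubic planar simple graph with n vertices has at least (5/2)^(n/4 − 1/2) circuit double covers. -/

import Mathlib

namespace CiDC

open SimpleGraph

/-- A circuit in a graph: a connected 2-regular subgraph. -/
def IsCircuit {V : Type*} {G : SimpleGraph V} (H : G.Subgraph) : Prop :=
  H.Connected ∧ ∀ v ∈ H.verts, (H.neighborSet v).ncard = 2

open scoped Classical in
/-- A circuit double cover: a multiset of circuits covering every edge exactly twice
(counted with multiplicity). -/
def IsCiDC {V : Type*} (G : SimpleGraph V) (C : Multiset G.Subgraph) : Prop :=
  (∀ H ∈ C, IsCircuit H) ∧ ∀ e ∈ G.edgeSet, C.countP (fun H => e ∈ H.edgeSet) = 2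

/-- ν(G): the number of circuit double covers of `G`. -/
noncomputable def nu {V : Type*} (G : SimpleGraph V) : ℕ :=
  {C : Multiset G.Subgraph | IsCiDC G C}.ncard

/-- A cubic graph: every vertex has degree 3. -/
def IsCubic {V : Type*} (G : SimpleGraph V) : Prop :=
  ∀ v : V, (G.neighborSet v).ncard = 3



/-- A rotation system on a graph: a permutation of the darts fixing the tail of each dart
and acting with a single cycle on the darts at each vertex (i.e. a cyclic ordering of the
edge-ends at each vertex). -/
structure RotationSystem {V : Type*} (G : SimpleGraph V) where
  σ : Equiv.Perm G.Dart
  fst_eq : ∀ d : G.Dart, (σ d).fst = d.fst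
  cyclic : ∀ d d' : G.Dart, d.fst = d'.fst → ∃ n : ℕ, (σ ^ n) d = d'

/-- The face-tracing map of a rotation system: traverse a dart, then turn to the next
dart in the cyclic order at its head. -/
def RotationSystem.faceMap {V : Type*} {G : SimpleGraph V} (rs : RotationSystem G) :
    Equiv.Perm G.Dart :=
  (Function.Involutive.toPerm Dart.symm (fun d => Dart.symm_symm d)).trans rs.σ

/-- The faces of a rotation system are the orbits of the face-tracing map. -/
def RotationSystem.faceSetoid {V : Type*} {G : SimpleGraph V} (rs : RotationSystem G) :
    Setoid G.Dart where
  r := rs.faceMap.SameCycle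
  iseqv := ⟨fun _ => Equiv.Perm.SameCycle.refl _ _,
    Equiv.Perm.SameCycle.symm, Equiv.Perm.SameCycle.trans⟩

/-- The number of faces of a rotation system. -/
noncomputable def RotationSystem.numFaces {V : Type*} {G : SimpleGraph V}
    (rs : RotationSystem G) : ℕ :=
  Nat.card (Quotient rs.faceSetoid)

/-- A connected graph is planar iff some rotation system satisfies Euler's formula
`n - m + F = 2` (written additively to avoid truncated subtraction). -/
def HasPlanarEmbedding {V : Type*} [Fintype V] (G : SimpleGraph V) : Prop :=
  ∃ rs : RotationSystem G, Fintype.card V + rs.numFaces = 2 + G.edgeSet.ncard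

end CiDC

namespace CiDC

/-- A cubic graph given by darts: `α` reverses a dart (fixed points are dangling darts),
`r` rotates the three darts at a vertex. -/
structure CG (D : Type*) where
  α : D → D
  r : D → D
  α_inv : ∀ d, α (α d) = d
  r3 : ∀ d, r (r (r d)) = d
  r_ne : ∀ d, r d ≠ d

/-- Two pairs agree as unordered pairs. -/
def EdgeOK (a b a' b' : ℕ) : Prop := (a = a' ∧ b = b') ∨ (a = b' ∧ b = a')

namespace CG

variable {D : Type*}

/-- Colourings of corners; the colour `c d` is that of the corner opposite to `d`. -/
def Col (G : CG D) (c : D → ℕ) : Prop :=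
  (∀ d, c d ≠ c (G.r d)) ∧
  ∀ d, EdgeOK (c (G.r d)) (c (G.r (G.r d))) (c (G.r (G.α d))) (c (G.r (G.r (G.α d))))

/-- The twist of a colouring. -/
def tw (G : CG D) (c : D → ℕ) (d : D) : Bool := decide (c (G.r d) = c (G.r (G.α d)))

/-- The set of valid twists. -/
def T (G : CG D) : Set (D → Bool) := {t | ∃ c, G.Col c ∧ G.tw c = t}

/-- The number of valid twists. -/
noncomputable def nu (G : CG D) : ℕ := (G.T).ncard

theorem rr_ne (G : CG D) (d : D) : G.r (G.r d) ≠ d := fun h => by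
  have := G.r3 d
  rw [h] at this
  exact G.r_ne _ this

theorem r_inj (G : CG D) {d e : D} (h : G.r d = G.r e) : d = e := by
  rw [← G.r3 d, ← G.r3 e, h]

theorem α_inj (G : CG D) {d e : D} (h : G.α d = G.α e) : d = e := by
  rw [← G.α_inv d, ← G.α_inv e, h]

theorem r_ne_rr (G : CG D) (d : D) : G.r d ≠ G.r (G.r d) := fun h => G.r_ne _ h.symm

end CG

section dihedral
variable {X : Type*}

theorem dihedral_zpow (κ τ : Equiv.Perm X) (hκ : ∀ x, κ (κ x) = x) (hτ : ∀ x, τ (τ x) = x)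
    (j : ℤ) (x : X) : τ (((τ * κ) ^ j) x) = ((τ * κ) ^ (-j)) (τ x) := by
  have h1 : τ * (τ * κ) * τ⁻¹ = (τ * κ)⁻¹ := by
    have a : τ⁻¹ = τ := by ext x; rw [Equiv.Perm.inv_eq_iff_eq, hτ]
    have b : κ⁻¹ = κ := by ext x; rw [Equiv.Perm.inv_eq_iff_eq, hκ]
    rw [mul_inv_rev, b, a]
    ext x; simp [hτ]
  have h2 : τ * (τ * κ) ^ j * τ⁻¹ = ((τ * κ)⁻¹) ^ j := by rw [← h1, conj_zpow]
  have h3 : τ * (τ * κ) ^ j = (τ * κ) ^ (-j) * τ := by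
    rw [zpow_neg, ← inv_zpow, ← h2]; group
  have := congrArg (fun p : Equiv.Perm X => p x) h3
  simpa using this

theorem dihedral_kappa (κ τ : Equiv.Perm X) (hκ : ∀ x, κ (κ x) = x) (hτ : ∀ x, τ (τ x) = x)
    (j : ℤ) (x : X) : κ (((τ * κ) ^ j) x) = ((τ * κ) ^ (-j - 1)) (τ x) := by
  have h : κ (((τ * κ) ^ j) x) = τ (((τ * κ) ^ (j + 1)) x) := by
    rw [add_comm, zpow_add, zpow_one]; simp [hτ]
  rw [h, dihedral_zpow κ τ hκ hτ]; congr 2; ring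

/-- The other end of the path starting in a `τ`-fixed point. -/
theorem dihedral_end [Finite X] (κ τ : Equiv.Perm X) (hκ : ∀ x, κ (κ x) = x)
    (hτ : ∀ x, τ (τ x) = x) (hκf : ∀ x, κ x ≠ x) (b : X) (hb : τ b = b) :
    ∃ b', τ b' = b' ∧ b' ≠ b ∧
      (∀ f : X → ℕ, (∀ x, f (κ x) = f x) → (∀ x, f (τ x) = f x) → f b' = f b) ∧
      ∀ y, τ y = y →
        (∀ f : X → ℕ, (∀ x, f (κ x) = f x) → (∀ x, f (τ x) = f x) → f y = f b) →
        y = b ∨ y = b' := by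
  classical
  set ρ := τ * κ with hρ
  have hT : ∀ j : ℤ, τ ((ρ ^ j) b) = (ρ ^ (-j)) b := fun j => by
    rw [dihedral_zpow κ τ hκ hτ, hb]
  have hK : ∀ j : ℤ, κ ((ρ ^ j) b) = (ρ ^ (-j - 1)) b := fun j => by
    rw [dihedral_kappa κ τ hκ hτ, hb]
  let N : ℕ := Function.minimalPeriod ρ b
  have hNpos : 0 < N := by
    apply Function.minimalPeriod_pos_of_mem_periodicPts
    have : Finite (Equiv.Perm X) := inferInstance
    refine ⟨orderOf ρ, orderOf_pos ρ, ?_⟩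
    rw [Function.IsPeriodicPt, Function.IsFixedPt, Equiv.Perm.iterate_eq_pow, pow_orderOf_eq_one]
    rfl
  have hN : ∀ j : ℤ, (ρ ^ j) b = b ↔ (N : ℤ) ∣ j := by
    intro j
    exact MulAction.zpow_smul_eq_iff_minimalPeriod_dvd (a := ρ) (b := b)
  have hN2 : ∀ i j : ℤ, (ρ ^ i) b = (ρ ^ j) b ↔ (N : ℤ) ∣ i - j := by
    intro i j
    rw [← hN, sub_eq_neg_add, zpow_add, zpow_neg, Equiv.Perm.mul_apply, Equiv.Perm.inv_eq_iff_eq]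
  have heven : (2 : ℤ) ∣ N := by
    by_contra h
    obtain ⟨j, hj⟩ : ∃ j : ℤ, (N : ℤ) = 2 * j + 1 := ⟨(N : ℤ) / 2, by omega⟩
    apply hκf ((ρ ^ j) b)
    rw [hK, hN2]
    exact ⟨-1, by rw [hj]; ring⟩
  obtain ⟨M, hM⟩ := heven
  refine ⟨(ρ ^ M) b, ?_, ?_, ?_, ?_⟩
  · rw [hT, hN2]; exact ⟨-1, by rw [hM]; ring⟩
  · intro h
    rw [hN] at h
    have := Int.le_of_dvd (by omega) h
    omega
  · intro f h1 h2
    have : ∀ x, f (ρ x) = f x := fun x => by simp [hρ, h1, h2]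
    have key : ∀ (n : ℕ) x, f ((ρ ^ n) x) = f x := by
      intro n
      induction n with
      | zero => intro x; simp
      | succ n ih => intro x; rw [pow_succ, Equiv.Perm.mul_apply, ih, this]
    obtain ⟨n, hn⟩ := Int.eq_ofNat_of_zero_le (show 0 ≤ M by omega)
    rw [hn, zpow_natCast, key]
  · intro y hy hf
    obtain ⟨j, rfl⟩ : ∃ j : ℤ, (ρ ^ j) b = y := by
      have := hf (fun x => if ∃ j : ℤ, (ρ ^ j) b = x then 1 else 0) ?_ ?_
      · have hbb : ∃ j : ℤ, (ρ ^ j) b = b := ⟨0, by simp⟩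
        by_contra h
        simp only [if_pos hbb, if_neg h] at this
        omega
      · intro x
        have : (∃ j : ℤ, (ρ ^ j) b = κ x) ↔ ∃ j : ℤ, (ρ ^ j) b = x := by
          constructor
          · rintro ⟨j, h⟩; exact ⟨-j - 1, by rw [← hK, h, hκ]⟩
          · rintro ⟨j, h⟩; exact ⟨-j - 1, by rw [← hK, h]⟩
        simp only [this]
      · intro x
        have : (∃ j : ℤ, (ρ ^ j) b = τ x) ↔ ∃ j : ℤ, (ρ ^ j) b = x := by
          constructor
          · rintro ⟨j, h⟩; exact ⟨-j, by rw [← hT, h, hτ]⟩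
          · rintro ⟨j, h⟩; exact ⟨-j, by rw [← hT, h]⟩
        simp only [this]
    rw [hT, hN2] at hy
    obtain ⟨z, hz⟩ := hy
    have hz' : M * z = -j := by
      have : 2 * (M * z) = 2 * (-j) := by rw [← mul_assoc, ← hM, ← hz]; ring
      omega
    rcases Int.even_or_odd z with ⟨w, hw⟩ | ⟨w, hw⟩
    · left; rw [hN]; exact ⟨-w, by rw [hM]; rw [hw] at hz'; linarith⟩
    · right; rw [hN2]; exact ⟨-w - 1, by rw [hM]; rw [hw] at hz'; linarith⟩

/-- Two fixed point free involutions have a common proper 2-colouring. -/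
theorem dihedral_bip [Finite X] (κ τ : Equiv.Perm X) (hκ : ∀ x, κ (κ x) = x)
    (hτ : ∀ x, τ (τ x) = x) (hκf : ∀ x, κ x ≠ x) (hτf : ∀ x, τ x ≠ x) :
    ∃ g : X → Bool, (∀ x, g (κ x) = !g x) ∧ ∀ x, g (τ x) = !g x := by
  classical
  set ρ := τ * κ with hρ
  have hT := dihedral_zpow κ τ hκ hτ
  have hK := dihedral_kappa κ τ hκ hτ
  have no : ∀ x, ¬ ρ.SameCycle x (τ x) := by
    rintro x ⟨j, hj⟩
    rcases Int.even_or_odd j with ⟨w, hw⟩ | ⟨w, hw⟩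
    · apply hτf ((ρ ^ w) x)
      rw [hT, ← hj, ← Equiv.Perm.mul_apply, ← zpow_add]
      congr 2; omega
    · apply hκf ((ρ ^ w) x)
      rw [hK, ← hj, ← Equiv.Perm.mul_apply, ← zpow_add]
      congr 2; omega
  have inv : ∀ x y, ρ.SameCycle x y → ρ.SameCycle (τ x) (τ y) := by
    rintro x y ⟨j, rfl⟩
    exact ⟨-j, by rw [hT]⟩
  let Q := Quotient (Equiv.Perm.SameCycle.setoid ρ)
  have : Finite Q := inferInstance
  obtain ⟨n, ⟨e⟩⟩ := Finite.exists_equiv_fin Q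
  let cl : X → Fin n := fun x => e (Quotient.mk (Equiv.Perm.SameCycle.setoid ρ) x)
  have hcl : ∀ x y, cl x = cl y ↔ ρ.SameCycle x y := by
    intro x y
    simp only [cl, EmbeddingLike.apply_eq_iff_eq]
    exact Quotient.eq
  have h1 : ∀ x, decide (cl (τ x) < cl (τ (τ x))) = !decide (cl x < cl (τ x)) := by
    intro x
    rw [hτ]
    have := mt (hcl x (τ x)).1 (no x)
    rcases lt_trichotomy (cl x) (cl (τ x)) with h | h | h
    · simp [h, h.le]
    · exact absurd h this
    · simp [h, h.le]
  refine ⟨fun x => decide (cl x < cl (τ x)), ?_, h1⟩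
  intro x
  have e1 : cl (κ x) = cl (τ x) := by
    rw [hcl]; exact ⟨1, by simp [hρ, hκ]⟩
  have e2 : cl (τ (κ x)) = cl (τ (τ x)) := by
    rw [hcl]; exact inv _ _ ((hcl _ _).1 e1)
  change decide (cl (κ x) < cl (τ (κ x))) = _
  rw [e1, e2]; exact h1 x
end dihedral

end CiDC

namespace CiDC
namespace CG
variable {O : Type*} (G : CG O)

/-- Corner involution on strand ends. -/
def kap : Equiv.Perm (O × Bool) where
  toFun x := if x.2 then (G.r (G.r x.1), false) else (G.r x.1, true)
  invFun x := if x.2 then (G.r (G.r x.1), false) else (G.r x.1, true)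
  left_inv := by rintro ⟨d, s⟩; cases s <;> simp [G.r3]
  right_inv := by rintro ⟨d, s⟩; cases s <;> simp [G.r3]

theorem kap_kap (x : O × Bool) : G.kap (G.kap x) = x := G.kap.left_inv x

theorem kap_ne (x : O × Bool) : G.kap x ≠ x := by
  rcases x with ⟨d, s⟩
  cases s <;> simp [kap]

/-- Edge involution on strand ends. -/
def tau (t : O → Bool) (ht : ∀ d, t (G.α d) = t d) : Equiv.Perm (O × Bool) where
  toFun x := (G.α x.1, if t x.1 then x.2 else !x.2)
  invFun x := (G.α x.1, if t x.1 then x.2 else !x.2)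
  left_inv := by rintro ⟨d, s⟩; cases h : t d <;> simp [G.α_inv, ht, h]
  right_inv := by rintro ⟨d, s⟩; cases h : t d <;> simp [G.α_inv, ht, h]

theorem tau_tau (t : O → Bool) (ht : ∀ d, t (G.α d) = t d) (x : O × Bool) :
    G.tau t ht (G.tau t ht x) = x := (G.tau t ht).left_inv x

/-- The colours at strand ends. -/
def endc (c : O → ℕ) (x : O × Bool) : ℕ := if x.2 then c (G.r x.1) else c (G.r (G.r x.1))

variable {G}

theorem Col.ne1 {c : O → ℕ} (h : G.Col c) (d : O) : c (G.r d) ≠ c (G.r (G.r d)) := h.1 _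
theorem Col.ne2 {c : O → ℕ} (h : G.Col c) (d : O) : c (G.r (G.r d)) ≠ c d := by
  have := h.1 (G.r (G.r d)); rwa [G.r3] at this

theorem tw_α (c : O → ℕ) (d : O) : G.tw c (G.α d) = G.tw c d := by
  simp [tw, G.α_inv, eq_comm]

theorem Col.tw_true {c : O → ℕ} (h : G.Col c) {d : O} (ht : G.tw c d = true) :
    c (G.r d) = c (G.r (G.α d)) ∧ c (G.r (G.r d)) = c (G.r (G.r (G.α d))) := by
  have h1 : c (G.r d) = c (G.r (G.α d)) := by simpa [tw] using ht
  rcases h.2 d with h2 | h2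
  · exact h2
  · exact absurd (h1.symm.trans h2.1) (h.ne1 _)

theorem Col.tw_false {c : O → ℕ} (h : G.Col c) {d : O} (ht : G.tw c d = false) :
    c (G.r d) = c (G.r (G.r (G.α d))) ∧ c (G.r (G.r d)) = c (G.r (G.α d)) := by
  have h1 : ¬ c (G.r d) = c (G.r (G.α d)) := by simpa [tw] using ht
  rcases h.2 d with h2 | h2
  · exact absurd h2.1 h1
  · exact h2

theorem endc_kap (c : O → ℕ) (x : O × Bool) : G.endc c (G.kap x) = G.endc c x := by
  rcases x with ⟨d, s⟩
  cases s <;> simp [kap, endc, G.r3]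

theorem Col.endc_tau {c : O → ℕ} (h : G.Col c) {t : O → Bool} (ht : ∀ d, t (G.α d) = t d)
    (hc : G.tw c = t) (x : O × Bool) : G.endc c (G.tau t ht x) = G.endc c x := by
  subst hc
  rcases x with ⟨d, s⟩
  cases hd : G.tw c d
  · have := h.tw_false hd
    cases s <;> simp [tau, endc, hd, this]
  · have := h.tw_true hd
    cases s <;> simp [tau, endc, hd, this]

theorem Col.endc_ne {c : O → ℕ} (h : G.Col c) (d : O) :
    G.endc c (d, true) ≠ G.endc c (d, false) := by
  simpa [endc] using h.ne1 d

/-- Invariant functions on strand ends give colourings. -/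
theorem exists_col {t : O → Bool} (ht : ∀ d, t (G.α d) = t d) (F : O × Bool → ℕ)
    (hκ : ∀ x, F (G.kap x) = F x) (hτ : ∀ x, F (G.tau t ht x) = F x)
    (hne : ∀ d, F (d, true) ≠ F (d, false)) :
    ∃ c, G.Col c ∧ G.tw c = t ∧ G.endc c = F := by
  have hk : ∀ d, F (d, false) = F (G.r d, true) := fun d => by
    rw [← hκ]; simp [kap]
  have hE : G.endc (fun d => F (G.r (G.r d), true)) = F := by
    funext ⟨d, s⟩
    cases s
    · simp [endc, G.r3, hk]
    · simp [endc, G.r3]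
  refine ⟨fun d => F (G.r (G.r d), true), ⟨?_, ?_⟩, ?_, hE⟩
  · intro d
    have := hne (G.r (G.r d))
    rw [hk (G.r (G.r d))] at this
    simpa [G.r3] using this
  · intro d
    have h1 := hτ (d, true)
    have h2 := hτ (d, false)
    cases hd : t d
    · right
      simp [tau, hd, hk] at h1 h2
      simp [G.r3, h1, h2]
    · left
      simp [tau, hd, hk] at h1 h2
      simp [G.r3, h1, h2]
  · funext d
    have h1 := hτ (d, true)
    simp only [tw, G.r3]
    cases hd : t d
    · simp [tau, hd] at h1
      simp only [decide_eq_false_iff_not]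
      rw [← h1]
      exact fun h => hne _ h.symm
    · simp [tau, hd] at h1
      simp [h1]

variable (G)
/-- Boundary colours. -/
def bd {k : ℕ} (q : Fin k → O) (c : O → ℕ) (i : Fin k) (s : Bool) : ℕ := G.endc c (q i, s)

/-- Extendable boundary colourings with outer twist `t`. -/
def St {k : ℕ} (q : Fin k → O) (t : O → Bool) : Set (Fin k → Bool → ℕ) :=
  {b | ∃ c, G.Col c ∧ G.tw c = t ∧ G.bd q c = b}

end CG

/-- A normalised state. -/
structure IsState {k : ℕ} (A : Set (Fin k → ℕ)) (σ : Fin k → Fin k) : Prop where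
  inj : Function.Injective σ
  ne : ∀ i, σ i ≠ i
  prop : ∀ a ∈ A, ∀ i, a i ≠ a (σ i)
  ext : ∀ L : Fin k → ℕ, (∀ i j, i ≠ j → L i = L j → ∃ a ∈ A, a i = a j) → L ∈ A

theorem CG.state {O : Type*} [Finite O] (G : CG O) {k : ℕ} (q : Fin k → O)
    (hq : Function.Injective q) (hfix : ∀ d, G.α d = d ↔ ∃ i, d = q i) (t : O → Bool)
    (hS : (G.St q t).Nonempty) :
    ∃ (f : Fin k → Bool) (σ : Fin k → Fin k),
      (∀ b ∈ G.St q t, ∀ i, b i (!f i) = b (σ i) (f (σ i))) ∧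
      IsState ((fun (b : Fin k → Bool → ℕ) (i : Fin k) => b i (f i)) '' (G.St q t)) σ := by
  classical
  obtain ⟨b₀, c₀, hc₀, htw₀, -⟩ := hS
  have ht : ∀ d, t (G.α d) = t d := fun d => by rw [← htw₀, G.tw_α]
  let κ := G.kap
  let τ := G.tau t ht
  have hκ := G.kap_kap
  have hτ := G.tau_tau t ht
  have tfix : ∀ x : O × Bool, τ x = x ↔ ∃ i, x.1 = q i := by
    rintro ⟨d, s⟩
    have : τ (d, s) = (d, s) ↔ G.α d = d := by
      constructor
      · intro h; exact congrArg Prod.fst h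
      · intro h
        have ht1 : t d = true := by rw [← htw₀]; simp [CG.tw, h]
        simp [τ, CG.tau, h, ht1]
    rw [this, hfix]
  have key : ∀ y : Fin k × Bool, ∃ y' : Fin k × Bool, y' ≠ y ∧
      (∀ F : O × Bool → ℕ, (∀ x, F (κ x) = F x) → (∀ x, F (τ x) = F x) →
        F (q y'.1, y'.2) = F (q y.1, y.2)) ∧
      ∀ z : Fin k × Bool, (∀ F : O × Bool → ℕ, (∀ x, F (κ x) = F x) → (∀ x, F (τ x) = F x) →
        F (q z.1, z.2) = F (q y.1, y.2)) → z = y ∨ z = y' := by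
    intro y
    obtain ⟨⟨d, s⟩, h1, h2, h3, h4⟩ := dihedral_end κ τ hκ hτ G.kap_ne (q y.1, y.2)
      ((tfix _).2 ⟨_, rfl⟩)
    obtain ⟨i, hi⟩ := (tfix _).1 h1
    change d = q i at hi
    subst hi
    refine ⟨(i, s), ?_, h3, ?_⟩
    · rintro rfl; exact h2 rfl
    · intro z hz
      rcases h4 _ ((tfix _).2 ⟨_, rfl⟩) hz with h | h
      · left; simp only [Prod.mk.injEq] at h; exact Prod.ext (hq h.1) h.2
      · right; simp only [Prod.mk.injEq] at h; exact Prod.ext (hq h.1) h.2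
  choose m hm1 hm2 hm3 using key
  have hmm : ∀ y, m (m y) = y := by
    intro y
    rcases hm3 (m y) y (fun F a b => (hm2 y F a b).symm) with h | h
    · exact absurd h.symm (hm1 y)
    · exact h.symm
  let mE : Equiv.Perm (Fin k × Bool) := ⟨m, m, hmm, hmm⟩
  let bar : Equiv.Perm (Fin k × Bool) := ⟨fun y => (y.1, !y.2), fun y => (y.1, !y.2),
    fun y => by simp, fun y => by simp⟩
  obtain ⟨g, hg1, hg2⟩ := dihedral_bip mE bar hmm (fun y => by simp [bar]) hm1
    (fun y => by intro h; have := congrArg Prod.snd h; simp [bar] at this)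
  have hg1' : ∀ y, g (m y) = !g y := hg1
  have hg2' : ∀ i s, g (i, !s) = !g (i, s) := fun i s => hg2 (i, s)
  let f : Fin k → Bool := fun i => g (i, true)
  have hf : ∀ i s, g (i, s) = true ↔ s = f i := by
    intro i s
    have := hg2' i true
    simp only [Bool.not_true] at this
    simp only [f]
    cases s
    · rw [this]; cases g (i, true) <;> simp
    · cases g (i, true) <;> simp
  let σ : Fin k → Fin k := fun i => (m (i, !f i)).1
  have hσ : ∀ i, m (i, !f i) = (σ i, f (σ i)) := by
    intro i
    have h1 : g (m (i, !f i)) = true := by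
      rw [hg1', hg2', (hf i (f i)).2 rfl]; rfl
    have h2 := (hf (m (i, !f i)).1 (m (i, !f i)).2).1 h1
    exact Prod.ext rfl h2
  have hb : ∀ c, G.Col c → G.tw c = t → ∀ y, G.endc c (q (m y).1, (m y).2) = G.endc c (q y.1, y.2) :=
    fun c hc htw y => hm2 y _ (fun x => CG.endc_kap c x) (fun x => hc.endc_tau ht htw x)
  have hbσ : ∀ c, G.Col c → G.tw c = t → ∀ i,
      G.endc c (q i, !f i) = G.endc c (q (σ i), f (σ i)) := by
    intro c hc htw i
    have := hb c hc htw (i, !f i)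
    rw [hσ] at this
    exact this.symm
  have hne : ∀ c, G.Col c → ∀ d s, G.endc c (d, s) ≠ G.endc c (d, !s) := by
    intro c hc d s
    have := hc.endc_ne d
    cases s
    · exact this.symm
    · exact this
  refine ⟨f, σ, ?_, ?_, ?_, ?_, ?_⟩
  · rintro b ⟨c, hc, htw, rfl⟩ i
    exact hbσ c hc htw i
  · intro i j hij
    have h1 : m (i, !f i) = m (j, !f j) := by rw [hσ, hσ, hij]
    have := mE.injective h1
    exact congrArg Prod.fst this
  · intro i hi
    have := hbσ c₀ hc₀ htw₀ i
    rw [hi] at this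
    exact hne c₀ hc₀ _ _ this.symm
  · rintro a ⟨b, ⟨c, hc, htw, rfl⟩, rfl⟩ i h
    change G.endc c (q i, f i) = G.endc c (q (σ i), f (σ i)) at h
    rw [← hbσ c hc htw i] at h
    exact hne c hc _ _ h
  · intro L hL
    -- the equivalence relation
    let Rel : O × Bool → O × Bool → Prop := fun x y => ∀ F : O × Bool → ℕ,
      (∀ x, F (κ x) = F x) → (∀ x, F (τ x) = F x) → F x = F y
    let sd : Setoid (O × Bool) := ⟨Rel, fun x F _ _ => rfl, fun h F a b => (h F a b).symm,
      fun h h' F a b => (h F a b).trans (h' F a b)⟩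
    obtain ⟨n, ⟨en⟩⟩ := Finite.exists_equiv_fin (Quotient sd)
    let cls : O × Bool → ℕ := fun x => (en (Quotient.mk sd x) : ℕ)
    have hcls : ∀ x y, cls x = cls y ↔ Rel x y := by
      intro x y
      simp only [cls, Fin.val_inj, EmbeddingLike.apply_eq_iff_eq]
      exact Quotient.eq (r := sd)
    let B : ℕ := (∑ i, L i) + 1
    have hB : ∀ i, L i < B := fun i => Nat.lt_succ_of_le
      (Finset.single_le_sum (f := L) (fun _ _ => Nat.zero_le _) (Finset.mem_univ i))
    let F : O × Bool → ℕ := fun x =>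
      if h : ∃ i, Rel x (q i, f i) then L h.choose else B + cls x
    have uniq : ∀ i j, Rel (q i, f i) (q j, f j) → i = j := by
      intro i j h
      rcases hm3 (j, f j) (i, f i) h with h' | h'
      · exact congrArg Prod.fst h'
      · exfalso
        have h1 : g (i, f i) = true := (hf _ _).2 rfl
        have h2 : g (j, f j) = true := (hf _ _).2 rfl
        rw [h', hg1', h2] at h1
        simp at h1
    have F1 : ∀ x i, Rel x (q i, f i) → F x = L i := by
      intro x i hx
      have hex : ∃ i, Rel x (q i, f i) := ⟨i, hx⟩
      simp only [F, dif_pos hex]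
      congr 1
      apply uniq
      exact fun F a b => (hex.choose_spec F a b).symm.trans (hx F a b)
    have F2 : ∀ x, (¬ ∃ i, Rel x (q i, f i)) → F x = B + cls x := fun x hx => dif_neg hx
    have Finv : ∀ x y, Rel x y → F x = F y := by
      intro x y hxy
      by_cases h : ∃ i, Rel x (q i, f i)
      · obtain ⟨i, hi⟩ := h
        rw [F1 x i hi, F1 y i (fun F a b => (hxy F a b).symm.trans (hi F a b))]
      · rw [F2 x h, F2 y, (hcls x y).2 hxy]
        rintro ⟨i, hi⟩
        exact h ⟨i, fun F a b => (hxy F a b).trans (hi F a b)⟩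
    obtain ⟨c, hc, htw, hcF⟩ := CG.exists_col (G := G) ht F
      (fun x => Finv _ _ (fun F a b => a x)) (fun x => Finv _ _ (fun F a b => b x)) (by
        intro d hd
        have nr : ¬ Rel (d, true) (d, false) := fun h => hc₀.endc_ne d
          (h _ (fun x => CG.endc_kap c₀ x) (fun x => hc₀.endc_tau ht htw₀ x))
        by_cases h1 : ∃ i, Rel (d, true) (q i, f i)
        · obtain ⟨i, hi⟩ := h1
          by_cases h2 : ∃ i, Rel (d, false) (q i, f i)
          · obtain ⟨j, hj⟩ := h2
            rw [F1 _ i hi, F1 _ j hj] at hd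
            by_cases hij : i = j
            · subst hij
              exact nr (fun F a b => (hi F a b).trans (hj F a b).symm)
            · obtain ⟨a, ⟨b, ⟨c, hc, htw, rfl⟩, rfl⟩, hab⟩ := hL i j hij hd
              apply hc.endc_ne d
              rw [hi _ (fun x => CG.endc_kap c x) (fun x => hc.endc_tau ht htw x),
                hj _ (fun x => CG.endc_kap c x) (fun x => hc.endc_tau ht htw x)]
              exact hab
          · rw [F1 _ i hi, F2 _ h2] at hd
            have := hB i; omega
        · by_cases h2 : ∃ i, Rel (d, false) (q i, f i)
          · obtain ⟨j, hj⟩ := h2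
            rw [F1 _ j hj, F2 _ h1] at hd
            have := hB j; omega
          · rw [F2 _ h1, F2 _ h2] at hd
            exact nr ((hcls _ _).1 (by omega)))
    refine ⟨G.bd q c, ⟨c, hc, htw, rfl⟩, ?_⟩
    funext i
    change G.endc c (q i, f i) = L i
    rw [hcF]
    exact F1 _ i (fun _ _ _ => rfl)

end CiDC

namespace CiDC

/-- A gadget with `k` ports and inner darts `I`. -/
structure Gad (k : ℕ) (I : Type) where
  r : I → I
  r3 : ∀ d, r (r (r d)) = d
  r_ne : ∀ d, r d ≠ d
  θ : Fin k ⊕ I → Fin k ⊕ I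
  θ_inv : ∀ p, θ (θ p) = p

/-- An open cubic graph with `k` dangling darts. -/
structure OG (O : Type*) (k : ℕ) extends CG O where
  q : Fin k → O
  q_inj : Function.Injective q
  fix_iff : ∀ d, α d = d ↔ ∃ i, d = q i

/-- Colours at ends of the gadget. -/
def Gad.E {k : ℕ} {I : Type} (Γ : Gad k I) (b : Fin k → Bool → ℕ) (cI : I → ℕ) :
    Fin k ⊕ I → Bool → ℕ
  | Sum.inl i, s => b i s
  | Sum.inr x, s => if s then cI (Γ.r x) else cI (Γ.r (Γ.r x))

/-- Valid inner twists for a set of boundary colourings. -/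
def Gad.fills {k : ℕ} {I : Type} (Γ : Gad k I) (S : Set (Fin k → Bool → ℕ)) :
    Set (Fin k ⊕ I → Bool) :=
  {t | ∃ b ∈ S, ∃ cI : I → ℕ, (∀ x, cI x ≠ cI (Γ.r x)) ∧
    (∀ p, EdgeOK (Γ.E b cI p true) (Γ.E b cI p false)
      (Γ.E b cI (Γ.θ p) true) (Γ.E b cI (Γ.θ p) false)) ∧
    (fun p => decide (Γ.E b cI p true = Γ.E b cI (Γ.θ p) true)) = t}

namespace OG
variable {O : Type*} {k : ℕ} {I : Type}

/-- Embedding of gadget points in the glued graph. -/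
def emb (G : OG O k) (p : Fin k ⊕ I) : O ⊕ I := Sum.map G.q id p

open scoped Classical in
/-- Edge map of the glued graph. -/
noncomputable def gα (G : OG O k) (Γ : Gad k I) : O ⊕ I → O ⊕ I
  | Sum.inl d => if h : ∃ i, d = G.q i then G.emb (Γ.θ (Sum.inl h.choose)) else Sum.inl (G.α d)
  | Sum.inr x => G.emb (Γ.θ (Sum.inr x))

theorem gα_emb (G : OG O k) (Γ : Gad k I) (p : Fin k ⊕ I) :
    G.gα Γ (G.emb p) = G.emb (Γ.θ p) := by
  rcases p with i | x
  · have h : ∃ j, G.q i = G.q j := ⟨i, rfl⟩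
    have h2 : h.choose = i := (G.q_inj h.choose_spec).symm
    simp only [gα, emb, Sum.map_inl]
    rw [dif_pos h, h2]
  · rfl

theorem gα_inl (G : OG O k) (Γ : Gad k I) (d : O) (h : ∀ i, d ≠ G.q i) :
    G.gα Γ (Sum.inl d) = Sum.inl (G.α d) := by
  simp [gα, h]

theorem α_not_port (G : OG O k) {d : O} (h : ∀ i, d ≠ G.q i) (i : Fin k) : G.α d ≠ G.q i := by
  intro hi
  have h1 := (G.fix_iff (G.q i)).2 ⟨i, rfl⟩
  apply h i
  rw [← h1, ← hi, G.α_inv]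

theorem cases_emb (G : OG O k) (y : O ⊕ I) :
    (∃ p, y = G.emb p) ∨ ∃ d, y = Sum.inl d ∧ ∀ i, d ≠ G.q i := by
  rcases y with d | x
  · by_cases h : ∃ i, d = G.q i
    · obtain ⟨i, rfl⟩ := h
      exact Or.inl ⟨Sum.inl i, rfl⟩
    · exact Or.inr ⟨d, rfl, fun i hi => h ⟨i, hi⟩⟩
  · exact Or.inl ⟨Sum.inr x, rfl⟩

/-- The glued graph. -/
noncomputable def glue (G : OG O k) (Γ : Gad k I) : CG (O ⊕ I) where
  α := G.gα Γ
  r := Sum.map G.r Γ.r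
  α_inv := by
    intro y
    rcases G.cases_emb y with ⟨p, rfl⟩ | ⟨d, rfl, h⟩
    · rw [gα_emb, gα_emb, Γ.θ_inv]
    · rw [gα_inl _ _ _ h, gα_inl _ _ _ (G.α_not_port h), G.α_inv]
  r3 := by rintro (d | x) <;> simp [G.r3, Γ.r3]
  r_ne := by rintro (d | x) <;> simp [G.r_ne, Γ.r_ne]

@[simp] theorem glue_r_inl (G : OG O k) (Γ : Gad k I) (d : O) :
    (G.glue Γ).r (Sum.inl d) = Sum.inl (G.r d) := rfl
@[simp] theorem glue_r_inr (G : OG O k) (Γ : Gad k I) (d : I) :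
    (G.glue Γ).r (Sum.inr d) = Sum.inr (Γ.r d) := rfl
theorem glue_α_emb (G : OG O k) (Γ : Gad k I) (p : Fin k ⊕ I) :
    (G.glue Γ).α (G.emb p) = G.emb (Γ.θ p) := G.gα_emb Γ p
theorem glue_α_q (G : OG O k) (Γ : Gad k I) (i : Fin k) :
    (G.glue Γ).α (Sum.inl (G.q i)) = G.emb (Γ.θ (Sum.inl i)) := G.gα_emb Γ (Sum.inl i)
theorem glue_α_inr (G : OG O k) (Γ : Gad k I) (x : I) :
    (G.glue Γ).α (Sum.inr x) = G.emb (Γ.θ (Sum.inr x)) := G.gα_emb Γ (Sum.inr x)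
theorem glue_α_inl (G : OG O k) (Γ : Gad k I) (d : O) (h : ∀ i, d ≠ G.q i) :
    (G.glue Γ).α (Sum.inl d) = Sum.inl (G.α d) := G.gα_inl Γ d h

theorem E_emb (G : OG O k) (Γ : Gad k I) (cO : O → ℕ) (cI : I → ℕ) (p : Fin k ⊕ I) (s : Bool) :
    (G.glue Γ).endc (Sum.elim cO cI) (G.emb p, s) = Γ.E (G.bd G.q cO) cI p s := by
  rcases p with i | x <;> simp [emb, CG.endc, Gad.E, CG.bd]

theorem endc_true {D : Type*} (G : CG D) (c : D → ℕ) (d : D) : G.endc c (d, true) = c (G.r d) := rfl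
theorem endc_false {D : Type*} (G : CG D) (c : D → ℕ) (d : D) :
    G.endc c (d, false) = c (G.r (G.r d)) := rfl

theorem nu_glue [Fintype O] [DecidableEq O] [Finite I] (G : OG O k) (Γ : Gad k I) :
    (G.glue Γ).nu = ∑ t : O → Bool, (Γ.fills (G.St G.q t)).ncard := by
  classical
  let Φ : (O ⊕ I → Bool) → (O → Bool) × (Fin k ⊕ I → Bool) := fun t =>
    (fun d => if ∃ i, d = G.q i then true else t (Sum.inl d), fun p => t (G.emb p))
  have hΦ : Function.Injective Φ := by
    intro t t' h
    funext y
    rcases G.cases_emb y with ⟨p, rfl⟩ | ⟨d, rfl, hd⟩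
    · exact congrFun (congrArg Prod.snd h) p
    · have := congrFun (congrArg Prod.fst h) d
      have hd' : ¬ ∃ i, d = G.q i := fun ⟨i, hi⟩ => hd i hi
      simpa [Φ, hd'] using this
  have himg : Φ '' (G.glue Γ).T = {x | x.2 ∈ Γ.fills (G.St G.q x.1)} := by
    ext ⟨tO, tI⟩
    constructor
    · rintro ⟨t, ⟨c, hc, rfl⟩, h⟩
      obtain ⟨cO, cI, rfl⟩ : ∃ cO cI, c = Sum.elim cO cI :=
        ⟨c ∘ Sum.inl, c ∘ Sum.inr, by ext (d | x) <;> rfl⟩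
      simp only [Φ, Prod.mk.injEq] at h
      obtain ⟨rfl, rfl⟩ := h
      refine ⟨G.bd G.q cO, ⟨cO, ⟨fun d => hc.1 (Sum.inl d), fun d => ?_⟩, ?_, rfl⟩, cI,
        fun x => hc.1 (Sum.inr x), fun p => ?_, ?_⟩
      · by_cases hd : ∃ i, d = G.q i
        · rw [(G.fix_iff d).2 hd]; exact Or.inl ⟨rfl, rfl⟩
        · have := hc.2 (Sum.inl d)
          rw [glue_α_inl _ _ _ (fun i hi => hd ⟨i, hi⟩)] at this
          exact this
      · funext d
        by_cases hd : ∃ i, d = G.q i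
        · simp only [CG.tw, (G.fix_iff d).2 hd, if_pos hd]; simp
        · simp only [CG.tw, if_neg hd, glue_α_inl _ _ _ (fun i hi => hd ⟨i, hi⟩)]
          rfl
      · have := hc.2 (G.emb p)
        rw [glue_α_emb] at this
        simp only [← endc_false, E_emb] at this
        simp only [← endc_true, E_emb] at this
        exact this
      · funext p
        simp only [CG.tw, glue_α_emb]
        simp only [← endc_true, E_emb]
    · rintro ⟨b, ⟨cO, hcO, htO, rfl⟩, cI, h1, h2, h3⟩
      simp only at htO h3
      refine ⟨(G.glue Γ).tw (Sum.elim cO cI), ⟨_, ⟨?_, ?_⟩, rfl⟩, ?_⟩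
      · rintro (d | x)
        · exact hcO.1 d
        · exact h1 x
      · intro y
        rcases G.cases_emb y with ⟨p, rfl⟩ | ⟨d, rfl, hd⟩
        · rw [glue_α_emb]
          simp only [← endc_false, E_emb]
          simp only [← endc_true, E_emb]
          exact h2 p
        · rw [glue_α_inl _ _ _ hd]
          exact hcO.2 d
      · simp only [Φ, Prod.mk.injEq]
        constructor
        · rw [← htO]
          funext d
          by_cases hd : ∃ i, d = G.q i
          · rw [if_pos hd]; simp only [CG.tw, (G.fix_iff d).2 hd]; simp
          · simp only [CG.tw, if_neg hd, glue_α_inl _ _ _ (fun i hi => hd ⟨i, hi⟩)]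
            rfl
        · rw [← h3]
          funext p
          simp only [CG.tw, glue_α_emb]
          simp only [← endc_true, E_emb]
  have e1 : (G.glue Γ).nu = {x : (O → Bool) × (Fin k ⊕ I → Bool) |
      x.2 ∈ Γ.fills (G.St G.q x.1)}.ncard := by
    rw [← himg, Set.ncard_image_of_injective _ hΦ]; rfl
  rw [e1, ← Nat.card_coe_set_eq]
  let e : {x : (O → Bool) × (Fin k ⊕ I → Bool) | x.2 ∈ Γ.fills (G.St G.q x.1)} ≃
      Σ t : O → Bool, Γ.fills (G.St G.q t) :=
    { toFun := fun x => ⟨x.1.1, ⟨x.1.2, x.2⟩⟩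
      invFun := fun y => ⟨(y.1, y.2.1), y.2.2⟩
      left_inv := fun _ => rfl
      right_inv := fun _ => rfl }
  rw [Nat.card_congr e, Nat.card_sigma]
  rfl

end OG

/-- Flip ends at ports. -/
def flipb {k : ℕ} (f : Fin k → Bool) (b : Fin k → Bool → ℕ) : Fin k → Bool → ℕ :=
  fun i s => b i (if s then f i else !f i)

theorem flipb_flipb {k : ℕ} (f : Fin k → Bool) (b : Fin k → Bool → ℕ) :
    flipb f (flipb f b) = b := by
  funext i s
  cases s <;> cases h : f i <;> simp [flipb, h]

theorem Gad.fills_flip_le {k : ℕ} {I : Type} [Finite I] (Γ : Gad k I) (f : Fin k → Bool)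
    (S : Set (Fin k → Bool → ℕ)) (hS : ∀ b ∈ S, ∀ i, b i true ≠ b i false) :
    (Γ.fills S).ncard ≤ (Γ.fills (flipb f '' S)).ncard := by
  classical
  let F : Fin k ⊕ I → Bool := Sum.elim f (fun _ => true)
  apply Set.ncard_le_ncard_of_injOn (fun t p => (t p).xor ((F p).xor (F (Γ.θ p))))
  · rintro t ⟨b, hb, cI, h1, h2, rfl⟩
    have hE : ∀ p s, Γ.E (flipb f b) cI p s = Γ.E b cI p (if s then F p else !F p) := by
      rintro (i | x) s
      · rfl
      · cases s <;> simp [E, F]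
    have hne : ∀ p, Γ.E b cI p true ≠ Γ.E b cI p false := by
      rintro (i | x)
      · exact hS b hb i
      · simpa [E] using h1 (Γ.r x)
    refine ⟨flipb f b, ⟨b, hb, rfl⟩, cI, h1, fun p => ?_, ?_⟩
    · have := h2 p
      simp only [hE, EdgeOK] at this ⊢
      cases F p <;> cases F (Γ.θ p) <;> simp only [Bool.false_eq_true, if_false, if_true, Bool.not_true, Bool.not_false] <;> tauto
    · funext p
      have h3 := h2 p
      have h4 := hne p
      have h5 := hne (Γ.θ p)
      simp only [hE, EdgeOK] at h3 ⊢
      cases F p <;> cases F (Γ.θ p) <;> simp <;> grind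
  · intro t _ t' _ h
    funext p
    have := congrFun h p
    simpa using this

theorem Gad.fills_flip {k : ℕ} {I : Type} [Finite I] (Γ : Gad k I) (f : Fin k → Bool)
    (S : Set (Fin k → Bool → ℕ)) (hS : ∀ b ∈ S, ∀ i, b i true ≠ b i false) :
    (Γ.fills (flipb f '' S)).ncard = (Γ.fills S).ncard := by
  apply le_antisymm _ (Γ.fills_flip_le f S hS)
  have := Γ.fills_flip_le f (flipb f '' S) (by
    rintro _ ⟨b, hb, rfl⟩ i
    have := hS b hb i
    cases h : f i <;> simp [flipb, h, this, this.symm])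
  rwa [Set.image_image, show (fun x => flipb f (flipb f x)) = id from funext (flipb_flipb f),
    Set.image_id] at this

/-- Boundary colourings from arc labels. -/
def arcb {k : ℕ} (σ : Fin k → Fin k) (a : Fin k → ℕ) : Fin k → Bool → ℕ :=
  fun i s => if s then a i else a (σ i)

theorem CG.St_ne {O : Type*} (G : CG O) {k : ℕ} (q : Fin k → O) (t : O → Bool) :
    ∀ b ∈ G.St q t, ∀ i, b i true ≠ b i false := by
  rintro b ⟨c, hc, -, rfl⟩ i
  exact hc.endc_ne _

/-- Main reduction to normalised states. -/
theorem OG.state_fills {O : Type*} [Finite O] {k : ℕ} (G : OG O k) (t : O → Bool)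
    (hS : (G.St G.q t).Nonempty) :
    ∃ (A : Set (Fin k → ℕ)) (σ : Fin k → Fin k), IsState A σ ∧
      ∀ (ρ : Fin k → Fin k) {I : Type} [Finite I] (Γ : Gad k I),
        (Γ.fills (G.St (G.q ∘ ρ) t)).ncard =
          (Γ.fills ((fun a i s => arcb σ a (ρ i) s) '' A)).ncard := by
  obtain ⟨f, σ, h1, h2⟩ := G.state G.q G.q_inj G.fix_iff t hS
  refine ⟨_, σ, h2, ?_⟩
  intro ρ I _ Γ
  rw [← Γ.fills_flip (f ∘ ρ) (G.St (G.q ∘ ρ) t) (G.St_ne _ _)]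
  congr 2
  ext b
  constructor
  · rintro ⟨b', ⟨c, hc, ht, rfl⟩, rfl⟩
    refine ⟨_, ⟨G.bd G.q c, ⟨c, hc, ht, rfl⟩, rfl⟩, ?_⟩
    funext i s
    have := h1 _ ⟨c, hc, ht, rfl⟩ (ρ i)
    cases s
    · simpa [arcb, flipb, CG.bd] using this.symm
    · simp [arcb, flipb, CG.bd]
  · rintro ⟨_, ⟨_, ⟨c, hc, ht, rfl⟩, rfl⟩, rfl⟩
    refine ⟨G.bd (G.q ∘ ρ) c, ⟨c, hc, ht, rfl⟩, ?_⟩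
    funext i s
    have := h1 _ ⟨c, hc, ht, rfl⟩ (ρ i)
    cases s
    · simpa [arcb, flipb, CG.bd] using this
    · simp [arcb, flipb, CG.bd]

end CiDC

namespace CiDC

/-! ### Finite combinatorics -/

def allB : ℕ → List (List Bool)
  | 0 => [[]]
  | n + 1 => (allB n).map (List.cons true) ++ (allB n).map (List.cons false)

theorem mem_allB : ∀ (n : ℕ) (l : List Bool), l.length = n → l ∈ allB n := by
  intro n
  induction n with
  | zero => intro l hl; simp [allB, List.length_eq_zero_iff.1 hl]
  | succ n ih =>
    intro l hl
    rcases l with _ | ⟨b, l⟩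
    · simp at hl
    · simp only [List.length_cons, Nat.add_right_cancel_iff] at hl
      cases b <;> simp [allB, ih l hl]

def allN (k : ℕ) : ℕ → List (List ℕ)
  | 0 => [[]]
  | n + 1 => (List.range k).flatMap fun i => (allN k n).map (List.cons i)

theorem mem_allN (k : ℕ) : ∀ (n : ℕ) (l : List ℕ), l.length = n → (∀ x ∈ l, x < k) →
    l ∈ allN k n := by
  intro n
  induction n with
  | zero => intro l hl _; simp [allN, List.length_eq_zero_iff.1 hl]
  | succ n ih =>
    intro l hl hx
    rcases l with _ | ⟨b, l⟩
    · simp at hl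
    · simp only [List.length_cons, Nat.add_right_cancel_iff] at hl
      simp only [allN, List.mem_flatMap, List.mem_range, List.mem_map]
      exact ⟨b, hx b (by simp), l, ih l hl (fun x hx' => hx x (by simp [hx'])), rfl⟩

/-- All pairs `i < j < k`. -/
def prs (k : ℕ) : List (ℕ × ℕ) :=
  (List.range k).flatMap fun j => (List.range j).map fun i => (i, j)

theorem mem_prs {k i j : ℕ} : (i, j) ∈ prs k ↔ i < j ∧ j < k := by
  simp only [prs, List.mem_flatMap, List.mem_range, List.mem_map, Prod.mk.injEq]
  constructor
  · rintro ⟨j', h1, i', h2, rfl, rfl⟩; exact ⟨h2, h1⟩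
  · rintro ⟨h1, h2⟩; exact ⟨j, h2, i, h1, rfl, rfl⟩

def mask (k : ℕ) (L : ℕ → ℕ) : List Bool := (prs k).map fun p => L p.1 == L p.2

def disj : List Bool → List Bool → Bool
  | a :: l, b :: m => !(a && b) && disj l m
  | _, _ => true

theorem disj_map {β : Type*} (l : List β) (f g : β → Bool) :
    disj (l.map f) (l.map g) = true ↔ ∀ p ∈ l, f p = true → g p = false := by
  induction l with
  | nil => simp [disj]
  | cons a l ih =>
    simp only [List.map_cons, disj, Bool.and_eq_true, ih, List.forall_mem_cons]
    cases f a <;> cases g a <;> simp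

def mergeL (L : List ℕ) (i j : ℕ) : List ℕ :=
  let x := L.getD i 0
  let y := L.getD j 0
  L.map fun z => if z == y then x else z

/-- Labels after merging. -/
def lab (k : ℕ) (es : List (ℕ × ℕ)) : List ℕ :=
  es.foldl (fun L e => mergeL L e.1 e.2) (List.range k)

theorem lab_sound (k : ℕ) (a : ℕ → ℕ) (es : List (ℕ × ℕ))
    (hes : ∀ e ∈ es, a e.1 = a e.2 ∧ e.1 < k ∧ e.2 < k) {i j : ℕ} (hi : i < k) (hj : j < k)
    (h : (lab k es).getD i 0 = (lab k es).getD j 0) : a i = a j := by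
  suffices H : ∀ (es : List (ℕ × ℕ)) (L : List ℕ), L.length = k →
      (∀ e ∈ es, a e.1 = a e.2 ∧ e.1 < k ∧ e.2 < k) →
      (∀ i j, i < k → j < k → L.getD i 0 = L.getD j 0 → a i = a j) →
      (∀ i j, i < k → j < k → (es.foldl (fun L e => mergeL L e.1 e.2) L).getD i 0 =
        (es.foldl (fun L e => mergeL L e.1 e.2) L).getD j 0 → a i = a j) by
    refine H es (List.range k) (by simp) hes ?_ i j hi hj h
    intro i j hi hj hij
    simp [List.getD_eq_getElem?_getD, hi, hj] at hij
    rw [hij]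
  intro es
  induction es with
  | nil => intro L _ _ h i j hi hj; simpa using h i j hi hj
  | cons e es ih =>
    intro L hL he hinv
    simp only [List.foldl_cons]
    apply ih (mergeL L e.1 e.2) (by simp [mergeL, hL]) (fun e' he' => he e' (by simp [he']))
    intro i j hi hj hij
    obtain ⟨h1, h2, h3⟩ := he e (by simp)
    have hg : ∀ i, i < k → (mergeL L e.1 e.2).getD i 0 =
        if L.getD i 0 = L.getD e.2 0 then L.getD e.1 0 else L.getD i 0 := by
      intro i hi
      simp [mergeL, List.getD_eq_getElem?_getD, hL, hi]
    rw [hg i hi, hg j hj] at hij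
    split_ifs at hij with c1 c2 c2
    · rw [hinv i _ hi h3 c1, hinv j _ hj h3 c2]
    · rw [hinv i _ hi h3 c1, ← h1, hinv _ j h2 hj hij]
    · rw [hinv j _ hj h3 c2, ← h1, hinv i _ hi h2 hij]
    · exact hinv i j hi hj hij

def dig (n i : ℕ) : ℕ := n / 10 ^ i % 10

/-- Corner labels of a certificate: corners 1 and 2 of cycle vertex `i`. -/
def x1 (k : ℕ) (σ : ℕ → ℕ) (n i : ℕ) : ℕ := if dig n (2 * k + i) == 1 then dig n i else dig n (σ i)
def x2 (k : ℕ) (σ : ℕ → ℕ) (n i : ℕ) : ℕ := if dig n (2 * k + i) == 1 then dig n (σ i) else dig n i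

def edgeB (a b a' b' : ℕ) : Bool := (a == a' && b == b') || (a == b' && b == a')

theorem edgeB_iff {a b a' b' : ℕ} : edgeB a b a' b' = true ↔ EdgeOK a b a' b' := by
  simp [edgeB, EdgeOK]

def nxt (k i : ℕ) : ℕ := if i + 1 == k then 0 else i + 1

def entOK (k : ℕ) (σ : ℕ → ℕ) (n : ℕ) : Bool := (List.range k).all fun i =>
  !(dig n i == dig n (σ i)) && !(dig n (k + i) == dig n i) && !(dig n (k + i) == dig n (σ i)) &&
  edgeB (x2 k σ n i) (dig n (k + i)) (dig n (k + nxt k i)) (x1 k σ n (nxt k i))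

def code (k : ℕ) (σ : ℕ → ℕ) (n : ℕ) : List Bool :=
  (List.range k).map (fun i => dig n (2 * k + i) == 1) ++
  (List.range k).map (fun i => x2 k σ n i == dig n (k + nxt k i))

/-- Distinctness test for lists of Boolean lists. -/
def nodupB : List (List Bool) → Bool
  | [] => true
  | a :: l => l.all (fun b => !(a == b)) && nodupB l

theorem nodupB_iff (l : List (List Bool)) : nodupB l = true ↔ l.Nodup := by
  induction l with
  | nil => simp [nodupB]
  | cons a l ih =>
    simp only [nodupB, Bool.and_eq_true, ih, List.nodup_cons, List.all_eq_true]
    constructor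
    · rintro ⟨h1, h2⟩; exact ⟨fun h => by simpa using h1 a h, h2⟩
    · rintro ⟨h1, h2⟩; exact ⟨fun b hb => by simp; rintro rfl; exact h1 hb, h2⟩

def baseMask (k : ℕ) (σ : ℕ → ℕ) : List Bool := (prs k).map fun p => p.2 == σ p.1 || p.1 == σ p.2

/-- The counting test for all conflict patterns. -/
def cntOK (np : ℕ) (base : List Bool) (cN cC : ℕ) (Nm Cm : List (List Bool)) : Bool :=
  (allB np).all fun l => disj base (l.map not) == false ||
    Nat.ble (cN * Nm.countP (fun m => disj m l)) (cC * Cm.countP (fun m => disj m l))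

noncomputable def stepB (c : Bool) (L : List (List Bool)) : List (List Bool) :=
  List.rec [] (fun m _ ih => List.rec ([] :: ih)
    (fun b m' _ => Bool.rec (m' :: ih) (Bool.rec (m' :: ih) ih b) c) m) L

theorem stepB_count (c : Bool) (l : List Bool) (L : List (List Bool)) :
    L.countP (fun m => disj m (c :: l)) = (stepB c L).countP (fun m => disj m l) := by
  induction L with
  | nil => rfl
  | cons m L ih =>
    rcases m with _ | ⟨b, m⟩
    · have e : stepB c ([] :: L) = [] :: stepB c L := rfl
      rw [e]
      simp [List.countP_cons, ih, disj]
    · have e : stepB c ((b :: m) :: L) = bif c && b then stepB c L else m :: stepB c L := by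
        cases c <;> cases b <;> rfl
      rw [e]
      cases c <;> cases b <;> simp [List.countP_cons, ih, disj]

/-- A faster form of the counting test. -/
noncomputable def cntT (cN cC : ℕ) : List Bool → List (List Bool) → List (List Bool) → Bool
  | [], Nm, Cm => Nat.ble (cN * Nm.length) (cC * Cm.length)
  | b :: base, Nm, Cm => cntT cN cC base (stepB true Nm) (stepB true Cm) &&
      (b || cntT cN cC base (stepB false Nm) (stepB false Cm))

theorem cntT_sound (cN cC : ℕ) (base : List Bool) : ∀ (Nm Cm : List (List Bool)),
    cntT cN cC base Nm Cm = true → ∀ l : List Bool, l.length = base.length →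
    disj base (l.map not) = false ∨
    Nat.ble (cN * Nm.countP (fun m => disj m l)) (cC * Cm.countP (fun m => disj m l)) = true := by
  induction base with
  | nil =>
    intro Nm Cm h l hl
    obtain rfl : l = [] := List.length_eq_zero_iff.1 hl
    right
    have hd : ∀ m : List Bool, disj m [] = true := fun m => by cases m <;> rfl
    have hcp : ∀ L : List (List Bool), L.countP (fun m => disj m []) = L.length := fun L => by
      rw [List.countP_eq_length]; exact fun m _ => hd m
    rw [hcp, hcp]
    exact h
  | cons b base ih =>
    intro Nm Cm h l hl
    rcases l with _ | ⟨c, l⟩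
    · simp at hl
    · simp only [List.length_cons, Nat.add_right_cancel_iff] at hl
      simp only [cntT, Bool.and_eq_true, Bool.or_eq_true] at h
      rw [stepB_count, stepB_count]
      cases c
      · rcases h.2 with hb | h2
        · left; simp [disj, hb]
        · rcases ih _ _ h2 l hl with h3 | h3
          · left; simp [disj, h3]
          · right; exact h3
      · rcases ih _ _ h.1 l hl with h3 | h3
        · left; simp [disj, h3]
        · right; exact h3

theorem allB_length : ∀ (n : ℕ) (l : List Bool), l ∈ allB n → l.length = n := by
  intro n
  induction n with
  | zero => intro l hl; simp [allB] at hl; simp [hl]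
  | succ n ih =>
    intro l hl
    simp only [allB, List.mem_append, List.mem_map] at hl
    rcases hl with ⟨m, hm, rfl⟩ | ⟨m, hm, rfl⟩ <;> simp [ih m hm]

theorem cntT_cntOK (np : ℕ) (base : List Bool) (cN cC : ℕ) (Nm Cm : List (List Bool))
    (hb : base.length = np) (h : cntT cN cC base Nm Cm = true) : cntOK np base cN cC Nm Cm = true := by
  rw [cntOK, List.all_eq_true]
  intro l hl
  rw [Bool.or_eq_true, beq_iff_eq]
  exact cntT_sound cN cC base Nm Cm h l ((allB_length np l hl).trans hb.symm)

/-- Full check for one permutation. -/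
def chk (k cN cC : ℕ) (eqs : (ℕ → ℕ) → List (List (ℕ × ℕ))) (tab : List (ℕ × List ℕ))
    (sl : List ℕ) : Bool :=
  let σ : ℕ → ℕ := fun i => sl.getD i 0
  if (prs k).any (fun p => σ p.1 == σ p.2) || (List.range k).any (fun i => σ i == i) then true else
  match tab.find? (fun e => (List.range k).all fun i => dig e.1 i == σ i) with
  | none => false
  | some e => e.2.all (entOK k σ) && nodupB (e.2.map (code k σ)) &&
      (eqs σ).all (fun l => l.all fun p => Nat.blt p.1 k && Nat.blt p.2 k) &&
      cntOK (prs k).length (baseMask k σ) cN cC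
        ((((eqs σ).map fun l => mask k (fun i => (lab k l).getD i 0))).filter
          fun m => disj m (baseMask k σ))
        (e.2.map fun n => mask k (dig n))

/-- Evaluate a small number before passing it on. -/
def forceN {β : Type} (n : ℕ) (f : ℕ → β) : β :=
  bif Nat.beq n 0 then f 0 else bif Nat.beq n 1 then f 1 else bif Nat.beq n 2 then f 2 else
  bif Nat.beq n 3 then f 3 else bif Nat.beq n 4 then f 4 else f n

theorem forceN_eq {β : Type} (n : ℕ) (f : ℕ → β) : forceN n f = f n := by
  rcases n with _ | _ | _ | _ | _ | n <;> rfl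

/-- Evaluate a list of small numbers before passing it on. -/
def forceL {β : Type} : List ℕ → (List ℕ → β) → β
  | [], f => f []
  | x :: l, f => forceN x fun y => forceL l fun m => f (y :: m)

theorem forceL_eq {β : Type} (l : List ℕ) (f : List ℕ → β) : forceL l f = f l := by
  induction l generalizing f with
  | nil => rfl
  | cons x l ih => simp only [forceL, forceN_eq, ih]

/-- Evaluate a list of Booleans before passing it on. -/
def forceB {β : Type} : List Bool → (List Bool → β) → β
  | [], f => f []
  | true :: l, f => forceB l fun m => f (true :: m)
  | false :: l, f => forceB l fun m => f (false :: m)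

theorem forceB_eq {β : Type} (l : List Bool) (f : List Bool → β) : forceB l f = f l := by
  induction l generalizing f with
  | nil => rfl
  | cons x l ih => cases x <;> simp only [forceB, ih]

/-- List lookup by recursors. -/
noncomputable def nthF (l : List ℕ) : ℕ → ℕ :=
  List.rec (fun _ => 0) (fun x _ ih n => Nat.rec x (fun m _ => ih m) n) l

theorem nthF_eq (l : List ℕ) (n : ℕ) : nthF l n = l.getD n 0 := by
  induction l generalizing n with
  | nil => rfl
  | cons x l ih =>
    rcases n with _ | n
    · rfl
    · exact (ih n).trans (by simp)

/-- Relabelling by recursors, evaluated. -/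
noncomputable def relF {β : Type} (x y : ℕ) (L : List ℕ) : (List ℕ → β) → β :=
  List.rec (fun f => f []) (fun z _ ih f =>
    Bool.rec (ih fun m => f (z :: m)) (ih fun m => f (x :: m)) (Nat.beq z y)) L

theorem relF_eq {β : Type} (x y : ℕ) (L : List ℕ) (f : List ℕ → β) :
    relF x y L f = f (L.map fun z => if z == y then x else z) := by
  induction L generalizing f with
  | nil => rfl
  | cons z L ih =>
    have e : relF x y (z :: L) f = Bool.rec (relF x y L fun m => f (z :: m))
      (relF x y L fun m => f (x :: m)) (Nat.beq z y) := rfl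
    rw [e, ih, ih]
    have h : Nat.beq z y = (z == y) := by rw [Bool.eq_iff_iff]; simp [Nat.beq_eq]
    rw [h, List.map_cons]
    cases z == y <;> rfl

/-- Merging labels, evaluated. -/
noncomputable def labF {β : Type} (es : List (ℕ × ℕ)) : List ℕ → (List ℕ → β) → β :=
  List.rec (fun L f => f L) (fun e _ ih L f =>
    forceN e.1 fun i => forceN e.2 fun j => forceN (nthF L i) fun x => forceN (nthF L j) fun y =>
      relF x y L fun L' => ih L' f) es

theorem labF_eq {β : Type} (es : List (ℕ × ℕ)) (L : List ℕ) (f : List ℕ → β) :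
    labF es L f = f (es.foldl (fun L e => mergeL L e.1 e.2) L) := by
  induction es generalizing L with
  | nil => rfl
  | cons e es ih =>
    have h : labF (e :: es) L f = forceN e.1 fun i => forceN e.2 fun j =>
      forceN (nthF L i) fun x => forceN (nthF L j) fun y =>
      relF x y L fun L' => labF es L' f := rfl
    rw [h]
    simp only [forceN_eq, relF_eq, nthF_eq, List.foldl_cons, ih, mergeL]

/-- The masks of a list of equation systems, evaluated and filtered. -/
noncomputable def nmF {β : Type} (k : ℕ) (base : List Bool) : List (List (ℕ × ℕ)) → (List (List Bool) → β) → β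
  | [], f => f []
  | l :: ls, f => labF l (List.range k) fun L =>
      forceB (mask k (nthF L)) fun m =>
        bif disj m base then nmF k base ls (fun ms => f (m :: ms)) else nmF k base ls f

theorem nmF_eq {β : Type} (k : ℕ) (base : List Bool) (ls : List (List (ℕ × ℕ)))
    (f : List (List Bool) → β) : nmF k base ls f =
    f ((ls.map fun l => mask k (fun i => (lab k l).getD i 0)).filter fun m => disj m base) := by
  induction ls generalizing f with
  | nil => rfl
  | cons l ls ih =>
    have hn : ∀ L : List ℕ, nthF L = fun i => L.getD i 0 := fun L => funext (nthF_eq L)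
    simp only [nmF, forceB_eq, labF_eq, hn, ih, List.map_cons, List.filter_cons, lab]
    cases disj _ base <;> rfl

/-- Faster full check for one permutation. -/
noncomputable def chkF (k cN cC : ℕ) (eqs : (ℕ → ℕ) → List (List (ℕ × ℕ))) (tab : List (ℕ × List ℕ))
    (sl : List ℕ) : Bool := forceL sl fun sl =>
  let σ : ℕ → ℕ := fun i => sl.getD i 0
  if (prs k).any (fun p => σ p.1 == σ p.2) || (List.range k).any (fun i => σ i == i) then true else
  match tab.find? (fun e => (List.range k).all fun i => dig e.1 i == σ i) with
  | none => false
  | some e => e.2.all (entOK k σ) && nodupB (e.2.map (code k σ)) &&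
      (eqs σ).all (fun l => l.all fun p => Nat.blt p.1 k && Nat.blt p.2 k) &&
      forceB (baseMask k σ) fun base => nmF k base (eqs σ) fun nm =>
      cntT cN cC base nm (e.2.map fun n => mask k (dig n))

theorem chkF_chk (k cN cC : ℕ) (eqs : (ℕ → ℕ) → List (List (ℕ × ℕ))) (tab : List (ℕ × List ℕ))
    (sl : List ℕ) (h : chkF k cN cC eqs tab sl = true) : chk k cN cC eqs tab sl = true := by
  unfold chkF at h
  rw [forceL_eq] at h
  simp only [forceB_eq, nmF_eq] at h
  unfold chk
  dsimp only at h ⊢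
  split_ifs at h ⊢ with hc
  · rfl
  · split at h
    · exact absurd h (by simp)
    · rw [Bool.and_eq_true] at h ⊢
      exact ⟨h.1, cntT_cntOK _ _ _ _ _ _ (by simp [baseMask]) h.2⟩

theorem chkF_all (k cN cC : ℕ) (eqs : (ℕ → ℕ) → List (List (ℕ × ℕ))) (tab : List (ℕ × List ℕ))
    (L : List (List ℕ)) (h : L.all (chkF k cN cC eqs tab) = true) :
    L.all (chk k cN cC eqs tab) = true := by
  rw [List.all_eq_true] at h ⊢
  exact fun sl hsl => chkF_chk k cN cC eqs tab sl (h sl hsl)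

def tab2 : List (ℕ × List ℕ) := [
  (1, [112210, 2210])]

def tab3 : List (ℕ × List ℕ) := [
  (21, [111333210, 102210]),
  (102, [111021210, 333210])]

def tab4 : List (ℕ × List ℕ) := [
  (2301, [111100223210, 111133332010, 1100333210, 1133330210, 110011223210, 110033332110, 11333210, 33331210]),
  (321, [111144443210, 20021210, 11222010, 22221010]),
  (2031, [111103223210, 1133330210, 110011220210, 110022220110, 11033210]),
  (1302, [111100213210, 1100222110, 1122220110, 110033332110, 21333210]),
  (1032, [111103213210, 1122220110, 10101233210, 100122221100, 11022221100, 101023013210, 110022220110, 21033210]),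
  (132, [111113213210, 100133332210, 11010012210, 11022221100, 20033210]),
  (2103, [111112212010, 111100221210, 111122221010, 44443210]),
  (1023, [111103313210, 100112212100, 100122221100, 11033332100, 21023210]),
  (123, [111113313210, 111133331210, 100123323210, 100133332210, 11010013210, 11033332100, 20023210, 33332010])]

def tab5 : List (ℕ × List ℕ) := [
  (24301, [111110002243210, 111114444432010, 113203303210, 110233330210, 111001112243210, 111004444432110, 3213313210, 1233331210]),
  (32401, [111112302230210, 111110322232010, 110004443210, 114444403210, 111002312231210, 111001322232110, 1114443210, 4444413210]),
  (34021, [111110033343210, 111114444430210, 1110044443210, 1114444403210, 110002210231210, 110001110232210, 2210213210, 1110223210]),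
  (4321, [111115555543210, 2210210210, 1110220210, 1000221210, 2012212010, 1022221010]),
  (30421, [111110433343210, 1114444403210, 110002210201210, 110001110202210, 2200213210, 1113332010, 3333312010]),
  (24031, [111110032243210, 1110033332210, 1113333302210, 110233330210, 111001112230210, 111003333320110, 110001110232210, 3210313210]),
  (20431, [111110432243210, 1113333302210, 10110234443210, 100113333322010, 11001110222010, 101002300232110, 110001110202210, 3200313210]),
  (2431, [111112432243210, 100114444433210, 11001110222010, 11001000222110, 3000313210, 1113330210, 3333310210]),
  (32041, [111112332230210, 111110033323210, 111113333320210, 114444403210, 111002012201210, 111001022202110, 1110443210]),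
  (20341, [111110442243210, 100112332232010, 100113333322010, 113203303210, 111001112203210, 111003333302110, 11001110332010, 1200331210]),
  (2341, [111112442243210, 111114444423210, 100113443343210, 100114444433210, 11001110332010, 11001000332110, 1110330210, 1000331210]),
  (34102, [111111102130210, 111110002131210, 1111102103210, 1110002113210, 110002233343210, 110004444432210, 2244443210, 4444423210]),
  (14302, [111110002143210, 112102202110, 110122220110, 111004444432110, 3113323210, 2233331210, 3333321210]),
  (31402, [111111302130210, 1110002113210, 110003332110, 113333302110, 111001322232110, 110002233313210, 110003333312210, 2214443210]),
  (14032, [111110032143210, 110122220110, 1013112303210, 110013333321100, 1101022221100, 110102230143210, 111003333320110, 3110323210]),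
  (4132, [111111132143210, 110014444432210, 1102000112210, 1101022221100, 3000323210, 2233330210, 3333320210]),
  (10432, [111110432143210, 10110123332110, 11010112333210, 101012301232100, 1013112303210, 10010113332210, 101102300132210, 110102230103210, 10101123332100, 100102200133210, 101002300232110]),
  (1432, [111111432143210, 100113333322110, 101013412343210, 110013333312210, 1102000112210, 10101123332100, 11001000222110, 2213330210]),
  (31042, [111111332130210, 113333302110, 1010012443210, 110010122212100, 1103333312100, 110101330132210, 111001022202110, 2210443210]),
  (30142, [111110332131210, 1111102103210, 110010233323210, 1101100123210, 1103333312100, 110002233303210, 110003333302210, 2200443210]),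
  (10342, [111110442143210, 112102202110, 11010112443210, 100012102212100, 11103333312100, 100102200133210, 111003333302110, 2200331210]),
  (1342, [111111442143210, 100112332232110, 100113333322110, 100013213323210, 11101000123210, 11103333312100, 11001000332110, 2210330210]),
  (24103, [111111122132010, 111110002231210, 111113333321010, 1111102102210, 1110002112210, 110004444432210, 3244443210]),
  (21403, [111111322132010, 1110002112210, 10111233103210, 100110002122110, 11003333322110, 101003412243210, 110003333312210, 3214443210]),
  (12403, [111110322132010, 100110003133210, 110003331210, 113333301210, 111002312231210, 11002112233210, 11003333322110, 3114443210]),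
  (14023, [111110033143210, 1110033331210, 1113333301210, 110011122132100, 110013333321100, 1102033332100, 110002210231210, 3110223210]),
  (4123, [111111133143210, 111114444431210, 110012233243210, 110014444432210, 1103000113210, 1102033332100, 3000223210, 2033332010]),
  (10423, [111110433143210, 1113333301210, 10010113332210, 100011102122100, 11103333322100, 101103400143210, 110002210201210, 2113332010]),
  (1423, [111111433143210, 110012233213210, 110013333312210, 100012213233210, 11101000133210, 11103333322100, 1103000113210, 2013332010]),
  (21043, [10111233103210, 11010022332110, 101010012233210, 1010012332210, 10010122332100, 101102331132100, 110101330132210, 10101230133210, 100102330132110, 101003012203210, 3210443210]),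
  (12043, [111110033123210, 113333301210, 11010022332110, 100013333322100, 11101021122100, 100103440143210, 111002012201210, 3110443210]),
  (20143, [111110332231210, 1111102102210, 10010233443210, 100013333322010, 11101120122010, 101102331132100, 110003333302210, 3200443210]),
  (2143, [111111133123210, 111112332231210, 111113333321210, 100014444433210, 11101120122010, 11101021122100, 3000443210]),
  (32104, [111111102120210, 111110002121210, 111110222121010, 111112102210210, 111110122212010, 5555543210]),
  (21304, [111111333132010, 111110002213210, 111113333312010, 100110002122110, 100110222120110, 11004444432110, 3213343210]),
  (12304, [111110002123210, 111110333132010, 100110003133210, 100110333130210, 11002112243210, 11004444432110, 3113343210, 4444431210]),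
  (31024, [111111333130210, 111110033313210, 111113333310210, 110010222121100, 110010122212100, 1104444432100, 2210243210]),
  (30124, [111110333131210, 111110133313210, 110010333232210, 110010233323210, 1101100143210, 1104444432100, 2200243210, 4444432010]),
  (10324, [111110444143210, 100011102122100, 100012102212100, 11104444432100, 2200231210, 2112232010, 3333321010]),
  (1324, [111111444143210, 111114444413210, 100012213233210, 100013213323210, 11101000143210, 11104444432100, 2210230210, 2012232010]),
  (21034, [111110032213210, 100110222120110, 101010012233210, 110010222121100, 1103333321100, 10101230143210, 11003333320110, 3210343210]),
  (12034, [111110032123210, 100110333130210, 100012333232100, 100013333322100, 11101021132100, 11002112230210, 11003333320110, 3110343210]),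
  (20134, [111110132213210, 110010333232210, 100012333232010, 100013333322010, 11101120132010, 1101100132210, 1103333321100, 3200343210]),
  (2134, [111111132123210, 111112132213210, 100013444343210, 100014444433210, 11101120132010, 11101021132100, 3000343210, 4444430210])]


/-- Ends as arcs: port `i`, side `s`, with rotation `ρ`. -/
def arcE (k : ℕ) (σ : ℕ → ℕ) (ρ i : ℕ) (s : Bool) : ℕ :=
  if s then (i + ρ) % k else σ ((i + ρ) % k)

def joinE (k : ℕ) (σ : ℕ → ℕ) (ρ i j : ℕ) (t : Bool) : List (ℕ × ℕ) :=
  [(arcE k σ ρ i true, arcE k σ ρ j t), (arcE k σ ρ i false, arcE k σ ρ j (!t))]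

def starE (k : ℕ) (σ : ℕ → ℕ) (ρ o : ℕ) (t : ℕ → Bool) : List (ℕ × ℕ) :=
  (List.range 3).map fun m => (arcE k σ ρ (o + (m + 2) % 3) (t ((m + 2) % 3)),
    arcE k σ ρ (o + (m + 1) % 3) (!t ((m + 1) % 3)))

def eqJ (σ : ℕ → ℕ) (ρ : ℕ) (β : List Bool) : List (ℕ × ℕ) := joinE 2 σ ρ 0 1 (β.getD 0 true)
def eqW (σ : ℕ → ℕ) (ρ : ℕ) (β : List Bool) : List (ℕ × ℕ) :=
  starE 3 σ ρ 0 (fun m => β.getD m true)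
def eqM (σ : ℕ → ℕ) (ρ : ℕ) (β : List Bool) : List (ℕ × ℕ) :=
  joinE 4 σ ρ 0 1 (β.getD 0 true) ++ joinE 4 σ ρ 2 3 (β.getD 1 true)
def eqN (σ : ℕ → ℕ) (ρ : ℕ) (β : List Bool) : List (ℕ × ℕ) :=
  joinE 5 σ ρ 0 1 (β.getD 0 true) ++ starE 5 σ ρ 2 (fun m => β.getD (m + 1) true)

def eqAll (nρ nb : ℕ) (eq : (ℕ → ℕ) → ℕ → List Bool → List (ℕ × ℕ)) (σ : ℕ → ℕ) :
    List (List (ℕ × ℕ)) :=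
  (List.range nρ).flatMap fun ρ => (allB nb).map (eq σ ρ)

set_option maxRecDepth 100000

theorem chk2 : (allN 2 2).all (chk 2 2 1 (eqAll 1 1 eqJ) tab2) = true :=
  chkF_all _ _ _ _ _ _ (by decide +kernel)
theorem chk3 : (allN 3 3).all (chk 3 2 1 (eqAll 1 3 eqW) tab3) = true :=
  chkF_all _ _ _ _ _ _ (by decide +kernel)
theorem chk4 : (allN 4 4).all (chk 4 2 1 (eqAll 2 2 eqM) tab4) = true :=
  chkF_all _ _ _ _ _ _ (by decide +kernel)
theorem chk5 : (allN 5 5).all (chk 5 1 2 (eqAll 5 4 eqN) tab5) = true :=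
  chkF_all _ _ _ _ _ _ (by decide +kernel)

end CiDC

namespace CiDC

/-- The cycle gadget. -/
def cycG (k : ℕ) [NeZero k] : Gad k (Fin k × Fin 3) where
  r := fun x => (x.1, x.2 + 1)
  r3 := by rintro ⟨i, j⟩; fin_cases j <;> rfl
  r_ne := by rintro ⟨i, j⟩; fin_cases j <;> simp
  θ := fun p => match p with
    | Sum.inl i => Sum.inr (i, 0)
    | Sum.inr (i, 0) => Sum.inl i
    | Sum.inr (i, 1) => Sum.inr (i + 1, 2)
    | Sum.inr (i, 2) => Sum.inr (i - 1, 1)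
  θ_inv := by
    rintro (i | ⟨i, j⟩)
    · rfl
    · fin_cases j <;> simp

def codeOf {k : ℕ} (t : Fin k ⊕ (Fin k × Fin 3) → Bool) : List Bool :=
  List.ofFn (fun i => t (Sum.inl i)) ++ List.ofFn (fun i => t (Sum.inr (i, 1)))

theorem nxt_val {k : ℕ} [NeZero k] (i : Fin k) : nxt k i.val = (i + 1).val := by
  have hk := NeZero.pos k
  have hi := i.2
  rw [Fin.val_add, Fin.val_one', Nat.add_mod_mod]
  simp only [nxt, beq_iff_eq]
  split_ifs with h
  · rw [h, Nat.mod_self]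
  · rw [Nat.mod_eq_of_lt (by omega)]

theorem map_range_ofFn {β : Type*} (k : ℕ) (f : ℕ → β) :
    (List.range k).map f = List.ofFn (fun i : Fin k => f i.val) := by
  apply List.ext_getElem <;> simp

theorem cyc_lower {k : ℕ} [NeZero k] {A : Set (Fin k → ℕ)} {σ : Fin k → Fin k} (hA : IsState A σ)
    (σ' : ℕ → ℕ) (hσ' : ∀ i : Fin k, σ' i.val = (σ i).val) (n : ℕ) (hn : entOK k σ' n = true)
    (l : List Bool) (hl : ∀ a : ℕ → ℕ, disj (mask k a) l = true →
      ∀ i j : Fin k, i ≠ j → a i = a j → ∃ b ∈ A, b i = b j)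
    (hm : disj (mask k (dig n)) l = true) :
    ∃ t ∈ (cycG k).fills (arcb σ '' A), codeOf t = code k σ' n := by
  have hLA : (fun i : Fin k => dig n i.val) ∈ A := hA.ext _ (hl _ hm)
  let cI : Fin k × Fin 3 → ℕ := fun x => match x with
    | (i, 0) => dig n (k + i.val)
    | (i, 1) => x1 k σ' n i.val
    | (i, 2) => x2 k σ' n i.val
  simp only [entOK, List.all_eq_true, List.mem_range, Bool.and_eq_true, Bool.not_eq_true',
    beq_eq_false_iff_ne, edgeB_iff] at hn
  have hn' : ∀ i : Fin k, _ := fun i => hn i.val i.2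
  simp only [nxt_val, hσ'] at hn'
  refine ⟨_, ⟨_, ⟨_, hLA, rfl⟩, cI, ?_, ?_, rfl⟩, ?_⟩
  · rintro ⟨i, j⟩
    have := hn' i
    fin_cases j <;> simp only [cycG, cI, x1, x2, hσ'] <;> simp <;> split_ifs <;> grind
  · have e1 : ∀ i : Fin k, EdgeOK (dig n i.val) (dig n (σ i).val) (x1 k σ' n i.val) (x2 k σ' n i.val) := by
      intro i
      simp only [EdgeOK, x1, x2, hσ']
      split_ifs <;> simp
    have es : ∀ {a b c d}, EdgeOK a b c d → EdgeOK c d a b := by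
      intro a b c d h; simp only [EdgeOK] at *; omega
    have es2 : ∀ {a b c d}, EdgeOK a b c d → EdgeOK b a d c := by
      intro a b c d h; simp only [EdgeOK] at *; omega
    rintro (i | ⟨i, j⟩)
    · exact e1 i
    · fin_cases j
      · exact es (e1 i)
      · exact (hn' i).2
      · have := (hn' (i - 1)).2
        rw [sub_add_cancel] at this
        exact es this
  · simp only [codeOf, code, map_range_ofFn]
    congr 2
    · funext i
      have := hn' i
      simp only [cycG, Gad.E, cI, arcb, x1, hσ'] 
      simp
      grind
    · funext i
      simp only [cycG, Gad.E, cI, nxt_val]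
      simp
      grind

theorem countP_filter_map {β γ : Type*} (l : List β) (f : β → γ) (p q : γ → Bool) :
    ((l.map f).filter p).countP q = l.countP (fun b => p (f b) && q (f b)) := by
  rw [List.countP_filter, List.countP_map]
  congr 1
  funext b
  simp [Bool.and_comm]

theorem local_main {k : ℕ} [NeZero k] {I : Type} [Finite I] (cN cC nρ nb : ℕ)
    (eq : (ℕ → ℕ) → ℕ → List Bool → List (ℕ × ℕ)) (tab : List (ℕ × List ℕ))
    (hchk : (allN k k).all (chk k cN cC (eqAll nρ nb eq) tab) = true)
    (Γ : Gad k I) (bits : (Fin k ⊕ I → Bool) → List Bool) (hlen : ∀ t, (bits t).length = nb)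
    (hinj : ∀ t t', t ∘ Γ.θ = t → t' ∘ Γ.θ = t' → bits t = bits t' → t = t')
    (hbits : ∀ (ρ : ℕ) (σ' a' : ℕ → ℕ) (b : Fin k → Bool → ℕ) (cI : I → ℕ) (t : Fin k ⊕ I → Bool),
      (∀ i s, b i s = a' (arcE k σ' ρ i.val s)) → 
      (∀ p, EdgeOK (Γ.E b cI p true) (Γ.E b cI p false)
        (Γ.E b cI (Γ.θ p) true) (Γ.E b cI (Γ.θ p) false)) →
      (fun p => decide (Γ.E b cI p true = Γ.E b cI (Γ.θ p) true)) = t →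
      (∀ p, Γ.E b cI p true ≠ Γ.E b cI p false) →
      ∀ e ∈ eq σ' ρ (bits t), a' e.1 = a' e.2)
    {A : Set (Fin k → ℕ)} {σ : Fin k → Fin k} (hA : IsState A σ) :
    cN * ∑ ρ ∈ Finset.range nρ,
      (Γ.fills ((fun a i s => arcb σ a (i + Fin.ofNat k ρ) s) '' A)).ncard ≤
    cC * ((cycG k).fills (arcb σ '' A)).ncard := by
  classical
  have hk := NeZero.pos k
  set sl : List ℕ := List.ofFn (fun i => (σ i).val) with hsl
  have h := (List.all_eq_true.1 hchk) sl (mem_allN k k sl (by simp [hsl]) (by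
    intro x hx
    simp only [hsl, List.mem_ofFn] at hx
    obtain ⟨i, rfl⟩ := hx
    exact (σ i).2))
  simp only [chk] at h
  set σ' : ℕ → ℕ := fun i => sl.getD i 0 with hσ'd
  have hσ' : ∀ i : Fin k, σ' i.val = (σ i).val := by
    intro i
    simp [hσ'd, hsl, List.getD_eq_getElem?_getD]
  rw [if_neg] at h
  swap
  · simp only [Bool.or_eq_true, List.any_eq_true, beq_iff_eq, not_or, not_exists, not_and,
      List.mem_range, Prod.forall]
    refine ⟨fun i j hij => ?_, fun i hi => ?_⟩
    · rw [mem_prs] at hij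
      have h1 := hσ' ⟨i, by omega⟩
      have h2 := hσ' ⟨j, by omega⟩
      simp only at h1 h2
      change ¬ σ' i = σ' j
      rw [h1, h2]
      intro h3
      have := hA.inj (Fin.ext h3)
      simp at this
      omega
    · have h1 := hσ' ⟨i, hi⟩
      simp only at h1
      change ¬ σ' i = i
      rw [h1]
      intro h3
      exact hA.ne ⟨i, hi⟩ (Fin.ext h3)
  rcases hf : tab.find? (fun e => (List.range k).all fun i => dig e.1 i == σ' i) with _ | e
  · rw [hf] at h; simp at h
  rw [hf] at h
  simp only [Bool.and_eq_true, List.all_eq_true] at h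
  obtain ⟨⟨⟨hok, hnd⟩, hlt⟩, hcnt⟩ := h
  rw [nodupB_iff] at hnd
  -- conflicts
  let conf : ℕ × ℕ → Bool := fun p =>
    decide (¬ ∃ b ∈ A, b (Fin.ofNat k p.1) = b (Fin.ofNat k p.2))
  set l : List Bool := (prs k).map conf with hl
  have hFin : ∀ i : Fin k, Fin.ofNat k i.val = i := fun i => by
    apply Fin.ext; simp [Fin.ofNat, Nat.mod_eq_of_lt i.2]
  have hl1 : ∀ a : ℕ → ℕ, disj (mask k a) l = true →
      ∀ i j : Fin k, i ≠ j → a i = a j → ∃ b ∈ A, b i = b j := by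
    intro a ha i j hij haij
    rw [hl, mask, disj_map] at ha
    rcases lt_or_gt_of_ne hij with hlt | hlt
    · have := ha (i.val, j.val) (mem_prs.2 ⟨hlt, j.2⟩) (by simpa using haij)
      simpa [conf, hFin] using this
    · have := ha (j.val, i.val) (mem_prs.2 ⟨hlt, i.2⟩) (by simpa using haij.symm)
      simp only [conf, hFin, decide_eq_false_iff_not, not_not] at this
      obtain ⟨b, hb, h⟩ := this
      exact ⟨b, hb, h.symm⟩
  simp only [cntOK, List.all_eq_true] at hcnt
  have hc := hcnt l (mem_allB _ _ (by simp [hl]))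
  have hbase : disj (baseMask k σ') (l.map not) = true := by
    rw [hl, List.map_map, baseMask, disj_map]
    rintro ⟨i, j⟩ hij h
    rw [mem_prs] at hij
    simp only [Bool.or_eq_true, beq_iff_eq] at h
    simp only [Function.comp, conf, Bool.not_eq_false', decide_eq_true_eq, not_exists, not_and]
    intro b hb
    have h1 := hσ' ⟨i, by omega⟩
    have h2 := hσ' ⟨j, by omega⟩
    have h3 : Fin.ofNat k i = ⟨i, by omega⟩ := hFin ⟨i, by omega⟩
    have h4 : Fin.ofNat k j = ⟨j, by omega⟩ := hFin ⟨j, by omega⟩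
    simp only at h1 h2
    rw [h3, h4]
    rcases h with h | h
    · have : (⟨j, by omega⟩ : Fin k) = σ ⟨i, by omega⟩ := Fin.ext (h.trans h1)
      rw [this]; exact hA.prop b hb _
    · have : (⟨i, by omega⟩ : Fin k) = σ ⟨j, by omega⟩ := Fin.ext (h.trans h2)
      rw [this]; exact (hA.prop b hb _).symm
  simp only [hbase, Bool.or_eq_true, Nat.ble_eq] at hc
  rcases hc with hc | hc
  · simp at hc
  -- lower
  have hlow : (e.2.map fun n => mask k (dig n)).countP (fun m => disj m l) ≤
      ((cycG k).fills (arcb σ '' A)).ncard := by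
    rw [List.countP_map, List.countP_eq_length_filter]
    set fl := e.2.filter ((fun m => disj m l) ∘ fun n => mask k (dig n)) with hfl
    have h1 : (fl.map (code k σ')).Nodup :=
      hnd.sublist (List.Sublist.map _ List.filter_sublist)
    have h2 : (fl.map (code k σ')).toFinset.card = fl.length := by
      rw [List.toFinset_card_of_nodup h1, List.length_map]
    rw [← h2, ← Set.ncard_coe_finset]
    refine (Set.ncard_le_ncard (t := codeOf '' ((cycG k).fills (arcb σ '' A))) ?_ (Set.toFinite _)).trans
      (Set.ncard_image_le (Set.toFinite _))
    intro c hc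
    simp only [List.coe_toFinset, List.mem_map, Set.mem_ofPred_eq] at hc
    obtain ⟨n, hn, rfl⟩ := hc
    rw [hfl, List.mem_filter] at hn
    exact cyc_lower hA σ' hσ' n (hok n hn.1) l hl1 hn.2
  -- upper
  have hup : ∑ ρ ∈ Finset.range nρ,
      (Γ.fills ((fun a i s => arcb σ a (i + Fin.ofNat k ρ) s) '' A)).ncard ≤
      ((((eqAll nρ nb eq) σ').map fun l => mask k (fun i => (lab k l).getD i 0)).filter
          fun m => disj m (baseMask k σ')).countP (fun m => disj m l) := by
    rw [countP_filter_map, eqAll, List.countP_flatMap]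
    rw [show ∀ f : ℕ → ℕ, (List.map f (List.range nρ)).sum = ∑ ρ ∈ Finset.range nρ, f ρ from
      fun f => rfl]
    apply Finset.sum_le_sum
    intro ρ hρ
    simp only [Function.comp, List.countP_map]
    let P : List Bool → Bool := fun β =>
      disj (mask k fun i => (lab k (eq σ' ρ β)).getD i 0) (baseMask k σ') &&
      disj (mask k fun i => (lab k (eq σ' ρ β)).getD i 0) l
    change _ ≤ List.countP P (allB nb)
    have h2 : (bits '' (Γ.fills ((fun a i s => arcb σ a (i + Fin.ofNat k ρ) s) '' A))).ncard =
        (Γ.fills ((fun a i s => arcb σ a (i + Fin.ofNat k ρ) s) '' A)).ncard := by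
      apply Set.ncard_image_of_injOn
      have key : ∀ t ∈ (Γ.fills ((fun a i s => arcb σ a (i + Fin.ofNat k ρ) s) '' A)),
          t ∘ Γ.θ = t := by
        rintro t ⟨b, -, cI, -, -, rfl⟩
        funext p
        simp only [Function.comp, Γ.θ_inv]
        congr 1
        exact propext ⟨Eq.symm, Eq.symm⟩
      intro t ht t' ht' hb
      exact hinj t t' (key t ht) (key t' ht') hb
    rw [← h2, List.countP_eq_length_filter]
    refine le_trans ?_ (List.toFinset_card_le _)
    rw [← Set.ncard_coe_finset]
    apply Set.ncard_le_ncard _ (Set.toFinite _)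
    rintro β ⟨t, ⟨b, ⟨a, haA, rfl⟩, cI, hcI, hE, ht⟩, rfl⟩
    simp only [List.coe_toFinset, Set.mem_ofPred_eq, List.mem_filter]
    refine ⟨mem_allB _ _ (hlen t), ?_⟩
    have hane : ∀ i, a i ≠ a (σ i) := hA.prop a haA
    have hb := hbits ρ σ' (fun i => a (Fin.ofNat k i)) _ cI t (by
      intro i s
      have hm : Fin.ofNat k ((i.val + ρ) % k) = i + Fin.ofNat k ρ := by
        apply Fin.ext
        simp [Fin.ofNat, Fin.val_add]
      have hm' : ((i.val + ρ) % k) = (i + Fin.ofNat k ρ).val := by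
        rw [← hm]; simp [Fin.ofNat]
      simp only [arcb, arcE]
      cases s
      · simp only [Bool.false_eq_true, if_false]
        rw [hm', hσ', hFin]
      · simp only [if_true]
        rw [hm]) hE ht (by
        rintro (i | x)
        · simpa [Gad.E, arcb] using hane _
        · simpa [Gad.E] using hcI (Γ.r x))
    have hmem : eq σ' ρ (bits t) ∈ eqAll nρ nb eq σ' := by
      simp only [eqAll, List.mem_flatMap, List.mem_map]
      exact ⟨ρ, List.mem_range.2 (Finset.mem_range.1 hρ), bits t, mem_allB _ _ (hlen t), rfl⟩
    have hlt' : ∀ e ∈ eq σ' ρ (bits t), e.1 < k ∧ e.2 < k := by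
      intro e he
      have := hlt _ hmem e he
      simpa [Nat.blt_eq] using this
    have hs : ∀ i j, i < k → j < k → (lab k (eq σ' ρ (bits t))).getD i 0 =
        (lab k (eq σ' ρ (bits t))).getD j 0 → a (Fin.ofNat k i) = a (Fin.ofNat k j) := by
      intro i j hi hj hij
      exact lab_sound k (fun i => a (Fin.ofNat k i)) _
        (fun e he => ⟨hb e he, hlt' e he⟩) hi hj hij
    simp only [P, Bool.and_eq_true]
    constructor
    · rw [mask, baseMask, disj_map]
      rintro ⟨i, j⟩ hij h
      rw [mem_prs] at hij
      have := hs i j (by omega) hij.2 (by simpa using h)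
      have h1 := hσ' ⟨i, by omega⟩
      have h2 := hσ' ⟨j, by omega⟩
      have h3 : Fin.ofNat k i = ⟨i, by omega⟩ := hFin ⟨i, by omega⟩
      have h4 : Fin.ofNat k j = ⟨j, by omega⟩ := hFin ⟨j, by omega⟩
      simp only at h1 h2
      rw [h3, h4] at this
      simp only [Bool.or_eq_false_iff, beq_eq_false_iff_ne]
      constructor
      · intro h5
        have h6 : (⟨j, by omega⟩ : Fin k) = σ ⟨i, by omega⟩ := Fin.ext (h5.trans h1)
        rw [h6] at this; exact hane _ this
      · intro h5
        have h6 : (⟨i, by omega⟩ : Fin k) = σ ⟨j, by omega⟩ := Fin.ext (h5.trans h2)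
        rw [h6] at this; exact hane _ this.symm
    · rw [mask, hl, disj_map]
      rintro ⟨i, j⟩ hij h
      rw [mem_prs] at hij
      have := hs i j (by omega) hij.2 (by simpa using h)
      simp only [conf, decide_eq_false_iff_not, not_not]
      exact ⟨a, haA, this⟩
  calc _ ≤ _ := Nat.mul_le_mul_left cN hup
    _ ≤ _ := hc
    _ ≤ _ := Nat.mul_le_mul_left cC hlow

end CiDC

namespace CiDC

def gadJ : Gad 2 Empty where
  r := id
  r3 := fun x => x.elim
  r_ne := fun x => x.elim
  θ := fun p => match p with
    | Sum.inl 0 => Sum.inl 1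
    | Sum.inl 1 => Sum.inl 0
  θ_inv := by rintro (i | x); · fin_cases i <;> rfl
              · exact x.elim

def gadW : Gad 3 (Fin 3) where
  r := fun x => x + 1
  r3 := by decide
  r_ne := by decide
  θ := fun p => match p with
    | Sum.inl i => Sum.inr i
    | Sum.inr i => Sum.inl i
  θ_inv := by rintro (i | x) <;> rfl

def gadM : Gad 4 Empty where
  r := id
  r3 := fun x => x.elim
  r_ne := fun x => x.elim
  θ := fun p => match p with
    | Sum.inl 0 => Sum.inl 1
    | Sum.inl 1 => Sum.inl 0
    | Sum.inl 2 => Sum.inl 3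
    | Sum.inl 3 => Sum.inl 2
  θ_inv := by rintro (i | x); · fin_cases i <;> rfl
              · exact x.elim

def gadN : Gad 5 (Fin 3) where
  r := fun x => x + 1
  r3 := by decide
  r_ne := by decide
  θ := fun p => match p with
    | Sum.inl 0 => Sum.inl 1
    | Sum.inl 1 => Sum.inl 0
    | Sum.inl 2 => Sum.inr 0
    | Sum.inl 3 => Sum.inr 1
    | Sum.inl 4 => Sum.inr 2
    | Sum.inr 0 => Sum.inl 2
    | Sum.inr 1 => Sum.inl 3
    | Sum.inr 2 => Sum.inl 4
  θ_inv := by rintro (i | x); · fin_cases i <;> rfl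
              · fin_cases x <;> rfl

theorem Gad.edge_eq {k : ℕ} {I : Type} (Γ : Gad k I) (b : Fin k → Bool → ℕ) (cI : I → ℕ)
    (t : Fin k ⊕ I → Bool)
    (h1 : ∀ p, EdgeOK (Γ.E b cI p true) (Γ.E b cI p false)
        (Γ.E b cI (Γ.θ p) true) (Γ.E b cI (Γ.θ p) false))
    (h2 : (fun p => decide (Γ.E b cI p true = Γ.E b cI (Γ.θ p) true)) = t)
    (p : Fin k ⊕ I) :
    Γ.E b cI p true = Γ.E b cI (Γ.θ p) (t p) ∧ Γ.E b cI p false = Γ.E b cI (Γ.θ p) (!t p) := by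
  subst h2
  have := h1 p
  simp only [EdgeOK] at this
  by_cases h : Γ.E b cI p true = Γ.E b cI (Γ.θ p) true
  · simp [h]; grind
  · simp [h]; grind

theorem localJ {A : Set (Fin 2 → ℕ)} {σ : Fin 2 → Fin 2} (hA : IsState A σ) :
    2 * ∑ ρ ∈ Finset.range 1,
      (gadJ.fills ((fun a i s => arcb σ a (i + Fin.ofNat 2 ρ) s) '' A)).ncard ≤
    1 * ((cycG 2).fills (arcb σ '' A)).ncard := by
  refine local_main 2 1 1 1 eqJ tab2 chk2 gadJ (fun t => [t (Sum.inl 0)]) (fun _ => rfl) ?_ ?_ hA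
  · intro t t' h h' hb
    have a1 := congrFun h (Sum.inl 0)
    have a2 := congrFun h' (Sum.inl 0)
    simp [gadJ] at a1 a2 hb
    funext p
    rcases p with i | x
    · fin_cases i <;> simp_all
    · exact x.elim
  · intro ρ σ' a' b cI t hb hE ht hne e he
    have h1 := gadJ.edge_eq b cI t hE ht (Sum.inl 0)
    simp only [gadJ, Gad.E, hb] at h1
    simp only [eqJ, joinE, List.mem_cons, List.not_mem_nil, or_false] at he
    rcases he with rfl | rfl <;> simp_all

theorem localM {A : Set (Fin 4 → ℕ)} {σ : Fin 4 → Fin 4} (hA : IsState A σ) :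
    2 * ∑ ρ ∈ Finset.range 2,
      (gadM.fills ((fun a i s => arcb σ a (i + Fin.ofNat 4 ρ) s) '' A)).ncard ≤
    1 * ((cycG 4).fills (arcb σ '' A)).ncard := by
  refine local_main 2 1 2 2 eqM tab4 chk4 gadM (fun t => [t (Sum.inl 0), t (Sum.inl 2)])
    (fun _ => rfl) ?_ ?_ hA
  · intro t t' h h' hb
    have a1 := congrFun h (Sum.inl 0)
    have a2 := congrFun h' (Sum.inl 0)
    have a3 := congrFun h (Sum.inl 2)
    have a4 := congrFun h' (Sum.inl 2)
    simp [gadM] at a1 a2 a3 a4 hb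
    funext p
    rcases p with i | x
    · fin_cases i <;> simp_all
    · exact x.elim
  · intro ρ σ' a' b cI t hb hE ht hne e he
    have h1 := gadM.edge_eq b cI t hE ht (Sum.inl 0)
    have h2 := gadM.edge_eq b cI t hE ht (Sum.inl 2)
    simp only [gadM, Gad.E, hb] at h1 h2
    simp only [eqM, joinE, List.mem_cons, List.not_mem_nil, or_false, List.mem_append] at he
    rcases he with (rfl | rfl) | (rfl | rfl) <;> simp_all

theorem localW {A : Set (Fin 3 → ℕ)} {σ : Fin 3 → Fin 3} (hA : IsState A σ) :
    2 * ∑ ρ ∈ Finset.range 1,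
      (gadW.fills ((fun a i s => arcb σ a (i + Fin.ofNat 3 ρ) s) '' A)).ncard ≤
    1 * ((cycG 3).fills (arcb σ '' A)).ncard := by
  refine local_main 2 1 1 3 eqW tab3 chk3 gadW
    (fun t => [t (Sum.inl 0), t (Sum.inl 1), t (Sum.inl 2)]) (fun _ => rfl) ?_ ?_ hA
  · intro t t' h h' hb
    have a1 : ∀ j, t (Sum.inr j) = t (Sum.inl j) := fun j => congrFun h (Sum.inl j)
    have a2 : ∀ j, t' (Sum.inr j) = t' (Sum.inl j) := fun j => congrFun h' (Sum.inl j)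
    simp at hb
    funext p
    rcases p with i | x
    · fin_cases i <;> simp_all
    · fin_cases x <;> simp_all
  · intro ρ σ' a' b cI t hb hE ht hne e he
    have h1 := gadW.edge_eq b cI t hE ht (Sum.inl 0)
    have h2 := gadW.edge_eq b cI t hE ht (Sum.inl 1)
    have h3 := gadW.edge_eq b cI t hE ht (Sum.inl 2)
    simp only [gadW, Gad.E, hb] at h1 h2 h3
    simp only [eqW, starE, List.range_succ, List.range_zero, List.nil_append, 
      List.map_cons, List.map_nil, List.cons_append, List.mem_cons, List.not_mem_nil, or_false] at he
    clear hE hb hne ht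
    generalize t (Sum.inl 0) = t0 at *
    generalize t (Sum.inl 1) = t1 at *
    generalize t (Sum.inl 2) = t2 at *
    rcases he with rfl | rfl | rfl <;> cases t0 <;> cases t1 <;> cases t2 <;> simp at * <;> grind

theorem localN {A : Set (Fin 5 → ℕ)} {σ : Fin 5 → Fin 5} (hA : IsState A σ) :
    1 * ∑ ρ ∈ Finset.range 5,
      (gadN.fills ((fun a i s => arcb σ a (i + Fin.ofNat 5 ρ) s) '' A)).ncard ≤
    2 * ((cycG 5).fills (arcb σ '' A)).ncard := by
  refine local_main 1 2 5 4 eqN tab5 chk5 gadN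
    (fun t => [t (Sum.inl 0), t (Sum.inl 2), t (Sum.inl 3), t (Sum.inl 4)]) (fun _ => rfl) ?_ ?_ hA
  · intro t t' h h' hb
    have a1 : t (Sum.inl 1) = t (Sum.inl 0) := congrFun h (Sum.inl 0)
    have a2 : t (Sum.inr 0) = t (Sum.inl 2) := congrFun h (Sum.inl 2)
    have a3 : t (Sum.inr 1) = t (Sum.inl 3) := congrFun h (Sum.inl 3)
    have a4 : t (Sum.inr 2) = t (Sum.inl 4) := congrFun h (Sum.inl 4)
    have b1 : t' (Sum.inl 1) = t' (Sum.inl 0) := congrFun h' (Sum.inl 0)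
    have b2 : t' (Sum.inr 0) = t' (Sum.inl 2) := congrFun h' (Sum.inl 2)
    have b3 : t' (Sum.inr 1) = t' (Sum.inl 3) := congrFun h' (Sum.inl 3)
    have b4 : t' (Sum.inr 2) = t' (Sum.inl 4) := congrFun h' (Sum.inl 4)
    simp at hb
    funext p
    rcases p with i | x
    · fin_cases i <;> simp_all
    · fin_cases x <;> simp_all
  · intro ρ σ' a' b cI t hb hE ht hne e he
    have h0 := gadN.edge_eq b cI t hE ht (Sum.inl 0)
    have h1 := gadN.edge_eq b cI t hE ht (Sum.inl 2)
    have h2 := gadN.edge_eq b cI t hE ht (Sum.inl 3)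
    have h3 := gadN.edge_eq b cI t hE ht (Sum.inl 4)
    simp only [gadN, Gad.E, hb] at h0 h1 h2 h3
    simp only [eqN, joinE, starE, List.range_succ, List.range_zero, List.nil_append, 
      List.map_cons, List.map_nil, List.cons_append, List.mem_cons, List.not_mem_nil, or_false] at he
    clear hE hb hne ht
    rcases he with rfl | rfl | rfl | rfl | rfl
    · simp_all
    · simp_all
    all_goals
      clear h0
      generalize t (Sum.inl 2) = t0 at *
      generalize t (Sum.inl 3) = t1 at *
      generalize t (Sum.inl 4) = t2 at *
      cases t0 <;> cases t1 <;> cases t2 <;> simp at * <;> grind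

/-- Rotate the port numbering. -/
def OG.rot {O : Type*} {k : ℕ} [NeZero k] (G : OG O k) (ρ : Fin k) : OG O k where
  toCG := G.toCG
  q := fun i => G.q (i + ρ)
  q_inj := fun i j h => by simpa using G.q_inj h
  fix_iff := fun d => by
    rw [G.fix_iff]
    constructor
    · rintro ⟨i, rfl⟩; exact ⟨i - ρ, by simp⟩
    · rintro ⟨i, rfl⟩; exact ⟨i + ρ, rfl⟩

theorem OG.nu_local {O : Type*} [Finite O] {k : ℕ} [NeZero k] (G : OG O k) {I : Type} [Finite I]
    (Γ : Gad k I) (cN cC nρ : ℕ)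
    (h : ∀ {A : Set (Fin k → ℕ)} {σ : Fin k → Fin k} (_ : IsState A σ),
      cN * ∑ ρ ∈ Finset.range nρ,
        (Γ.fills ((fun a i s => arcb σ a (i + Fin.ofNat k ρ) s) '' A)).ncard ≤
      cC * ((cycG k).fills (arcb σ '' A)).ncard) :
    cN * ∑ ρ ∈ Finset.range nρ, ((G.rot (Fin.ofNat k ρ)).glue Γ).nu ≤ cC * (G.glue (cycG k)).nu := by
  classical
  have := Fintype.ofFinite O
  simp only [OG.nu_glue]
  rw [Finset.sum_comm, Finset.mul_sum, Finset.mul_sum]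
  apply Finset.sum_le_sum
  intro t _
  by_cases hS : (G.St G.q t).Nonempty
  · obtain ⟨A, σ, hA, hf⟩ := G.state_fills t hS
    have h1 := h hA
    have h2 := hf id (cycG k)
    simp only [Function.comp_id] at h2
    rw [h2]
    refine le_trans (le_of_eq ?_) h1
    congr 1
    apply Finset.sum_congr rfl
    intro ρ _
    exact hf (fun i => i + Fin.ofNat k ρ) Γ
  · have : ∀ ρ : ℕ, (Γ.fills ((G.rot (Fin.ofNat k ρ)).St (G.rot (Fin.ofNat k ρ)).q t)).ncard = 0 := by
      intro ρ
      rw [Set.ncard_eq_zero (Set.toFinite _)]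
      ext u
      simp only [Set.mem_empty_iff_false, iff_false]
      rintro ⟨b, ⟨c, hc, ht, -⟩, -⟩
      exact hS ⟨_, c, hc, ht, rfl⟩
    simp only [this]
    simp

theorem OG.nuJ {O : Type*} [Finite O] (G : OG O 2) :
    2 * ((G.rot 0).glue gadJ).nu ≤ (G.glue (cycG 2)).nu := by
  simpa using G.nu_local gadJ 2 1 1 localJ
theorem OG.nuW {O : Type*} [Finite O] (G : OG O 3) :
    2 * ((G.rot 0).glue gadW).nu ≤ (G.glue (cycG 3)).nu := by
  simpa using G.nu_local gadW 2 1 1 localW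
theorem OG.nuM {O : Type*} [Finite O] (G : OG O 4) :
    2 * (((G.rot 0).glue gadM).nu + ((G.rot 1).glue gadM).nu) ≤ (G.glue (cycG 4)).nu := by
  have := G.nu_local gadM 2 1 2 localM
  rw [one_mul, Finset.sum_range_succ, Finset.sum_range_one] at this
  exact this
theorem OG.nuN {O : Type*} [Finite O] (G : OG O 5) :
    ∑ ρ : Fin 5, ((G.rot ρ).glue gadN).nu ≤ 2 * (G.glue (cycG 5)).nu := by
  have := G.nu_local gadN 1 2 5 localN
  rw [one_mul, Finset.sum_range] at this
  refine le_trans (le_of_eq ?_) this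
  apply Finset.sum_congr rfl
  intro ρ _
  congr 3
  apply Fin.ext; simp [Fin.ofNat, Nat.mod_eq_of_lt ρ.2]

end CiDC

namespace CiDC

/-! ### Cycle space and good graphs -/

/-- The binary cycle space. -/
def CG.cyc {D : Type*} (G : CG D) : Submodule (ZMod 2) (D → ZMod 2) where
  carrier := {g | (∀ d, g (G.α d) = g d) ∧ ∀ d, g d + g (G.r d) + g (G.r (G.r d)) = 0}
  add_mem' := by
    rintro a b ⟨h1, h2⟩ ⟨h3, h4⟩
    refine ⟨fun d => by simp [h1, h3], fun d => ?_⟩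
    have := h2 d
    have := h4 d
    simp only [Pi.add_apply]
    linear_combination h2 d + h4 d
  zero_mem' := by simp
  smul_mem' := by
    rintro c a ⟨h1, h2⟩
    refine ⟨fun d => by simp [h1], fun d => ?_⟩
    simp only [Pi.smul_apply, smul_eq_mul]
    linear_combination c * h2 d

theorem CG.mem_cyc {D : Type*} (G : CG D) (g : D → ZMod 2) : g ∈ G.cyc ↔
    (∀ d, g (G.α d) = g d) ∧ ∀ d, g d + g (G.r d) + g (G.r (G.r d)) = 0 := Iff.rfl

/-- MacLane's property of a space of binary functions. -/
def Mac {D : Type*} (W : Submodule (ZMod 2) (D → ZMod 2)) : Prop :=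
  ∃ l : List (D → ZMod 2), Submodule.span (ZMod 2) {f | f ∈ l} = W ∧
    ∀ d, l.countP (fun f => decide (f d ≠ 0)) ≤ 2

theorem zmod2_cases (a : ZMod 2) : a = 0 ∨ a = 1 := by
  revert a; decide

theorem Mac.inf {D : Type*} {W : Submodule (ZMod 2) (D → ZMod 2)} (h : Mac W) (z : D) :
    Mac (W ⊓ LinearMap.ker (LinearMap.proj z : (D → ZMod 2) →ₗ[ZMod 2] ZMod 2)) := by
  obtain ⟨l, rfl, hl⟩ := h
  set A := l.filter (fun f => decide (f z ≠ 0)) with hA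
  set B := l.filter (fun f => !decide (f z ≠ 0)) with hB
  have hp : (A ++ B).Perm l := List.filter_append_perm _ l
  have hAlen : A.length ≤ 2 := by
    rw [hA, ← List.countP_eq_length_filter]; exact hl z
  have hA1 : ∀ f ∈ A, f z = 1 := by
    intro f hf
    have := (List.mem_filter.1 hf).2
    rcases zmod2_cases (f z) with h | h
    · simp [h] at this
    · exact h
  have hB0 : ∀ f ∈ B, f z = 0 := by
    intro f hf
    simpa using (List.mem_filter.1 hf).2
  have hcnt : ∀ d, A.countP (fun f => decide (f d ≠ 0)) + B.countP (fun f => decide (f d ≠ 0)) ≤ 2 := by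
    intro d
    rw [← List.countP_append, hp.countP_eq]
    exact hl d
  have hspan : {f | f ∈ l} = {f | f ∈ A} ∪ {f | f ∈ B} := by
    ext f
    simp only [Set.mem_ofPred_eq, Set.mem_union]
    rw [← hp.mem_iff, List.mem_append]
  have hBz : Submodule.span (ZMod 2) {f | f ∈ B} ≤
      LinearMap.ker (LinearMap.proj z : (D → ZMod 2) →ₗ[ZMod 2] ZMod 2) := by
    rw [Submodule.span_le]
    intro f hf
    simpa using hB0 f hf
  rw [hspan, Submodule.span_union]
  rcases hA' : A with _ | ⟨f1, _ | ⟨f2, _ | ⟨f3, A'⟩⟩⟩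
  · refine ⟨B, ?_, fun d => le_trans (Nat.le_add_left _ _) (hcnt d)⟩
    simp only [List.not_mem_nil]
    rw [show {f : D → ZMod 2 | False} = ∅ by ext; simp, Submodule.span_empty, bot_sup_eq]
    exact (inf_eq_left.2 hBz).symm
  · refine ⟨B, ?_, fun d => le_trans (Nat.le_add_left _ _) (hcnt d)⟩
    have h1 : f1 z = 1 := hA1 f1 (by simp [hA'])
    apply le_antisymm
    · exact le_inf le_sup_right hBz
    · rintro g ⟨hg, hgz⟩
      obtain ⟨y, hy, w, hw, rfl⟩ := Submodule.mem_sup.1 hg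
      simp only [List.mem_singleton, Set.ofPred_eq_eq_singleton] at hy
      obtain ⟨c, rfl⟩ := Submodule.mem_span_singleton.1 hy
      have hwz := hBz hw
      simp only [SetLike.mem_coe, LinearMap.mem_ker, LinearMap.proj_apply, Pi.add_apply, Pi.smul_apply, h1, smul_eq_mul,
        mul_one] at hgz hwz
      rw [hwz, add_zero] at hgz
      simpa [hgz] using hw
  · refine ⟨(f1 + f2) :: B, ?_, fun d => ?_⟩
    · have h1 : f1 z = 1 := hA1 f1 (by simp [hA'])
      have h2 : f2 z = 1 := hA1 f2 (by simp [hA'])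
      have hm1 : f1 ∈ Submodule.span (ZMod 2) {f | f ∈ [f1, f2]} := Submodule.subset_span (by simp)
      have hm2 : f2 ∈ Submodule.span (ZMod 2) {f | f ∈ [f1, f2]} := Submodule.subset_span (by simp)
      apply le_antisymm
      · rw [Submodule.span_le]
        intro f hf
        simp only [List.mem_cons, Set.mem_ofPred_eq] at hf
        rcases hf with rfl | hf
        · refine ⟨Submodule.mem_sup_left (add_mem hm1 hm2), ?_⟩
          simp [h1, h2]
          decide
        · exact ⟨Submodule.mem_sup_right (Submodule.subset_span hf), hBz (Submodule.subset_span hf)⟩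
      · rintro g ⟨hg, hgz⟩
        obtain ⟨y, hy, w, hw, rfl⟩ := Submodule.mem_sup.1 hg
        rw [show {f | f ∈ [f1, f2]} = {f1, f2} by ext; simp] at hy
        obtain ⟨c, c', rfl⟩ := Submodule.mem_span_pair.1 hy
        have hwz := hBz hw
        simp only [SetLike.mem_coe, LinearMap.mem_ker, LinearMap.proj_apply, Pi.add_apply, Pi.smul_apply, h1, h2,
          smul_eq_mul, mul_one] at hgz hwz
        rw [hwz, add_zero] at hgz
        have hc : c' = c := by
          rcases zmod2_cases c with rfl | rfl <;> rcases zmod2_cases c' with rfl | rfl <;>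
            first | rfl | simp at hgz
        rw [hc, ← smul_add]
        apply add_mem
        · exact Submodule.smul_mem _ _ (Submodule.subset_span (by simp))
        · exact Submodule.span_mono (fun f hf => by simp only [Set.mem_ofPred_eq] at hf ⊢; simp [hf]) hw
    · have := hcnt d
      rw [hA'] at this
      simp only [List.countP_cons, List.countP_nil, Pi.add_apply] at this ⊢
      generalize List.countP (fun f => decide (f d ≠ 0)) B = n at this ⊢
      rcases zmod2_cases (f1 d) with h | h <;> rcases zmod2_cases (f2 d) with h' | h' <;>
        simp [h, h', show (1 + 1 : ZMod 2) = 0 from rfl] at this ⊢ <;> omega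
  · rw [hA'] at hAlen; simp at hAlen

theorem Mac.map {D D' : Type*} {W : Submodule (ZMod 2) (D → ZMod 2)} (h : Mac W) (ρ : D' → D)
    (W' : Submodule (ZMod 2) (D' → ZMod 2)) (h1 : ∀ g ∈ W, g ∘ ρ ∈ W')
    (h2 : ∀ g' ∈ W', ∃ g ∈ W, g ∘ ρ = g') : Mac W' := by
  obtain ⟨l, rfl, hl⟩ := h
  refine ⟨l.map (fun f => f ∘ ρ), ?_, fun d => ?_⟩
  · have : {f | f ∈ l.map (fun f => f ∘ ρ)} = (LinearMap.funLeft (ZMod 2) (ZMod 2) ρ) '' {f | f ∈ l} := by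
      ext f; simp [LinearMap.funLeft, LinearMap.coe_mk]
    rw [this, Submodule.span_image]
    ext g
    rw [Submodule.mem_map]
    constructor
    · rintro ⟨f, hf, rfl⟩; exact h1 f hf
    · intro hg; obtain ⟨f, hf, rfl⟩ := h2 g hg; exact ⟨f, hf, rfl⟩
  · rw [List.countP_map]; exact hl (ρ d)

/-- Closed, connected, bridgeless and planar (via MacLane). -/
structure CG.Good {D : Type*} (G : CG D) : Prop where
  fpf : ∀ d, G.α d ≠ d
  cut : ∀ x : D → Bool, (∀ d, x (G.r d) = x d) → ∀ d0,
    (∀ d, x d ≠ x (G.α d) → d = d0 ∨ d = G.α d0) → ∀ d d', x d = x d'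
  mac : Mac G.cyc

/-- Isomorphism up to local orientation. -/
structure WIso {D D' : Type*} (G : CG D) (G' : CG D') where
  e : D ≃ D'
  hα : ∀ d, e (G.α d) = G'.α (e d)
  hr : ∀ d, e (G.r d) = G'.r (e d) ∨ e (G.r d) = G'.r (G'.r (e d))

namespace WIso
variable {D D' : Type*} {G : CG D} {G' : CG D'}

theorem hrr (w : WIso G G') (d : D) :
    (w.e (G.r d) = G'.r (w.e d) ∧ w.e (G.r (G.r d)) = G'.r (G'.r (w.e d))) ∨
    (w.e (G.r d) = G'.r (G'.r (w.e d)) ∧ w.e (G.r (G.r d)) = G'.r (w.e d)) := by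
  have hne : w.e (G.r (G.r d)) ≠ w.e d := fun h => G.rr_ne d (w.e.injective h)
  rcases w.hr d with h | h
  · refine Or.inl ⟨h, ?_⟩
    rcases w.hr (G.r d) with h2 | h2
    · rw [h2, h]
    · rw [h2, h, G'.r3] at hne; exact absurd rfl hne
  · refine Or.inr ⟨h, ?_⟩
    rcases w.hr (G.r d) with h2 | h2
    · rw [h2, h, G'.r3] at hne; exact absurd rfl hne
    · rw [h2, h, G'.r3]

def symm (w : WIso G G') : WIso G' G where
  e := w.e.symm
  hα := fun d => by
    apply w.e.injective
    rw [w.hα]; simp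
  hr := fun d => by
    rcases w.hrr (w.e.symm d) with ⟨h, h'⟩ | ⟨h, h'⟩
    · left; apply w.e.injective; rw [h]; simp
    · right; apply w.e.injective; rw [h']; simp

theorem good (w : WIso G G') (h : G'.Good) : G.Good where
  fpf := fun d hd => h.fpf (w.e d) (by rw [← w.hα, hd])
  cut := by
    intro x hx d0 hc d d'
    have hx2 : ∀ d, x (G.r (G.r d)) = x d := fun d => by rw [hx, hx]
    have := h.cut (fun y => x (w.e.symm y)) (by
      intro y
      rcases w.symm.hr y with h | h
      · have h : w.e.symm (G'.r y) = G.r (w.e.symm y) := h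
        simp only [h, hx]
      · have h : w.e.symm (G'.r y) = G.r (G.r (w.e.symm y)) := h
        simp only [h, hx]) (w.e d0) (by
      intro y hy
      have h1 : w.e.symm (G'.α y) = G.α (w.e.symm y) := w.symm.hα y
      simp only [h1] at hy
      rcases hc _ hy with h | h
      · left; rw [← h]; simp
      · right; rw [← w.hα, ← h]; simp) (w.e d) (w.e d')
    simpa using this
  mac := by
    have key : ∀ {D D' : Type _} {G : CG D} {G' : CG D'} (w : WIso G G') (g : D' → ZMod 2),
        g ∈ G'.cyc → g ∘ w.e ∈ G.cyc := by
      rintro D D' G G' w g ⟨h1, h2⟩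
      refine ⟨fun d => by simp [w.hα, h1], fun d => ?_⟩
      have := h2 (w.e d)
      simp only [Function.comp]
      rcases w.hrr d with ⟨h, h'⟩ | ⟨h, h'⟩
      · rw [h, h', this]
      · rw [h, h']; linear_combination this
    refine h.mac.map w.e _ (fun g hg => key w g hg) (fun g hg => ⟨g ∘ w.e.symm, ?_, ?_⟩)
    · obtain ⟨h1, h2⟩ := hg
      refine ⟨fun d => ?_, fun d => ?_⟩
      · have : w.e.symm (G'.α d) = G.α (w.e.symm d) := w.symm.hα d
        simp [this, h1]
      · have := h2 (w.e.symm d)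
        simp only [Function.comp]
        rcases w.symm.hrr d with ⟨h, h'⟩ | ⟨h, h'⟩ <;> 
        simp only [symm] at h h' <;> rw [h, h'] <;> linear_combination this
    · funext d; simp

theorem nu_le [Finite D] (w : WIso G G') : G'.nu ≤ G.nu := by
  classical
  have : Finite D' := Finite.of_equiv D w.e
  let s : D → Bool := fun d => decide (w.e (G.r d) = G'.r (w.e d))
  apply Set.ncard_le_ncard_of_injOn (fun (t : D' → Bool) (d : D) =>
    (t (w.e d)).xor ((s d).xor (s (G.α d)))) _ _ (Set.toFinite _)
  · rintro t ⟨c, hc, rfl⟩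
    have hne : ∀ d, c (G'.r (w.e d)) ≠ c (G'.r (G'.r (w.e d))) := fun d => hc.1 _
    have hE : ∀ d, EdgeOK (c (w.e (G.r d))) (c (w.e (G.r (G.r d)))) (c (w.e (G.r (G.α d))))
        (c (w.e (G.r (G.r (G.α d))))) := by
      intro d
      have h2 := hc.2 (w.e d)
      simp only [EdgeOK] at h2 ⊢
      rcases w.hrr d with ⟨h, h'⟩ | ⟨h, h'⟩ <;> rcases w.hrr (G.α d) with ⟨k, k'⟩ | ⟨k, k'⟩ <;>
      rw [h, h', k, k', w.hα] <;> tauto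
    refine ⟨c ∘ w.e, ⟨fun d => ?_, hE⟩, ?_⟩
    · simp only [Function.comp]
      have h3 := hc.1 (w.e d)
      have h4 := hc.1 (G'.r (G'.r (w.e d)))
      rw [G'.r3] at h4
      rcases w.hr d with h | h <;> rw [h]
      · exact h3
      · exact h4.symm
    · funext d
      have h2 := hc.2 (w.e d)
      have n1 := hne d
      have n2 := hne (G.α d)
      have n3 := G'.r_ne_rr (w.e d)
      have n4 := G'.r_ne_rr (w.e (G.α d))
      simp only [EdgeOK] at h2
      simp only [CG.tw, Function.comp, s]
      rw [← w.hα] at h2 ⊢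
      rcases w.hrr d with ⟨h, h'⟩ | ⟨h, h'⟩ <;> rcases w.hrr (G.α d) with ⟨k, k'⟩ | ⟨k, k'⟩ <;>
      simp only [h, k] <;> simp [n3, n4, n3.symm, n4.symm] <;> grind
  · intro t _ t' _ h
    funext y
    have := congrFun h (w.e.symm y)
    simpa using this

end WIso
end CiDC

namespace CiDC

theorem extract {D : Type*} (G : CG D) (fpf : ∀ d, G.α d ≠ d) {k : ℕ} {I : Type} (Γ : Gad k I)
    (ι : I → D) (hι : Function.Injective ι)
    (hport : ∀ i, ∃ y, Γ.θ (Sum.inl i) = Sum.inr y)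
    (hr : ∀ x, G.r (ι x) = ι (Γ.r x) ∨ G.r (ι x) = ι (Γ.r (Γ.r x)))
    (hin : ∀ x y, Γ.θ (Sum.inr x) = Sum.inr y → G.α (ι x) = ι y)
    (hout : ∀ x i, Γ.θ (Sum.inr x) = Sum.inl i → G.α (ι x) ∉ Set.range ι) :
    ∃ (G' : OG {d // d ∉ Set.range ι} k) (w : WIso G (G'.glue Γ)),
      (∀ x, w.e (ι x) = Sum.inr x) ∧ ∀ d (h : d ∉ Set.range ι), w.e d = Sum.inl ⟨d, h⟩ := by
  classical
  choose y hy using hport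
  have hy' : ∀ i, Γ.θ (Sum.inr (y i)) = Sum.inl i := fun i => by rw [← hy, Γ.θ_inv]
  have hrr : ∀ x, G.r (ι x) ∈ Set.range ι := by
    intro x; rcases hr x with h | h <;> rw [h] <;> exact Set.mem_range_self _
  have hrO : ∀ d, d ∉ Set.range ι → G.r d ∉ Set.range ι := by
    rintro d hd ⟨x, hx⟩
    apply hd
    obtain ⟨x', hx'⟩ := hrr x
    rw [← G.r3 d, ← hx, ← hx']
    exact hrr _
  let O := {d // d ∉ Set.range ι}
  let αO : O → O := fun d => if h : G.α d.1 ∉ Set.range ι then ⟨G.α d.1, h⟩ else d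
  have αO_pos : ∀ d : O, G.α d.1 ∉ Set.range ι → (αO d).1 = G.α d.1 := by
    intro d h; simp only [αO]; rw [dif_pos h]
  have αO_neg : ∀ d : O, G.α d.1 ∈ Set.range ι → αO d = d := by
    intro d h; simp only [αO]; rw [dif_neg (not_not.2 h)]
  have hfix : ∀ d : O, αO d = d ↔ G.α d.1 ∈ Set.range ι := by
    intro d
    constructor
    · intro h
      by_contra h2
      have := αO_pos d h2
      rw [h] at this
      exact fpf _ this.symm
    · exact αO_neg d
  let q : Fin k → O := fun i => ⟨G.α (ι (y i)), hout _ i (hy' i)⟩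
  have hx_port : ∀ x, G.α (ι x) ∉ Set.range ι → ∃ i, y i = x := by
    intro x hx
    rcases hc : Γ.θ (Sum.inr x) with i | z
    · refine ⟨i, ?_⟩
      have : Γ.θ (Sum.inl i) = Sum.inr x := by rw [← hc, Γ.θ_inv]
      rw [hy] at this
      simpa using this
    · exact absurd ⟨z, (hin x z hc).symm⟩ hx
  let G' : OG O k :=
    { α := αO
      r := fun d => ⟨G.r d.1, hrO _ d.2⟩
      α_inv := by
        intro d
        by_cases h : G.α d.1 ∈ Set.range ι
        · rw [αO_neg d h, αO_neg d h]
        · apply Subtype.ext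
          have h1 := αO_pos d h
          rw [αO_pos _ (by rw [h1, G.α_inv]; exact d.2), h1, G.α_inv]
      r3 := fun d => Subtype.ext (G.r3 d.1)
      r_ne := fun d h => G.r_ne d.1 (congrArg Subtype.val h)
      q := q
      q_inj := by
        intro i j h
        have h1 : y i = y j := hι (G.α_inj (congrArg Subtype.val h))
        have := hy' i
        rw [h1, hy'] at this
        simpa using this.symm
      fix_iff := by
        intro d
        rw [hfix]
        constructor
        · rintro ⟨x, hx⟩
          have hd : G.α (ι x) = d.1 := by rw [hx, G.α_inv]
          obtain ⟨i, rfl⟩ := hx_port x (by rw [hd]; exact d.2)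
          exact ⟨i, Subtype.ext hd.symm⟩
        · rintro ⟨i, rfl⟩
          exact ⟨y i, by simp only [q]; rw [G.α_inv]⟩ }
  let f : O ⊕ I → D := Sum.elim Subtype.val ι
  have hf : Function.Bijective f := by
    constructor
    · rintro (a | a) (b | b) h
      · exact congrArg _ (Subtype.ext h)
      · exact absurd ⟨b, h.symm⟩ a.2
      · exact absurd ⟨a, h⟩ b.2
      · exact congrArg _ (hι h)
    · intro d
      by_cases h : d ∈ Set.range ι
      · obtain ⟨x, rfl⟩ := h; exact ⟨Sum.inr x, rfl⟩
      · exact ⟨Sum.inl ⟨d, h⟩, rfl⟩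
  let w : WIso (G'.glue Γ) G :=
    { e := Equiv.ofBijective f hf
      hα := by
        intro z
        simp only [Equiv.ofBijective_apply]
        rcases G'.cases_emb z with ⟨p, rfl⟩ | ⟨d, rfl, hd⟩
        · rw [OG.glue_α_emb]
          rcases p with i | x
          · rw [hy]
            change ι (y i) = G.α (G.α (ι (y i)))
            rw [G.α_inv]
          · rcases hc : Γ.θ (Sum.inr x) with i | z
            · change G.α (ι (y i)) = G.α (ι x)
              have : Γ.θ (Sum.inl i) = Sum.inr x := by rw [← hc, Γ.θ_inv]
              rw [hy] at this
              rw [Sum.inr_injective this]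
            · exact (hin x z hc).symm
        · rw [OG.glue_α_inl _ _ _ hd]
          change (αO d).1 = G.α d.1
          apply αO_pos
          intro h
          have := (G'.fix_iff d).1 (αO_neg d h)
          obtain ⟨i, hi⟩ := this
          exact hd i hi
      hr := by
        rintro (d | x)
        · exact Or.inl rfl
        · have h1 : G.r (G.r (ι x)) = ι (Γ.r x) ∨ G.r (ι x) = ι (Γ.r x) := by
            rcases hr x with h | h
            · exact Or.inr h
            · left
              rw [h]
              rcases hr (Γ.r (Γ.r x)) with h2 | h2
              · rw [Γ.r3] at h2
                exfalso
                have h3 : G.r (G.r (ι x)) = ι x := by rw [h, h2]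
                exact G.rr_ne _ h3
              · rw [h2, Γ.r3]
          change ι (Γ.r x) = G.r (ι x) ∨ ι (Γ.r x) = G.r (G.r (ι x))
          rcases h1 with h | h
          · exact Or.inr h.symm
          · exact Or.inl h.symm }
  refine ⟨G', w.symm, fun x => ?_, fun d h => ?_⟩
  · change (Equiv.ofBijective f hf).symm (ι x) = _
    rw [Equiv.symm_apply_eq]; rfl
  · change (Equiv.ofBijective f hf).symm d = _
    rw [Equiv.symm_apply_eq]; rfl

theorem nu_eq_of_wiso {D D' : Type*} [Finite D] {G : CG D} {G' : CG D'} (w : WIso G G') :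
    G'.nu = G.nu := by
  have : Finite D' := Finite.of_equiv D w.e
  exact le_antisymm w.nu_le w.symm.nu_le

/-- Rotating ports does not change the cycle gadget graph. -/
noncomputable def OG.rotIso {O : Type*} {k : ℕ} [NeZero k] (G : OG O k) (ρ : Fin k) :
    WIso ((G.rot ρ).glue (cycG k)) (G.glue (cycG k)) where
  e := Equiv.sumCongr (Equiv.refl O) (Equiv.prodCongr (Equiv.addRight ρ) (Equiv.refl (Fin 3)))
  hα := by
    intro z
    rcases (G.rot ρ).cases_emb z with ⟨p, rfl⟩ | ⟨d, rfl, hd⟩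
    · rw [OG.glue_α_emb]
      have h : ∀ p : Fin k ⊕ (Fin k × Fin 3), (Equiv.sumCongr (Equiv.refl O) (Equiv.prodCongr (Equiv.addRight ρ) (Equiv.refl (Fin 3))))
        ((G.rot ρ).emb p) = G.emb (Sum.map (· + ρ) (Prod.map (· + ρ) id) p) := by
        rintro (i | ⟨i, j⟩) <;> rfl
      rw [h, h, OG.glue_α_emb]
      congr 1
      rcases p with i | ⟨i, j⟩
      · rfl
      · fin_cases j <;> simp [cycG] <;> abel
    · rw [OG.glue_α_inl _ _ _ hd]
      change _ = (G.glue (cycG k)).α (Sum.inl d)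
      rw [OG.glue_α_inl]
      · rfl
      · intro i hi
        exact hd (i - ρ) (by rw [hi]; simp [OG.rot])
  hr := by
    rintro (d | ⟨i, j⟩) <;> exact Or.inl rfl

end CiDC

namespace CiDC
namespace OG
variable {O : Type*} {k : ℕ} {I : Type}

theorem emb_inj (G : OG O k) : Function.Injective (G.emb (I := I)) := by
  rintro (i | x) (j | y) h
  · exact congrArg _ (G.q_inj (Sum.inl_injective h))
  · cases h
  · cases h
  · exact congrArg _ (Sum.inr_injective h)

theorem glue_fpf (G : OG O k) (Γ : Gad k I) (h : ∀ p, Γ.θ p ≠ p) (y : O ⊕ I) :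
    (G.glue Γ).α y ≠ y := by
  rcases G.cases_emb y with ⟨p, rfl⟩ | ⟨d, rfl, hd⟩
  · rw [glue_α_emb]
    exact fun h' => h p (G.emb_inj h')
  · rw [glue_α_inl _ _ _ hd]
    intro h'
    obtain ⟨i, hi⟩ := (G.fix_iff d).1 (Sum.inl_injective h')
    exact hd i hi

theorem mem_cyc_glue (G : OG O k) (Γ : Gad k I) (g : O ⊕ I → ZMod 2) : g ∈ (G.glue Γ).cyc ↔
    (∀ d, (∀ i, d ≠ G.q i) → g (Sum.inl (G.α d)) = g (Sum.inl d)) ∧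
    (∀ d, g (Sum.inl d) + g (Sum.inl (G.r d)) + g (Sum.inl (G.r (G.r d))) = 0) ∧
    (∀ p, g (G.emb (Γ.θ p)) = g (G.emb p)) ∧
    (∀ x, g (Sum.inr x) + g (Sum.inr (Γ.r x)) + g (Sum.inr (Γ.r (Γ.r x))) = 0) := by
  rw [CG.mem_cyc]
  constructor
  · rintro ⟨h1, h2⟩
    refine ⟨fun d hd => ?_, fun d => h2 (Sum.inl d), fun p => ?_, fun x => h2 (Sum.inr x)⟩
    · rw [← h1 (Sum.inl d), glue_α_inl _ _ _ hd]
    · rw [← h1 (G.emb p), glue_α_emb]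
  · rintro ⟨h1, h2, h3, h4⟩
    refine ⟨fun y => ?_, ?_⟩
    · rcases G.cases_emb y with ⟨p, rfl⟩ | ⟨d, rfl, hd⟩
      · rw [glue_α_emb, h3]
      · rw [glue_α_inl _ _ _ hd, h1 d hd]
    · rintro (d | x)
      · exact h2 d
      · exact h4 x

/-- Cutting with the cycle contracted. -/
theorem K_cut [NeZero k] (G : OG O k) (hK : (G.glue (cycG k)).Good) (x : O → Bool)
    (hx : ∀ d, x (G.r d) = x d) (v : Bool) (d0 : O)
    (h1 : ∀ d, (∀ i, d ≠ G.q i) → x d ≠ x (G.α d) → d = d0 ∨ d = G.α d0)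
    (h2 : ∀ i, x (G.q i) ≠ v → G.q i = d0) (d : O) : x d = v := by
  refine hK.cut (Sum.elim x (fun _ => v)) ?_ (Sum.inl d0) ?_ (Sum.inl d) (Sum.inr (0, 0))
  · rintro (d | y)
    · exact hx d
    · rfl
  · intro y hy
    rcases G.cases_emb y with ⟨p, rfl⟩ | ⟨d, rfl, hd⟩
    · rw [glue_α_emb] at hy
      rcases p with i | ⟨i, j⟩
      · left
        exact congrArg _ (h2 i hy)
      · fin_cases j
        · right
          have := h2 i (Ne.symm hy)
          rw [← this, glue_α_q]; rfl
        · exact absurd rfl hy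
        · exact absurd rfl hy
    · rw [glue_α_inl _ _ _ hd] at hy
      rcases h1 d hd hy with rfl | h
      · left; rfl
      · right
        by_cases h' : ∃ i, d0 = G.q i
        · obtain ⟨i, rfl⟩ := h'
          have := (G.fix_iff (G.q i)).2 ⟨i, rfl⟩
          rw [this] at h
          exact absurd h (hd i)
        · rw [glue_α_inl _ _ _ (fun i hi => h' ⟨i, hi⟩), h]

theorem glue_cut_cases (G : OG O k) (Γ : Gad k I) (x : O ⊕ I → Bool) (y0 : O ⊕ I)
    (h : ∀ y, x y ≠ x ((G.glue Γ).α y) → y = y0 ∨ y = (G.glue Γ).α y0) :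
    (∃ d0, (∀ d, (∀ i, d ≠ G.q i) → x (Sum.inl d) ≠ x (Sum.inl (G.α d)) → d = d0 ∨ d = G.α d0) ∧
      ∀ p, x (G.emb p) = x (G.emb (Γ.θ p))) ∨
    (∃ p0, (∀ d, (∀ i, d ≠ G.q i) → x (Sum.inl d) = x (Sum.inl (G.α d))) ∧
      ∀ p, x (G.emb p) ≠ x (G.emb (Γ.θ p)) → p = p0 ∨ p = Γ.θ p0) := by
  rcases G.cases_emb y0 with ⟨p0, rfl⟩ | ⟨d0, rfl, hd0⟩
  · right
    refine ⟨p0, fun d hd => ?_, fun p hp => ?_⟩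
    · by_contra hne
      have hh := h (Sum.inl d) (by rwa [glue_α_inl _ _ _ hd])
      rw [glue_α_emb] at hh
      rcases hh with hh | hh
      · rcases p0 with i | z
        · exact hd i (Sum.inl_injective hh)
        · cases hh
      · rcases hz : Γ.θ p0 with i | z
        · rw [hz] at hh; exact hd i (Sum.inl_injective hh)
        · rw [hz] at hh; cases hh
    · have hh := h (G.emb p) (by rwa [glue_α_emb])
      rw [glue_α_emb] at hh
      rcases hh with hh | hh
      · exact Or.inl (G.emb_inj hh)
      · exact Or.inr (G.emb_inj hh)
  · left
    refine ⟨d0, fun d hd hne => ?_, fun p => ?_⟩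
    · have hh := h (Sum.inl d) (by rwa [glue_α_inl _ _ _ hd])
      rw [glue_α_inl _ _ _ hd0] at hh
      rcases hh with hh | hh
      · exact Or.inl (Sum.inl_injective hh)
      · exact Or.inr (Sum.inl_injective hh)
    · by_contra hne
      have hh := h (G.emb p) (by rwa [glue_α_emb])
      rw [glue_α_inl _ _ _ hd0] at hh
      rcases p with i | z
      · rcases hh with hh | hh
        · exact hd0 i (Sum.inl_injective hh).symm
        · exact G.α_not_port hd0 i (Sum.inl_injective hh).symm
      · rcases hh with hh | hh <;> cases hh

/-- Flow values on the cycle gadget. -/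
def mkCyc [NeZero k] (G : OG O k) (g : O → ZMod 2) (y : Fin k → ZMod 2) :
    O ⊕ (Fin k × Fin 3) → ZMod 2
  | Sum.inl d => g d
  | Sum.inr (i, 0) => g (G.q i)
  | Sum.inr (i, 1) => y i
  | Sum.inr (i, 2) => y (i - 1)

theorem zz (a : ZMod 2) : a + a = 0 := by revert a; decide

theorem mkCyc_mem [NeZero k] (G : OG O k) (g : O → ZMod 2) (y : Fin k → ZMod 2)
    (h1 : ∀ d, (∀ i, d ≠ G.q i) → g (G.α d) = g d)
    (h2 : ∀ d, g d + g (G.r d) + g (G.r (G.r d)) = 0)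
    (h3 : ∀ i, g (G.q i) = y i + y (i - 1)) : G.mkCyc g y ∈ (G.glue (cycG k)).cyc := by
  rw [mem_cyc_glue]
  refine ⟨h1, h2, ?_, ?_⟩
  · rintro (i | ⟨i, j⟩)
    · rfl
    · fin_cases j <;> simp [cycG, emb, mkCyc]
  · rintro ⟨i, j⟩
    have := h3 i
    fin_cases j <;> simp [cycG, mkCyc, this]
    · linear_combination zz (y i) + zz (y (i - 1))
    · linear_combination zz (y i) + zz (y (i - 1))
    · linear_combination zz (y i) + zz (y (i - 1))

theorem mem_cycK [NeZero k] (G : OG O k) {g : O ⊕ (Fin k × Fin 3) → ZMod 2}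
    (hg : g ∈ (G.glue (cycG k)).cyc) (i : Fin k) :
    g (Sum.inr (i, 0)) = g (Sum.inl (G.q i)) ∧
    g (Sum.inl (G.q i)) = g (Sum.inr (i, 1)) + g (Sum.inr (i - 1, 1)) := by
  obtain ⟨-, -, h3, h4⟩ := (G.mem_cyc_glue _ _).1 hg
  have a := h3 (Sum.inl i)
  have b := h3 (Sum.inr (i, 2))
  have c := h4 (i, 0)
  simp only [cycG, emb, Sum.map_inl, Sum.map_inr, id] at a b c
  simp at c
  refine ⟨a, ?_⟩
  rw [← a, b]
  linear_combination c - zz (g (Sum.inr (i, 1))) - zz (g (Sum.inr (i, 2)))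

theorem mac_glue [NeZero k] (G : OG O k) (Γ : Gad k I) (hK : (G.glue (cycG k)).Good)
    (Z : List (Fin k)) (ρ : I → Fin k)
    (h1 : ∀ (a y : Fin k → ZMod 2), (∀ i, a i = y i + y (i - 1)) → (∀ i ∈ Z, y i = 0) →
      (∀ p, Sum.elim a (a ∘ ρ) (Γ.θ p) = Sum.elim a (a ∘ ρ) p) ∧
      (∀ x, a (ρ x) + a (ρ (Γ.r x)) + a (ρ (Γ.r (Γ.r x))) = 0))
    (h2 : ∀ (a : Fin k → ZMod 2) (b : I → ZMod 2), (∀ p, Sum.elim a b (Γ.θ p) = Sum.elim a b p) →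
      (∀ x, b x + b (Γ.r x) + b (Γ.r (Γ.r x)) = 0) → (∀ x, b x = a (ρ x)) ∧
      ∃ y : Fin k → ZMod 2, (∀ i, a i = y i + y (i - 1)) ∧ (∀ i ∈ Z, y i = 0)) :
    Mac (G.glue Γ).cyc := by
  have hm : ∀ (Z : List (Fin k)), ∃ W, Mac W ∧ ∀ g, g ∈ W ↔ g ∈ (G.glue (cycG k)).cyc ∧
      ∀ i ∈ Z, g (Sum.inr (i, 1)) = 0 := by
    intro Z
    induction Z with
    | nil => exact ⟨_, hK.mac, by simp⟩
    | cons i Z ih =>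
      obtain ⟨W, hW, hW2⟩ := ih
      refine ⟨_, hW.inf (Sum.inr (i, 1)), fun g => ?_⟩
      rw [Submodule.mem_inf, hW2]
      simp only [LinearMap.mem_ker, LinearMap.proj_apply, List.forall_mem_cons]
      tauto
  obtain ⟨W, hW, hW2⟩ := hm Z
  refine hW.map (Sum.elim Sum.inl (fun x => Sum.inr (ρ x, 0))) _ ?_ ?_
  · intro g hg
    rw [hW2] at hg
    obtain ⟨hg, hz⟩ := hg
    have hy := G.mem_cycK hg
    obtain ⟨a1, a2⟩ := h1 (fun i => g (Sum.inl (G.q i))) (fun i => g (Sum.inr (i, 1)))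
      (fun i => (hy i).2) hz
    rw [mem_cyc_glue] at hg ⊢
    refine ⟨hg.1, hg.2.1, fun p => ?_, fun x => ?_⟩
    · have e : ∀ p : Fin k ⊕ I, (g ∘ Sum.elim Sum.inl (fun x => Sum.inr (ρ x, 0))) (G.emb p) =
        Sum.elim (fun i => g (Sum.inl (G.q i))) ((fun i => g (Sum.inl (G.q i))) ∘ ρ) p := by
        rintro (i | x)
        · rfl
        · exact (hy _).1
      rw [e, e, a1]
    · have := a2 x
      simp only [Function.comp, Sum.elim_inr, (hy _).1]
      exact this
  · intro g' hg'
    rw [mem_cyc_glue] at hg'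
    obtain ⟨b1, b2, b3, b4⟩ := hg'
    obtain ⟨hb, y, hy, hyZ⟩ := h2 (fun i => g' (Sum.inl (G.q i))) (fun x => g' (Sum.inr x)) (by
      have e : ∀ p : Fin k ⊕ I, Sum.elim (fun i => g' (Sum.inl (G.q i))) (fun x => g' (Sum.inr x)) p =
          g' (G.emb p) := by rintro (i | x) <;> rfl
      intro p
      rw [e, e, b3]) b4
    refine ⟨G.mkCyc (fun d => g' (Sum.inl d)) y, ?_, ?_⟩
    · rw [hW2]
      exact ⟨G.mkCyc_mem _ _ b1 b2 hy, hyZ⟩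
    · funext z
      rcases z with d | x
      · rfl
      · exact (hb x).symm

end OG
end CiDC

namespace CiDC
namespace OG
variable {O : Type*}

theorem goodJ (G : OG O 2) (hK : (G.glue (cycG 2)).Good) : (G.glue gadJ).Good where
  fpf := G.glue_fpf _ (by rintro (i | x); · fin_cases i <;> simp [gadJ]
                          · exact x.elim)
  cut := by
    intro x hx y0 h
    have hxO : ∀ d, x (Sum.inl (G.r d)) = x (Sum.inl d) := fun d => hx (Sum.inl d)
    suffices H : ∃ v, ∀ d, x (Sum.inl d) = v by
      obtain ⟨v, hv⟩ := H
      rintro (d | z) (d' | z')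
      · rw [hv, hv]
      · exact z'.elim
      · exact z.elim
      · exact z.elim
    rcases G.glue_cut_cases gadJ x y0 h with ⟨d0, h1, h2⟩ | ⟨p0, h1, h2⟩
    · have e := h2 (Sum.inl 0)
      simp only [gadJ, emb, Sum.map_inl] at e
      refine ⟨x (Sum.inl (G.q 0)), G.K_cut hK (fun d => x (Sum.inl d)) hxO _ d0 h1 ?_⟩
      intro i hi
      fin_cases i
      · exact absurd rfl hi
      · exact absurd e.symm hi
    · refine ⟨x (Sum.inl (G.q 1)), G.K_cut hK (fun d => x (Sum.inl d)) hxO _ (G.q 0)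
        (fun d hd hne => absurd (h1 d hd) hne) ?_⟩
      intro i hi
      fin_cases i
      · rfl
      · exact absurd rfl hi
  mac := by
    refine G.mac_glue gadJ hK [0] (fun x => x.elim) ?_ ?_
    · intro a y h1 h2
      have z0 := h2 0 (by simp)
      have a0 := h1 0
      have a1 := h1 1
      rw [show (0 - 1 : Fin 2) = 1 from rfl] at a0
      rw [show (1 - 1 : Fin 2) = 0 from rfl] at a1
      simp [z0] at a0 a1
      refine ⟨?_, fun x => x.elim⟩
      rintro (i | x)
      · fin_cases i <;> simp [gadJ, a0, a1]
      · exact x.elim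
    · intro a b h1 _
      refine ⟨fun x => x.elim, fun i => if i = 0 then 0 else a 0, ?_, by simp⟩
      have e := h1 (Sum.inl 0)
      simp [gadJ] at e
      intro i
      fin_cases i <;> simp [e]

theorem goodW (G : OG O 3) (hK : (G.glue (cycG 3)).Good) : (G.glue gadW).Good where
  fpf := G.glue_fpf _ (by rintro (i | x) <;> simp [gadW])
  cut := by
    intro x hx y0 h
    have hxO : ∀ d, x (Sum.inl (G.r d)) = x (Sum.inl d) := fun d => hx (Sum.inl d)
    have hw : ∀ j : Fin 3, x (Sum.inr j) = x (Sum.inr 0) := by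
      have e0 : x (Sum.inr 1) = x (Sum.inr 0) := hx (Sum.inr 0)
      have e1 : x (Sum.inr 2) = x (Sum.inr 1) := hx (Sum.inr 1)
      intro j
      fin_cases j
      · rfl
      · exact e0
      · exact e1.trans e0
    suffices H : ∀ d, x (Sum.inl d) = x (Sum.inr 0) by
      rintro (d | z) (d' | z')
      · rw [H, H]
      · rw [H, hw z']
      · rw [H, hw z]
      · rw [hw z, hw z']
    rcases G.glue_cut_cases gadW x y0 h with ⟨d0, h1, h2⟩ | ⟨p0, h1, h2⟩
    · refine G.K_cut hK (fun d => x (Sum.inl d)) hxO _ d0 h1 ?_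
      intro i hi
      have e := h2 (Sum.inl i)
      simp only [gadW, emb, Sum.map_inl, Sum.map_inr, id, hw i] at e
      exact absurd e hi
    · refine G.K_cut hK (fun d => x (Sum.inl d)) hxO _ (G.q (Sum.elim id id p0))
        (fun d hd hne => absurd (h1 d hd) hne) ?_
      intro i hi
      have e := h2 (Sum.inl i)
      simp only [gadW, emb, Sum.map_inl, Sum.map_inr, id, hw i] at e
      rcases e hi with rfl | e
      · rfl
      · rcases p0 with j | j
        · cases e
        · rw [Sum.inl_injective e]; rfl
  mac := by
    refine G.mac_glue gadW hK [] id ?_ ?_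
    · intro a y h1 h2
      have a0 := h1 0
      have a1 := h1 1
      have a2 := h1 2
      rw [show (0 - 1 : Fin 3) = 2 from rfl] at a0
      rw [show (1 - 1 : Fin 3) = 0 from rfl] at a1
      rw [show (2 - 1 : Fin 3) = 1 from rfl] at a2
      have e : a 0 + a 1 + a 2 = 0 := by
        rw [a0, a1, a2]
        linear_combination zz (y 0) + zz (y 1) + zz (y 2)
      refine ⟨?_, ?_⟩
      · rintro (i | x) <;> simp [gadW]
      · intro j
        fin_cases j <;> simp [gadW]
        · exact e
        · linear_combination e
        · linear_combination e
    · intro a b h1 h2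
      have hb : ∀ i, b i = a i := fun i => h1 (Sum.inl i)
      have e := h2 0
      simp only [gadW, hb] at e
      rw [show (0 + 1 : Fin 3) = 1 from rfl, show (1 + 1 : Fin 3) = 2 from rfl] at e
      refine ⟨hb, fun i => if i = 0 then a 0 else if i = 1 then a 0 + a 1 else 0, ?_, by simp⟩
      intro i
      fin_cases i
      · simp
        intro h; exact absurd h (by decide)
      · simp; linear_combination - zz (a 0)
      · simp; linear_combination e - zz (a 0) - zz (a 1)

/-- The exceptional cut configuration at edge `01` of the cycle. -/
def Conf {k : ℕ} [NeZero k] (G : OG O k) : Prop :=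
  ∃ (x : O ⊕ (Fin k × Fin 3) → Bool) (f : O ⊕ (Fin k × Fin 3)),
    (∀ y, x ((G.glue (cycG k)).r y) = x y) ∧
    (∀ j, x (Sum.inr (0, j)) = true) ∧ (∀ j, x (Sum.inr (1, j)) = true) ∧
    (∀ i j, i ≠ 0 → i ≠ 1 → x (Sum.inr (i, j)) = false) ∧
    x (Sum.inl (G.q 0)) = true ∧ x (Sum.inl (G.q 1)) = true ∧
    ∀ y, x y ≠ x ((G.glue (cycG k)).α y) → y = Sum.inr (1, 1) ∨ y = Sum.inr (2, 2) ∨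
      y = Sum.inr (0, 2) ∨ y = Sum.inr (0 - 1, 1) ∨ y = f ∨ y = (G.glue (cycG k)).α f

theorem conf_mk {k : ℕ} [NeZero k] (G : OG O k) (h10 : (1 : Fin k) ≠ 0) (h11 : (1 + 1 : Fin k) = 2)
    (x : O → Bool) (z : Bool)
    (hx : ∀ d, x (G.r d) = x d) (e0 : x (G.q 0) ≠ z) (e1 : x (G.q 1) ≠ z) (d0 : O)
    (h1 : ∀ d, (∀ i, d ≠ G.q i) → x d ≠ x (G.α d) → d = d0 ∨ d = G.α d0)
    (h2 : ∀ i, i ≠ 0 → i ≠ 1 → x (G.q i) ≠ z → G.q i = d0) : G.Conf := by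
  refine ⟨Sum.elim (fun d => x d != z) (fun p => decide (p.1 = 0 ∨ p.1 = 1)), Sum.inl d0,
    ?_, ?_, ?_, ?_, ?_, ?_, ?_⟩
  · rintro (d | ⟨i, j⟩)
    · simp [hx]
    · simp [cycG]
  · simp
  · simp
  · intro i j h h'; simp [h, h']
  · simpa using e0
  · simpa using e1
  · intro y hy
    rcases G.cases_emb y with ⟨p, rfl⟩ | ⟨d, rfl, hd⟩
    · rw [glue_α_emb] at hy
      have hport : ∀ i, (x (G.q i) != z) ≠ decide (i = 0 ∨ i = 1) → G.q i = d0 := by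
        intro i hi
        by_cases h0 : i = 0
        · subst h0; simp at hi; exact absurd hi e0
        · by_cases h1 : i = 1
          · subst h1; simp at hi; exact absurd hi e1
          · simp [h0, h1] at hi
            exact h2 i h0 h1 hi
      rcases p with i | ⟨i, j⟩
      · right; right; right; right; left
        exact congrArg _ (hport i hy)
      · fin_cases j
        · right; right; right; right; right
          rw [← hport i (Ne.symm hy), glue_α_q]; rfl
        · simp [cycG, emb] at hy
          by_cases h0 : i = 0
          · subst h0; simp at hy
          · by_cases h1 : i = 1
            · subst h1; left; rfl
            · simp [h0, h1] at hy
              right; right; right; left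
              have : i = 0 - 1 := by rw [← hy]; simp
              rw [this]; rfl
        · simp [cycG, emb] at hy
          by_cases h0 : i = 0
          · subst h0; right; right; left; rfl
          · by_cases h1 : i = 1
            · subst h1; simp at hy
            · simp [h0, h1] at hy
              right; left
              by_cases hy0 : i - 1 = 0
              · have := sub_eq_zero.1 hy0; exact absurd this h1
              · have : i = 2 := by
                  have e := sub_add_cancel i 1
                  rw [hy hy0, h11] at e
                  exact e.symm
                rw [this]; rfl
    · rw [glue_α_inl _ _ _ hd] at hy
      have hy' : x d ≠ x (G.α d) := by
        intro h; apply hy; simp [h]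
      rcases h1 d hd hy' with rfl | h
      · right; right; right; right; left; rfl
      · right; right; right; right; right
        by_cases h' : ∃ i, d0 = G.q i
        · obtain ⟨i, rfl⟩ := h'
          rw [(G.fix_iff (G.q i)).2 ⟨i, rfl⟩] at h
          exact absurd h (hd i)
        · rw [glue_α_inl _ _ _ (fun i hi => h' ⟨i, hi⟩), h]

theorem goodM (G : OG O 4) (hK : (G.glue (cycG 4)).Good) : (G.glue gadM).Good ∨ G.Conf := by
  by_cases hconf : G.Conf
  · exact Or.inr hconf
  left
  refine ⟨G.glue_fpf _ (by rintro (i | x); · fin_cases i <;> simp [gadM]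
                           · exact x.elim), ?_, ?_⟩
  · intro x hx y0 h
    have hxO : ∀ d, x (Sum.inl (G.r d)) = x (Sum.inl d) := fun d => hx (Sum.inl d)
    suffices H : ∃ v, ∀ d, x (Sum.inl d) = v by
      obtain ⟨v, hv⟩ := H
      rintro (d | z) (d' | z')
      · rw [hv, hv]
      · exact z'.elim
      · exact z.elim
      · exact z.elim
    have main : ∀ d0, (∀ d, (∀ i, d ≠ G.q i) → x (Sum.inl d) ≠ x (Sum.inl (G.α d)) →
        d = d0 ∨ d = G.α d0) → x (Sum.inl (G.q 0)) = x (Sum.inl (G.q 1)) →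
        x (Sum.inl (G.q 2)) = x (Sum.inl (G.q 3)) → ∃ v, ∀ d, x (Sum.inl d) = v := by
      intro d0 h1 e1 e2
      by_cases hyz : x (Sum.inl (G.q 0)) = x (Sum.inl (G.q 2))
      · refine ⟨x (Sum.inl (G.q 0)), G.K_cut hK (fun d => x (Sum.inl d)) hxO _ d0 h1 ?_⟩
        intro i hi
        fin_cases i
        · exact absurd rfl hi
        · exact absurd e1.symm hi
        · exact absurd hyz.symm hi
        · exact absurd (hyz.trans e2).symm hi
      · exfalso
        apply hconf
        refine G.conf_mk (by decide) rfl (fun d => x (Sum.inl d)) (x (Sum.inl (G.q 2))) hxO hyz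
          (by rw [← e1]; exact hyz) d0 h1 ?_
        intro i h0 h1 h2
        fin_cases i
        · exact absurd rfl h0
        · exact absurd rfl h1
        · exact absurd rfl h2
        · exact absurd e2.symm h2
    rcases G.glue_cut_cases gadM x y0 h with ⟨d0, h1, h2⟩ | ⟨p0, h1, h2⟩
    · exact main d0 h1 (h2 (Sum.inl 0)) (h2 (Sum.inl 2))
    · have h1' : ∀ d0, (∀ d, (∀ i, d ≠ G.q i) → x (Sum.inl d) ≠ x (Sum.inl (G.α d)) →
        d = d0 ∨ d = G.α d0) := fun d0 d hd hne => absurd (h1 d hd) hne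
      by_cases e1 : x (Sum.inl (G.q 0)) = x (Sum.inl (G.q 1))
      · by_cases e2 : x (Sum.inl (G.q 2)) = x (Sum.inl (G.q 3))
        · exact main (G.q 0) (h1' _) e1 e2
        · refine ⟨x (Sum.inl (G.q 0)), G.K_cut hK (fun d => x (Sum.inl d)) hxO _
            (if x (Sum.inl (G.q 2)) = x (Sum.inl (G.q 0)) then G.q 3 else G.q 2) (h1' _) ?_⟩
          intro i hi
          fin_cases i
          · exact absurd rfl hi
          · exact absurd e1.symm hi
          · exact (if_neg hi).symm
          · refine (if_pos ?_).symm
            have hi : x (Sum.inl (G.q 3)) ≠ x (Sum.inl (G.q 0)) := hi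
            revert e2 hi
            generalize x (Sum.inl (G.q 0)) = b1
            generalize x (Sum.inl (G.q 2)) = b2
            generalize x (Sum.inl (G.q 3)) = b3
            revert b1 b2 b3; decide
      · have e2 : x (Sum.inl (G.q 2)) = x (Sum.inl (G.q 3)) := by
          by_contra e2
          have a := h2 (Sum.inl 0) e1
          have b := h2 (Sum.inl 2) e2
          rcases p0 with i | z
          · fin_cases i <;> simp [gadM] at a b
          · exact z.elim
        refine ⟨x (Sum.inl (G.q 2)), G.K_cut hK (fun d => x (Sum.inl d)) hxO _
            (if x (Sum.inl (G.q 0)) = x (Sum.inl (G.q 2)) then G.q 1 else G.q 0) (h1' _) ?_⟩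
        intro i hi
        fin_cases i
        · exact (if_neg hi).symm
        · refine (if_pos ?_).symm
          have hi : x (Sum.inl (G.q 1)) ≠ x (Sum.inl (G.q 2)) := hi
          revert e1 hi
          generalize x (Sum.inl (G.q 0)) = b0
          generalize x (Sum.inl (G.q 1)) = b1
          generalize x (Sum.inl (G.q 2)) = b3
          revert b0 b1 b3; decide
        · exact absurd rfl hi
        · exact absurd e2.symm hi
  · refine G.mac_glue gadM hK [1, 3] (fun x => x.elim) ?_ ?_
    · intro a y h1 h2
      have z1 := h2 1 (by simp)
      have z3 := h2 3 (by simp)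
      have a0 := h1 0
      have a1 := h1 1
      have a2 := h1 2
      have a3 := h1 3
      rw [show (0 - 1 : Fin 4) = 3 from rfl] at a0
      rw [show (1 - 1 : Fin 4) = 0 from rfl] at a1
      rw [show (2 - 1 : Fin 4) = 1 from rfl] at a2
      rw [show (3 - 1 : Fin 4) = 2 from rfl] at a3
      simp [z1, z3] at a0 a1 a2 a3
      refine ⟨?_, fun x => x.elim⟩
      rintro (i | x)
      · fin_cases i <;> simp [gadM, a0, a1, a2, a3]
      · exact x.elim
    · intro a b h1 _
      refine ⟨fun x => x.elim, fun i => if i = 0 then a 0 else if i = 2 then a 2 else 0, ?_, by simp⟩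
      have e := h1 (Sum.inl 0)
      have e' := h1 (Sum.inl 2)
      simp [gadM] at e e'
      intro i
      fin_cases i <;> simp [e, e']
      intro h; exact absurd h (by decide)

set_option maxHeartbeats 1000000 in
theorem goodN (G : OG O 5) (hK : (G.glue (cycG 5)).Good) : (G.glue gadN).Good ∨ G.Conf := by
  by_cases hconf : G.Conf
  · exact Or.inr hconf
  left
  refine ⟨G.glue_fpf _ (by rintro (i | i) <;> fin_cases i <;> simp [gadN]), ?_, ?_⟩
  · intro x hx y0 h
    have hxO : ∀ d, x (Sum.inl (G.r d)) = x (Sum.inl d) := fun d => hx (Sum.inl d)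
    have hw1 : x (Sum.inr 1) = x (Sum.inr 0) := hx (Sum.inr 0)
    have hw2 : x (Sum.inr 2) = x (Sum.inr 0) := (hx (Sum.inr 1)).trans hw1
    have hw : ∀ j : Fin 3, x (Sum.inr j) = x (Sum.inr 0) := by
      intro j
      fin_cases j
      · rfl
      · exact hw1
      · exact hw2
    suffices H : ∀ d, x (Sum.inl d) = x (Sum.inr 0) by
      rintro (d | z) (d' | z')
      · rw [H, H]
      · rw [H, hw z']
      · rw [H, hw z]
      · rw [hw z, hw z']
    have main : ∀ d0, (∀ d, (∀ i, d ≠ G.q i) → x (Sum.inl d) ≠ x (Sum.inl (G.α d)) →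
        d = d0 ∨ d = G.α d0) → x (Sum.inl (G.q 0)) = x (Sum.inl (G.q 1)) →
        (∀ i, i ≠ 0 → i ≠ 1 → x (Sum.inl (G.q i)) ≠ x (Sum.inr 0) → G.q i = d0) →
        ∀ d, x (Sum.inl d) = x (Sum.inr 0) := by
      intro d0 h1 e1 e2
      by_cases hyz : x (Sum.inl (G.q 0)) = x (Sum.inr 0)
      · refine G.K_cut hK (fun d => x (Sum.inl d)) hxO _ d0 h1 ?_
        intro i hi
        by_cases i0 : i = 0
        · subst i0; exact absurd hyz hi
        · by_cases i1 : i = 1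
          · subst i1; exact absurd (e1 ▸ hyz) hi
          · exact e2 i i0 i1 hi
      · exfalso
        apply hconf
        exact G.conf_mk (by decide) rfl (fun d => x (Sum.inl d)) (x (Sum.inr 0)) hxO hyz
          (by rw [← e1]; exact hyz) d0 h1 e2
    rcases G.glue_cut_cases gadN x y0 h with ⟨d0, h1, h2⟩ | ⟨p0, h1, h2⟩
    · refine main d0 h1 (h2 (Sum.inl 0)) ?_
      have t2 := h2 (Sum.inl 2)
      have t3 := h2 (Sum.inl 3)
      have t4 := h2 (Sum.inl 4)
      simp only [gadN, emb, Sum.map_inl, Sum.map_inr, id] at t2 t3 t4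
      intro i i0 i1 hi
      fin_cases i <;> simp_all
    · have h1' : ∀ d0, (∀ d, (∀ i, d ≠ G.q i) → x (Sum.inl d) ≠ x (Sum.inl (G.α d)) →
        d = d0 ∨ d = G.α d0) := fun d0 d hd hne => absurd (h1 d hd) hne
      have t0 := h2 (Sum.inl 0)
      have t2 := h2 (Sum.inl 2)
      have t3 := h2 (Sum.inl 3)
      have t4 := h2 (Sum.inl 4)
      simp only [gadN, emb, Sum.map_inl, Sum.map_inr, id, hw1, hw2] at t0 t2 t3 t4
      by_cases e1 : x (Sum.inl (G.q 0)) = x (Sum.inl (G.q 1))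
      · refine main (if x (Sum.inl (G.q 2)) ≠ x (Sum.inr 0) then G.q 2 else
          if x (Sum.inl (G.q 3)) ≠ x (Sum.inr 0) then G.q 3 else G.q 4) (h1' _) e1 ?_
        intro i i0 i1 hi
        fin_cases i
        · simp at i0
        · simp at i1
        · simp at hi; simp [hi]
        · have hi : x (Sum.inl (G.q 3)) ≠ x (Sum.inr 0) := hi
          have : x (Sum.inl (G.q 2)) = x (Sum.inr 0) := by
            by_contra e2
            have a := t3 hi
            have b := t2 e2
            rcases p0 with i | i <;> fin_cases i <;> simp at a b
          simp [this, hi]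
        · have hi : x (Sum.inl (G.q 4)) ≠ x (Sum.inr 0) := hi
          have e2 : x (Sum.inl (G.q 2)) = x (Sum.inr 0) := by
            by_contra e2
            have a := t4 hi
            have b := t2 e2
            rcases p0 with i | i <;> fin_cases i <;> simp at a b
          have e3 : x (Sum.inl (G.q 3)) = x (Sum.inr 0) := by
            by_contra e3
            have a := t4 hi
            have b := t3 e3
            rcases p0 with i | i <;> fin_cases i <;> simp at a b
          simp [e2, e3]
      · have a := t0 e1
        have e2 : x (Sum.inl (G.q 2)) = x (Sum.inr 0) := by
          by_contra e2
          have b := t2 e2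
          rcases p0 with i | i <;> fin_cases i <;> simp at a b
        have e3 : x (Sum.inl (G.q 3)) = x (Sum.inr 0) := by
          by_contra e2
          have b := t3 e2
          rcases p0 with i | i <;> fin_cases i <;> simp at a b
        have e4 : x (Sum.inl (G.q 4)) = x (Sum.inr 0) := by
          by_contra e2
          have b := t4 e2
          rcases p0 with i | i <;> fin_cases i <;> simp at a b
        refine G.K_cut hK (fun d => x (Sum.inl d)) hxO _
            (if x (Sum.inl (G.q 0)) = x (Sum.inr 0) then G.q 1 else G.q 0) (h1' _) ?_
        intro i hi
        fin_cases i
        · have hi : x (Sum.inl (G.q 0)) ≠ x (Sum.inr 0) := hi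
          simp [hi]
        · have hi : x (Sum.inl (G.q 1)) ≠ x (Sum.inr 0) := hi
          have : x (Sum.inl (G.q 0)) = x (Sum.inr 0) := by
            revert e1 hi
            generalize x (Sum.inl (G.q 0)) = b0
            generalize x (Sum.inl (G.q 1)) = b1
            generalize x (Sum.inr 0) = b3
            revert b0 b1 b3; decide
          simp [this]
        · exact absurd e2 hi
        · exact absurd e3 hi
        · exact absurd e4 hi
  · refine G.mac_glue gadN hK [1, 4] (fun j => ![2, 3, 4] j) ?_ ?_
    · intro a y h1 h2
      have z1 := h2 1 (by simp)
      have z4 := h2 4 (by simp)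
      have a0 := h1 0
      have a1 := h1 1
      have a2 := h1 2
      have a3 := h1 3
      have a4 := h1 4
      rw [show (0 - 1 : Fin 5) = 4 from rfl] at a0
      rw [show (1 - 1 : Fin 5) = 0 from rfl] at a1
      rw [show (2 - 1 : Fin 5) = 1 from rfl] at a2
      rw [show (3 - 1 : Fin 5) = 2 from rfl] at a3
      rw [show (4 - 1 : Fin 5) = 3 from rfl] at a4
      simp [z1, z4] at a0 a1 a2 a3 a4
      refine ⟨?_, ?_⟩
      · rintro (i | i) <;> fin_cases i <;> simp [gadN, a0, a1]
      · have e : a 2 + a 3 + a 4 = 0 := by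
          rw [a2, a3, a4]; linear_combination zz (y 2) + zz (y 3)
        intro j
        fin_cases j <;> simp [gadN]
        · linear_combination e
        · linear_combination e
        · linear_combination e
    · intro a b h1 h2
      have e := h1 (Sum.inl 0)
      have b0 := h1 (Sum.inl 2)
      have b1 := h1 (Sum.inl 3)
      have b2 := h1 (Sum.inl 4)
      simp [gadN] at e b0 b1 b2
      have s := h2 0
      simp only [gadN] at s
      rw [show (0 + 1 : Fin 3) = 1 from rfl, show (1 + 1 : Fin 3) = 2 from rfl, b0, b1, b2] at s
      refine ⟨?_, ![a 0, 0, a 2, a 4, 0], ?_, by simp⟩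
      · intro j; fin_cases j <;> simp [b0, b1, b2]
      · have c0 : a 0 = a 0 + 0 := by ring
        have c1 : a 1 = 0 + a 0 := by rw [e]; ring
        have c2 : a 2 = a 2 + 0 := by ring
        have c3 : a 3 = a 4 + a 2 := by linear_combination s - zz (a 2) - zz (a 4)
        have c4 : a 4 = 0 + a 4 := by ring
        intro i
        fin_cases i
        · exact c0
        · exact c1
        · exact c2
        · exact c3
        · exact c4

end OG
end CiDC

namespace CiDC

/-- Parity: a flow crosses a cut evenly. -/
theorem CG.parity {D : Type*} [Fintype D] (G : CG D) (fpf : ∀ d, G.α d ≠ d) {g : D → ZMod 2}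
    (hg : g ∈ G.cyc) (x : D → Bool) (hx : ∀ d, x (G.r d) = x d) :
    ∑ d with (x d = true ∧ x (G.α d) = false), g d = 0 := by
  classical
  rw [CG.mem_cyc] at hg
  obtain ⟨h1, h2⟩ := hg
  let S : Finset D := Finset.univ.filter (fun d => x d = true)
  have hS : ∑ d ∈ S, g d = ∑ d ∈ S, g (G.r d) := by
    symm
    refine Finset.sum_bij (fun d _ => G.r d) ?_ ?_ ?_ ?_
    · intro d hd; simpa [S, hx] using hd
    · intro d _ d' _ h; exact G.r_inj h
    · intro d hd; exact ⟨G.r (G.r d), by simpa [S, hx] using hd, G.r3 d⟩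
    · intro d _; rfl
  have hS2 : ∑ d ∈ S, g (G.r d) = ∑ d ∈ S, g (G.r (G.r d)) := by
    symm
    refine Finset.sum_bij (fun d _ => G.r d) ?_ ?_ ?_ ?_
    · intro d hd; simpa [S, hx] using hd
    · intro d _ d' _ h; exact G.r_inj h
    · intro d hd; exact ⟨G.r (G.r d), by simpa [S, hx] using hd, G.r3 d⟩
    · intro d _; rfl
  have h0 : ∑ d ∈ S, g d = 0 := by
    have : ∑ d ∈ S, (g d + g (G.r d) + g (G.r (G.r d))) = 0 := Finset.sum_eq_zero fun d _ => h2 d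
    rw [Finset.sum_add_distrib, Finset.sum_add_distrib, ← hS2, ← hS] at this
    linear_combination this - OG.zz (∑ d ∈ S, g d)
  have hs := Finset.sum_filter_add_sum_filter_not S (fun d => x (G.α d) = false) g
  have hn : ∑ d ∈ S with ¬ x (G.α d) = false, g d = 0 := by
    refine Finset.sum_involution (fun d _ => G.α d) ?_ ?_ ?_ ?_
    · intro d _; rw [h1]; exact OG.zz _
    · intro d _ _; exact fpf d
    · intro d hd; simp [S, G.α_inv] at hd ⊢; exact ⟨hd.2, hd.1⟩
    · intro d _; exact G.α_inv d
  rw [hn, add_zero, h0, Finset.filter_filter] at hs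
  exact hs

open scoped Classical in
/-- Indicator of a colour class. -/
noncomputable def CG.gX {D : Type*} (G : CG D) (c : D → ℕ) (X : ℕ) (d : D) : ZMod 2 :=
  if c (G.r d) = X ∨ c (G.r (G.r d)) = X then 1 else 0

theorem CG.gX_mem {D : Type*} (G : CG D) {c : D → ℕ} (hc : G.Col c) (X : ℕ) : G.gX c X ∈ G.cyc := by
  rw [CG.mem_cyc]
  refine ⟨fun d => ?_, fun d => ?_⟩
  · have := hc.2 d
    simp only [EdgeOK] at this
    simp only [gX]
    congr 1
    apply propext
    rcases this with ⟨a, b⟩ | ⟨a, b⟩ <;> rw [a, b]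
    exact or_comm
  · have h1 := hc.1 d
    have h2 := hc.1 (G.r d)
    have h3 := hc.1 (G.r (G.r d))
    simp only [gX, G.r3] at *
    by_cases e1 : c d = X <;> by_cases e2 : c (G.r d) = X <;> by_cases e3 : c (G.r (G.r d)) = X <;>
      simp [e1, e2, e3] <;> first | rfl | (exfalso; simp_all)

/-- An edge with its two ends. -/
def gadH : Gad 4 (Fin 2 × Fin 3) where
  r := fun x => (x.1, x.2 + 1)
  r3 := by decide
  r_ne := by decide
  θ := fun p => match p with
    | Sum.inl 0 => Sum.inr (0, 0)
    | Sum.inl 1 => Sum.inr (0, 2)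
    | Sum.inl 2 => Sum.inr (1, 0)
    | Sum.inl 3 => Sum.inr (1, 1)
    | Sum.inr (0, 0) => Sum.inl 0
    | Sum.inr (0, 1) => Sum.inr (1, 2)
    | Sum.inr (0, 2) => Sum.inl 1
    | Sum.inr (1, 0) => Sum.inl 2
    | Sum.inr (1, 1) => Sum.inl 3
    | Sum.inr (1, 2) => Sum.inr (0, 1)
  θ_inv := by rintro (i | ⟨i, j⟩)
              · fin_cases i <;> rfl
              · fin_cases i <;> fin_cases j <;> rfl

theorem EdgeOK.symm {a b a' b' : ℕ} (h : EdgeOK a b a' b') : EdgeOK a' b' a b := by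
  rcases h with ⟨h, h'⟩ | ⟨h, h'⟩
  · exact Or.inl ⟨h.symm, h'.symm⟩
  · exact Or.inr ⟨h'.symm, h.symm⟩

theorem EdgeOK.map {a b a' b' : ℕ} (φ : ℕ → ℕ) (h : EdgeOK a b a' b') :
    EdgeOK (φ a) (φ b) (φ a') (φ b') := by
  rcases h with ⟨h, h'⟩ | ⟨h, h'⟩
  · exact Or.inl ⟨congrArg φ h, congrArg φ h'⟩
  · exact Or.inr ⟨congrArg φ h, congrArg φ h'⟩

namespace OG
variable {O : Type*}

theorem colH (G : OG O 4) (c : O → ℕ) (y : Fin 2 × Fin 3 → ℕ)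
    (h1 : ∀ d, c d ≠ c (G.r d))
    (h2 : ∀ d, (∀ i, d ≠ G.q i) → EdgeOK (c (G.r d)) (c (G.r (G.r d))) (c (G.r (G.α d))) (c (G.r (G.r (G.α d)))))
    (h3 : ∀ i j, y (i, j) ≠ y (i, j + 1))
    (k0 : EdgeOK (c (G.r (G.q 0))) (c (G.r (G.r (G.q 0)))) (y (0, 1)) (y (0, 2)))
    (k1 : EdgeOK (c (G.r (G.q 1))) (c (G.r (G.r (G.q 1)))) (y (0, 0)) (y (0, 1)))
    (k2 : EdgeOK (c (G.r (G.q 2))) (c (G.r (G.r (G.q 2)))) (y (1, 1)) (y (1, 2)))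
    (k3 : EdgeOK (c (G.r (G.q 3))) (c (G.r (G.r (G.q 3)))) (y (1, 2)) (y (1, 0)))
    (kh : EdgeOK (y (0, 2)) (y (0, 0)) (y (1, 0)) (y (1, 1))) :
    (G.glue gadH).Col (Sum.elim c y) := by
  refine ⟨?_, ?_⟩
  · rintro (d | ⟨i, j⟩)
    · exact h1 d
    · exact h3 i j
  · intro z
    rcases G.cases_emb z with ⟨p, rfl⟩ | ⟨d, rfl, hd⟩
    · rw [glue_α_emb]
      rcases p with i | ⟨i, j⟩
      · fin_cases i
        · exact k0
        · exact k1
        · exact k2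
        · exact k3
      · fin_cases i <;> fin_cases j
        · exact k0.symm
        · exact kh
        · exact k1.symm
        · exact k2.symm
        · exact k3.symm
        · exact kh.symm
    · rw [glue_α_inl _ _ _ hd]
      exact h2 d hd

end OG
end CiDC

namespace CiDC
namespace OG
variable {O : Type*}

theorem extH (G : OG O 4) (c : O → ℕ) (x : O → Bool) (hx : ∀ d, x (G.r d) = x d)
    (x0 : x (G.q 0) = true) (x1 : x (G.q 1) = false) (x2 : x (G.q 2) = true)
    (x3 : x (G.q 3) = false) (φ : Equiv.Perm ℕ)
    (h1 : ∀ d, c d ≠ c (G.r d))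
    (h2 : ∀ d, (∀ i, d ≠ G.q i) → EdgeOK (c (G.r d)) (c (G.r (G.r d))) (c (G.r (G.α d))) (c (G.r (G.r (G.α d)))))
    (hcr : ∀ d, (∀ i, d ≠ G.q i) → x d = true → x (G.α d) = false →
      EdgeOK (c (G.r d)) (c (G.r (G.r d))) (φ (c (G.r (G.α d)))) (φ (c (G.r (G.r (G.α d))))))
    (y : Fin 2 × Fin 3 → ℕ)
    (h3 : ∀ i j, y (i, j) ≠ y (i, j + 1))
    (k0 : EdgeOK (c (G.r (G.q 0))) (c (G.r (G.r (G.q 0)))) (y (0, 1)) (y (0, 2)))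
    (k1 : EdgeOK (φ (c (G.r (G.q 1)))) (φ (c (G.r (G.r (G.q 1))))) (y (0, 0)) (y (0, 1)))
    (k2 : EdgeOK (c (G.r (G.q 2))) (c (G.r (G.r (G.q 2)))) (y (1, 1)) (y (1, 2)))
    (k3 : EdgeOK (φ (c (G.r (G.q 3)))) (φ (c (G.r (G.r (G.q 3))))) (y (1, 2)) (y (1, 0)))
    (kh : EdgeOK (y (0, 2)) (y (0, 0)) (y (1, 0)) (y (1, 1))) :
    ∃ t ∈ (G.glue gadH).T, t (Sum.inl (G.q 0)) = decide (c (G.r (G.q 0)) = y (0, 1)) ∧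
      t (Sum.inl (G.q 1)) = decide (φ (c (G.r (G.q 1))) = y (0, 0)) ∧
      t (Sum.inl (G.q 2)) = decide (c (G.r (G.q 2)) = y (1, 1)) ∧
      t (Sum.inl (G.q 3)) = decide (φ (c (G.r (G.q 3))) = y (1, 2)) ∧
      t (Sum.inr (0, 1)) = decide (y (0, 2) = y (1, 0)) ∧
      (∀ d, (∀ i, d ≠ G.q i) → x d = x (G.α d) → 
        t (Sum.inl d) = decide (c (G.r d) = c (G.r (G.α d)))) ∧
      (∀ d, (∀ i, d ≠ G.q i) → x d = true → x (G.α d) = false → 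
        t (Sum.inl d) = decide (c (G.r d) = φ (c (G.r (G.α d))))) := by
  let c' : O → ℕ := fun d => if x d = true then c d else φ (c d)
  have ct : ∀ d, x d = true → c' d = c d := fun d h => if_pos h
  have cf : ∀ d, x d = false → c' d = φ (c d) := fun d h => if_neg (by simp [h])
  have xr : ∀ d b, x d = b → x (G.r d) = b := fun d b h => by rw [hx, h]
  have xrr : ∀ d b, x d = b → x (G.r (G.r d)) = b := fun d b h => by rw [hx, hx, h]
  refine ⟨_, ⟨Sum.elim c' y, G.colH c' y ?_ ?_ h3 ?_ ?_ ?_ ?_ kh, rfl⟩, ?_⟩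
  · intro d
    cases hd : x d
    · rw [cf _ hd, cf _ (xr _ _ hd)]
      exact fun h => h1 d (φ.injective h)
    · rw [ct _ hd, ct _ (xr _ _ hd)]
      exact h1 d
  · intro d hp
    cases hd : x d <;> cases ha : x (G.α d)
    · rw [cf _ (xr _ _ hd), cf _ (xrr _ _ hd), cf _ (xr _ _ ha), cf _ (xrr _ _ ha)]
      exact (h2 d hp).map φ
    · have := hcr (G.α d) (G.α_not_port hp) ha (by rw [G.α_inv]; exact hd)
      rw [G.α_inv] at this
      rw [cf _ (xr _ _ hd), cf _ (xrr _ _ hd), ct _ (xr _ _ ha), ct _ (xrr _ _ ha)]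
      exact this.symm
    · rw [ct _ (xr _ _ hd), ct _ (xrr _ _ hd), cf _ (xr _ _ ha), cf _ (xrr _ _ ha)]
      exact hcr d hp hd ha
    · rw [ct _ (xr _ _ hd), ct _ (xrr _ _ hd), ct _ (xr _ _ ha), ct _ (xrr _ _ ha)]
      exact h2 d hp
  · rw [ct _ (xr _ _ x0), ct _ (xrr _ _ x0)]; exact k0
  · rw [cf _ (xr _ _ x1), cf _ (xrr _ _ x1)]; exact k1
  · rw [ct _ (xr _ _ x2), ct _ (xrr _ _ x2)]; exact k2
  · rw [cf _ (xr _ _ x3), cf _ (xrr _ _ x3)]; exact k3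
  refine ⟨?_, ?_, ?_, ?_, ?_, ?_, ?_⟩
  · rw [← ct _ (xr _ _ x0)]; simp only [CG.tw, glue_α_q]; rfl
  · rw [← cf _ (xr _ _ x1)]; simp only [CG.tw, glue_α_q]; rfl
  · rw [← ct _ (xr _ _ x2)]; simp only [CG.tw, glue_α_q]; rfl
  · rw [← cf _ (xr _ _ x3)]; simp only [CG.tw, glue_α_q]; rfl
  · simp only [CG.tw, glue_α_inr]; rfl
  · intro d hp hd
    simp only [CG.tw, glue_α_inl _ _ _ hp, glue_r_inl, Sum.elim_inl]
    cases ha : x (G.α d)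
    · rw [ha] at hd
      rw [cf _ (xr _ _ hd), cf _ (xr _ _ ha)]
      simp
    · rw [ha] at hd
      rw [ct _ (xr _ _ hd), ct _ (xr _ _ ha)]
  · intro d hp hd ha
    simp only [CG.tw, glue_α_inl _ _ _ hp, glue_r_inl, Sum.elim_inl]
    rw [ct _ (xr _ _ hd), cf _ (xr _ _ ha)]

/-- data of a colouring of the reduced graph -/
theorem colM (G : OG O 4) {cM : O ⊕ Empty → ℕ} (hc : (G.glue gadM).Col cM) :
    (∀ d, (cM ∘ Sum.inl) d ≠ (cM ∘ Sum.inl) (G.r d)) ∧ 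
    (∀ d, (∀ i, d ≠ G.q i) → EdgeOK ((cM ∘ Sum.inl) (G.r d)) ((cM ∘ Sum.inl) (G.r (G.r d)))
      ((cM ∘ Sum.inl) (G.r (G.α d))) ((cM ∘ Sum.inl) (G.r (G.r (G.α d))))) ∧
    EdgeOK ((cM ∘ Sum.inl) (G.r (G.q 0))) ((cM ∘ Sum.inl) (G.r (G.r (G.q 0))))
      ((cM ∘ Sum.inl) (G.r (G.q 1))) ((cM ∘ Sum.inl) (G.r (G.r (G.q 1)))) ∧
    EdgeOK ((cM ∘ Sum.inl) (G.r (G.q 2))) ((cM ∘ Sum.inl) (G.r (G.r (G.q 2))))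
      ((cM ∘ Sum.inl) (G.r (G.q 3))) ((cM ∘ Sum.inl) (G.r (G.r (G.q 3)))) := by
  refine ⟨fun d => hc.1 (Sum.inl d), fun d hp => ?_, ?_, ?_⟩
  · have := hc.2 (Sum.inl d)
    rwa [glue_α_inl _ _ _ hp] at this
  · have := hc.2 (Sum.inl (G.q 0))
    rwa [glue_α_q] at this
  · have := hc.2 (Sum.inl (G.q 2))
    rwa [glue_α_q] at this

end OG

theorem EdgeOK.trans {a b a' b' a'' b'' : ℕ} (h : EdgeOK a b a' b') (k : EdgeOK a' b' a'' b'') :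
    EdgeOK a b a'' b'' := by
  rcases h with ⟨rfl, rfl⟩ | ⟨rfl, rfl⟩
  · exact k
  · rcases k with ⟨rfl, rfl⟩ | ⟨rfl, rfl⟩
    · exact Or.inr ⟨rfl, rfl⟩
    · exact Or.inl ⟨rfl, rfl⟩

theorem EdgeOK.swap {a b a' b' : ℕ} (h : EdgeOK a b a' b') : EdgeOK a b b' a' := by
  rcases h with ⟨rfl, rfl⟩ | ⟨rfl, rfl⟩
  · exact Or.inr ⟨rfl, rfl⟩
  · exact Or.inl ⟨rfl, rfl⟩

theorem EdgeOK.ne {a b a' b' : ℕ} (h : EdgeOK a b a' b') (hn : a ≠ b) : a' ≠ b' := by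
  rcases h with ⟨rfl, rfl⟩ | ⟨rfl, rfl⟩
  · exact hn
  · exact hn.symm

theorem EdgeOK.xor {u v u' v' p a : ℕ} (h : EdgeOK u v p a) (k : EdgeOK u v u' v') (hn : p ≠ a) :
    (decide (u = a) ^^ decide (u' = p)) = decide (u = u') := by
  rcases h with ⟨rfl, rfl⟩ | ⟨rfl, rfl⟩ <;> rcases k with ⟨rfl, rfl⟩ | ⟨rfl, rfl⟩ <;>
    simp [hn, hn.symm]

/-- Corner colours on the edge gadget. -/
def yH (a h e b g h' : ℕ) : Fin 2 × Fin 3 → ℕ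
  | (0, 0) => a
  | (0, 1) => h
  | (0, 2) => e
  | (1, 0) => b
  | (1, 1) => g
  | (1, 2) => h'

theorem yH_ne {a h e b g h' : ℕ} (h1 : a ≠ h) (h2 : h ≠ e) (h3 : e ≠ a) (h4 : b ≠ g) (h5 : g ≠ h')
    (h6 : h' ≠ b) (i : Fin 2) (j : Fin 3) : yH a h e b g h' (i, j) ≠ yH a h e b g h' (i, j + 1) := by
  fin_cases i <;> fin_cases j
  · exact h1
  · exact h2
  · exact h3
  · exact h4
  · exact h5
  · exact h6

namespace OG
variable {O : Type*}

/-- Splitting a colour. -/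
theorem splitA [Finite O] (G : OG O 4) (c : O → ℕ) (x : O → Bool) (hx : ∀ d, x (G.r d) = x d)
    (x0 : x (G.q 0) = true) (x1 : x (G.q 1) = false) (x2 : x (G.q 2) = true)
    (x3 : x (G.q 3) = false)
    (h1 : ∀ d, c d ≠ c (G.r d))
    (h2 : ∀ d, (∀ i, d ≠ G.q i) → EdgeOK (c (G.r d)) (c (G.r (G.r d))) (c (G.r (G.α d))) (c (G.r (G.r (G.α d)))))
    (e01 : EdgeOK (c (G.r (G.q 0))) (c (G.r (G.r (G.q 0)))) (c (G.r (G.q 1))) (c (G.r (G.r (G.q 1)))))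
    (e23 : EdgeOK (c (G.r (G.q 2))) (c (G.r (G.r (G.q 2)))) (c (G.r (G.q 3))) (c (G.r (G.r (G.q 3)))))
    (p a w : ℕ) (ea : EdgeOK (c (G.r (G.q 0))) (c (G.r (G.r (G.q 0)))) p a)
    (ew : EdgeOK (c (G.r (G.q 2))) (c (G.r (G.r (G.q 2)))) p w)
    (hcr : ∀ d, (∀ i, d ≠ G.q i) → x d = true → x (G.α d) = false →
      c (G.r d) ≠ p ∧ c (G.r (G.r d)) ≠ p) :
    ∃ t ∈ (G.glue gadH).T, t (Sum.inl (G.q 0)) = decide (c (G.r (G.q 0)) = a) ∧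
      (t (Sum.inl (G.q 0)) ^^ t (Sum.inl (G.q 1))) = decide (c (G.r (G.q 0)) = c (G.r (G.q 1))) ∧
      (t (Sum.inl (G.q 2)) ^^ t (Sum.inl (G.q 3))) = decide (c (G.r (G.q 2)) = c (G.r (G.q 3))) ∧
      t (Sum.inr (0, 1)) = false ∧
      (∀ d, (∀ i, d ≠ G.q i) → t (Sum.inl d) = decide (c (G.r d) = c (G.r (G.α d)))) := by
  obtain ⟨s, hs⟩ := (Set.finite_range c).exists_notMem
  have hs : ∀ d, c d ≠ s := fun d h => hs ⟨d, h⟩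
  have n0 := h1 (G.r (G.q 0))
  have n2 := h1 (G.r (G.q 2))
  have hpa : p ≠ a := ea.ne n0
  have hpw : p ≠ w := ew.ne n2
  have hps : p ≠ s := by
    rcases ea with ⟨rfl, rfl⟩ | ⟨rfl, rfl⟩ <;> exact hs _
  have has : a ≠ s := by
    rcases ea with ⟨rfl, rfl⟩ | ⟨rfl, rfl⟩ <;> exact hs _
  have hws : w ≠ s := by
    rcases ew with ⟨rfl, rfl⟩ | ⟨rfl, rfl⟩ <;> exact hs _
  have φp : Equiv.swap p s p = s := Equiv.swap_apply_left _ _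
  have φo : ∀ n, n ≠ p → n ≠ s → Equiv.swap p s n = n := fun n h h' => Equiv.swap_apply_of_ne_of_ne h h'
  have φa := φo a hpa.symm has
  have φw := φo w hpw.symm hws
  have hf : ∀ d, (∀ i, d ≠ G.q i) → x d = true → x (G.α d) = false →
      Equiv.swap p s (c (G.r (G.α d))) = c (G.r (G.α d)) ∧
      Equiv.swap p s (c (G.r (G.r (G.α d)))) = c (G.r (G.r (G.α d))) := by
    intro d hp hd ha
    have := hcr d hp hd ha
    rcases h2 d hp with ⟨e1, e2⟩ | ⟨e1, e2⟩
    · rw [e1, e2] at this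
      exact ⟨φo _ this.1 (hs _), φo _ this.2 (hs _)⟩
    · rw [e1, e2] at this
      exact ⟨φo _ this.2 (hs _), φo _ this.1 (hs _)⟩
  have m1 := (ea.symm.trans e01).map (Equiv.swap p s)
  have m3 := (ew.symm.trans e23).map (Equiv.swap p s)
  rw [φp, φa] at m1
  rw [φp, φw] at m3
  have φs : ∀ n, Equiv.swap p s n = s ↔ n = p := by
    intro n
    constructor
    · intro h; exact (Equiv.swap p s).injective (h.trans φp.symm)
    · rintro rfl; exact φp
  have φw' : ∀ n, Equiv.swap p s n = w ↔ n = w := by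
    intro n
    constructor
    · intro h; rw [← φw] at h; exact (Equiv.swap p s).injective h
    · rintro rfl; exact φw
  obtain ⟨t, ht, t0, t1, t2, t3, th, tn, tc⟩ := G.extH c x hx x0 x1 x2 x3 (Equiv.swap p s) h1 h2
    (by
      intro d hp hd ha
      rw [(hf d hp hd ha).1, (hf d hp hd ha).2]
      exact h2 d hp)
    (yH s a p s p w) (yH_ne has.symm hpa.symm hps hps.symm hpw hws) ea.swap m1.symm ew
    m3.symm.swap (Or.inr ⟨rfl, rfl⟩)
  refine ⟨t, ht, t0, ?_, ?_, ?_, ?_⟩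
  · rw [t0, t1, ← ea.xor e01 hpa]
    exact congrArg₂ _ rfl (decide_eq_decide.2 (φs _))
  · rw [t2, t3, ← ew.swap.xor e23 hpw.symm]
    exact congrArg₂ _ rfl (decide_eq_decide.2 (φw' _))
  · rw [th]; simp [yH, hps]
  · intro d hp
    cases hd : x d <;> cases ha : x (G.α d)
    · exact tn d hp (by rw [hd, ha])
    · have hp' := G.α_not_port hp
      have a1 := tc (G.α d) hp' ha (by rw [G.α_inv]; exact hd)
      have a2 := (hf (G.α d) hp' ha (by rw [G.α_inv]; exact hd)).1
      rw [a2, G.α_inv] at a1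
      obtain ⟨c', hc', rfl⟩ := ht
      have a3 := (G.glue gadH).tw_α c' (Sum.inl d)
      rw [glue_α_inl _ _ _ hp] at a3
      rw [← a3, a1]
      simp [eq_comm]
    · rw [tc d hp hd ha, (hf d hp hd ha).1]
    · exact tn d hp (by rw [hd, ha])

/-- Swapping two colours. -/
theorem swapB (G : OG O 4) (c : O → ℕ) (x : O → Bool) (hx : ∀ d, x (G.r d) = x d)
    (x0 : x (G.q 0) = true) (x1 : x (G.q 1) = false) (x2 : x (G.q 2) = true)
    (x3 : x (G.q 3) = false)
    (h1 : ∀ d, c d ≠ c (G.r d))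
    (h2 : ∀ d, (∀ i, d ≠ G.q i) → EdgeOK (c (G.r d)) (c (G.r (G.r d))) (c (G.r (G.α d))) (c (G.r (G.r (G.α d)))))
    (e01 : EdgeOK (c (G.r (G.q 0))) (c (G.r (G.r (G.q 0)))) (c (G.r (G.q 1))) (c (G.r (G.r (G.q 1)))))
    (e23 : EdgeOK (c (G.r (G.q 2))) (c (G.r (G.r (G.q 2)))) (c (G.r (G.q 3))) (c (G.r (G.r (G.q 3)))))
    (p a w : ℕ) (haw : a ≠ w) (ea : EdgeOK (c (G.r (G.q 0))) (c (G.r (G.r (G.q 0)))) p a)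
    (ew : EdgeOK (c (G.r (G.q 2))) (c (G.r (G.r (G.q 2)))) p w)
    (hcr : ∀ d, (∀ i, d ≠ G.q i) → x d = true → x (G.α d) = false →
      EdgeOK (c (G.r d)) (c (G.r (G.r d))) a w) :
    ∃ t ∈ (G.glue gadH).T,
      (t (Sum.inl (G.q 0)) ^^ t (Sum.inl (G.q 1))) = decide (c (G.r (G.q 0)) = c (G.r (G.q 1))) ∧
      (t (Sum.inl (G.q 2)) ^^ t (Sum.inl (G.q 3))) = decide (c (G.r (G.q 2)) = c (G.r (G.q 3))) ∧
      t (Sum.inr (0, 1)) = true ∧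
      (∀ d, (∀ i, d ≠ G.q i) → (t (Sum.inl d) ^^ decide (x d ≠ x (G.α d))) =
        decide (c (G.r d) = c (G.r (G.α d)))) := by
  have n0 := h1 (G.r (G.q 0))
  have n2 := h1 (G.r (G.q 2))
  have hpa : p ≠ a := ea.ne n0
  have hpw : p ≠ w := ew.ne n2
  have φa : Equiv.swap a w a = w := Equiv.swap_apply_left _ _
  have φw : Equiv.swap a w w = a := Equiv.swap_apply_right _ _
  have φp : Equiv.swap a w p = p := Equiv.swap_apply_of_ne_of_ne hpa hpw
  have m1 := (ea.symm.trans e01).map (Equiv.swap a w)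
  have m3 := (ew.symm.trans e23).map (Equiv.swap a w)
  rw [φp, φa] at m1
  rw [φp, φw] at m3
  have φs : ∀ n, Equiv.swap a w n = w ↔ n = a := by
    intro n
    constructor
    · intro h; exact (Equiv.swap a w).injective (h.trans φa.symm)
    · rintro rfl; exact φa
  have φp' : ∀ n, Equiv.swap a w n = p ↔ n = p := by
    intro n
    constructor
    · intro h; exact (Equiv.swap a w).injective (h.trans φp.symm)
    · rintro rfl; exact φp
  obtain ⟨t, ht, t0, t1, t2, t3, th, tn, tc⟩ := G.extH c x hx x0 x1 x2 x3 (Equiv.swap a w) h1 h2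
    (by
      intro d hp hd ha
      have e := hcr d hp hd ha
      have := (e.symm.trans (h2 d hp)).map (Equiv.swap a w)
      rw [φa, φw] at this
      exact e.swap.trans this)
    (yH w p a a w p) (yH_ne hpw.symm hpa haw haw hpw.symm hpa) ea m1.symm.swap.symm.symm ew.swap
    m3.symm (Or.inl ⟨rfl, rfl⟩)
  have key : ∀ d, (∀ i, d ≠ G.q i) → x d = true → x (G.α d) = false →
      (t (Sum.inl d) ^^ true) = decide (c (G.r d) = c (G.r (G.α d))) := by
    intro d hp hd ha
    rw [tc d hp hd ha]
    have e := hcr d hp hd ha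
    have e2 := e.symm.trans (h2 d hp)
    rcases e with ⟨e, e'⟩ | ⟨e, e'⟩ <;> rcases e2 with ⟨k, k'⟩ | ⟨k, k'⟩ <;> 
      simp [e, ← k, ← k', haw, haw.symm]
  refine ⟨t, ht, ?_, ?_, ?_, ?_⟩
  · rw [t0, t1, ← ea.swap.xor e01 hpa.symm]
    exact congrArg₂ _ rfl (decide_eq_decide.2 (φs _))
  · rw [t2, t3, ← ew.xor e23 hpw]
    exact congrArg₂ _ rfl (decide_eq_decide.2 (φp' _))
  · rw [th]; simp [yH]
  · intro d hp
    cases hd : x d <;> cases ha : x (G.α d)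
    · simpa using tn d hp (by rw [hd, ha])
    · have hp' := G.α_not_port hp
      have a1 := key (G.α d) hp' ha (by rw [G.α_inv]; exact hd)
      rw [G.α_inv] at a1
      obtain ⟨c', hc', rfl⟩ := ht
      have a3 := (G.glue gadH).tw_α c' (Sum.inl d)
      rw [glue_α_inl _ _ _ hp] at a3
      rw [← a3]
      simpa [eq_comm] using a1
    · simpa using key d hp hd ha
    · simpa using tn d hp (by rw [hd, ha])

/-- Doubling from a pair of preimages. -/
theorem two_mul_ncard {A B : Type*} [Finite A] [Finite B] (S : Set A) (T : Set B) (dec : B → A)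
    (h : ∀ s ∈ S, ∃ t1 ∈ T, ∃ t2 ∈ T, t1 ≠ t2 ∧ dec t1 = s ∧ dec t2 = s) :
    2 * S.ncard ≤ T.ncard := by
  rcases S.eq_empty_or_nonempty with rfl | ⟨s0, hs0⟩
  · simp
  have : Nonempty B := ⟨(h s0 hs0).choose⟩
  choose! f1 m1 f2 m2 hne d1 d2 using h
  have i1 : Set.InjOn f1 S := fun a ha b hb e => by rw [← d1 a ha, ← d1 b hb, e]
  have i2 : Set.InjOn f2 S := fun a ha b hb e => by rw [← d2 a ha, ← d2 b hb, e]
  have hd : Disjoint (f1 '' S) (f2 '' S) := by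
    rw [Set.disjoint_left]
    rintro _ ⟨a, ha, rfl⟩ ⟨b, hb, e⟩
    have : b = a := by rw [← d2 b hb, e, d1 a ha]
    subst this
    exact hne _ ha e.symm
  have hsub : f1 '' S ∪ f2 '' S ⊆ T := by
    rintro _ (⟨a, ha, rfl⟩ | ⟨a, ha, rfl⟩)
    · exact m1 a ha
    · exact m2 a ha
  have := Set.ncard_le_ncard hsub (Set.toFinite _)
  rw [Set.ncard_union_eq hd (Set.toFinite _) (Set.toFinite _), Set.ncard_image_of_injOn i1,
    Set.ncard_image_of_injOn i2] at this
  omega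

end OG
end CiDC

namespace CiDC

theorem three_pairs {u v u2 v2 u3 v3 : ℕ} (n1 : u ≠ v) (n2 : u2 ≠ v2) (n3 : u3 ≠ v3)
    (h : ∀ X, ((if u = X ∨ v = X then 1 else 0) + (if u2 = X ∨ v2 = X then 1 else 0)
      + (if u3 = X ∨ v3 = X then 1 else 0) : ZMod 2) = 0) :
    ∃ p a w, a ≠ w ∧ EdgeOK u v p a ∧ EdgeOK u2 v2 p w ∧ EdgeOK u3 v3 a w := by
  have h' : ∀ X, ((u = X ∨ v = X) ↔ ¬ ((u2 = X ∨ v2 = X) ↔ (u3 = X ∨ v3 = X))) := by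
    intro X
    have := h X
    by_cases a : u = X ∨ v = X <;> by_cases b : u2 = X ∨ v2 = X <;> by_cases c : u3 = X ∨ v3 = X <;>
      simp only [a, b, c, if_true, if_false] at this ⊢ <;> revert this <;> decide
  have a1 := h' u
  have a2 := h' v
  have a3 := h' u2
  have a4 := h' v2
  have a5 := h' u3
  have a6 := h' v3
  clear h h'
  by_cases e : u = u2
  · subst e
    refine ⟨u, v, v2, ?_, Or.inl ⟨rfl, rfl⟩, Or.inl ⟨rfl, rfl⟩, ?_⟩
    · grind
    · simp only [EdgeOK]; grind
  by_cases e' : u = v2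
  · subst e'
    refine ⟨u, v, u2, ?_, Or.inl ⟨rfl, rfl⟩, Or.inr ⟨rfl, rfl⟩, ?_⟩
    · grind
    · simp only [EdgeOK]; grind
  by_cases e3 : v = u2
  · subst e3
    refine ⟨v, u, v2, ?_, Or.inr ⟨rfl, rfl⟩, Or.inl ⟨rfl, rfl⟩, ?_⟩
    · grind
    · simp only [EdgeOK]; grind
  by_cases e4 : v = v2
  · subst e4
    refine ⟨v, u, u2, ?_, Or.inr ⟨rfl, rfl⟩, Or.inr ⟨rfl, rfl⟩, ?_⟩
    · grind
    · simp only [EdgeOK]; grind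
  exfalso
  grind

theorem two_pairs {u v u2 v2 : ℕ} (n1 : u ≠ v)
    (h : ∀ X, ((if u = X ∨ v = X then 1 else 0) + (if u2 = X ∨ v2 = X then 1 else 0) : ZMod 2) = 0) :
    EdgeOK u2 v2 u v := by
  have a1 := h u
  have a2 := h v
  have b1 : u2 = u ∨ v2 = u := by
    by_contra h; simp [h] at a1
  have b2 : u2 = v ∨ v2 = v := by
    by_contra h; simp [h] at a2
  simp only [EdgeOK]; grind

namespace OG
variable {O : Type*}

open scoped Classical in
/-- Decoding twists. -/
noncomputable def decH (G : OG O 4) (x : O → Bool) (t : O ⊕ (Fin 2 × Fin 3) → Bool) :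
    O ⊕ Empty → Bool
  | Sum.inl d => if d = G.q 0 ∨ d = G.q 1 then t (Sum.inl (G.q 0)) ^^ t (Sum.inl (G.q 1)) else
      if d = G.q 2 ∨ d = G.q 3 then t (Sum.inl (G.q 2)) ^^ t (Sum.inl (G.q 3)) else
      t (Sum.inl d) ^^ (t (Sum.inr (0, 1)) && decide (x d ≠ x (G.α d)))
  | Sum.inr z => z.elim

theorem dec_eq (G : OG O 4) (x : O → Bool) (t : O ⊕ (Fin 2 × Fin 3) → Bool) (cM : O ⊕ Empty → ℕ)
    (c : O → ℕ) (hcM : ∀ d, cM (Sum.inl d) = c d)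
    (h0 : (t (Sum.inl (G.q 0)) ^^ t (Sum.inl (G.q 1))) = decide (c (G.r (G.q 0)) = c (G.r (G.q 1))))
    (h2 : (t (Sum.inl (G.q 2)) ^^ t (Sum.inl (G.q 3))) = decide (c (G.r (G.q 2)) = c (G.r (G.q 3))))
    (hn : ∀ d, (∀ i, d ≠ G.q i) → (t (Sum.inl d) ^^ (t (Sum.inr (0, 1)) && decide (x d ≠ x (G.α d)))) =
      decide (c (G.r d) = c (G.r (G.α d)))) : G.decH x t = (G.glue gadM).tw cM := by
  funext z
  rcases z with d | z
  · by_cases hd : ∃ i, d = G.q i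
    · obtain ⟨i, rfl⟩ := hd
      have inj : ∀ i j : Fin 4, G.q i = G.q j ↔ i = j := fun i j => G.q_inj.eq_iff
      simp only [decH, CG.tw, glue_α_q, inj]
      fin_cases i
      · exact h0.trans (by rw [← hcM, ← hcM]; rfl)
      · exact h0.trans (decide_eq_decide.2 (by rw [← hcM, ← hcM]; exact eq_comm))
      · exact h2.trans (by rw [← hcM, ← hcM]; rfl)
      · exact h2.trans (decide_eq_decide.2 (by rw [← hcM, ← hcM]; exact eq_comm))
    · have hd : ∀ i, d ≠ G.q i := fun i h => hd ⟨i, h⟩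
      simp only [decH, CG.tw, glue_α_inl _ _ _ hd, hd, or_self, if_false, hn d hd, glue_r_inl, hcM]
  · exact z.elim

theorem nuH [Finite O] (G : OG O 4) (x : O → Bool) (hx : ∀ d, x (G.r d) = x d)
    (x0 : x (G.q 0) = true) (x1 : x (G.q 1) = false) (x2 : x (G.q 2) = true)
    (x3 : x (G.q 3) = false) (f : O)
    (hf : ∀ d, (∀ i, d ≠ G.q i) → x d ≠ x (G.α d) → d = f ∨ d = G.α f) :
    2 * (G.glue gadM).nu ≤ (G.glue gadH).nu := by
  classical
  have : Fintype O := Fintype.ofFinite O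
  refine two_mul_ncard _ _ (G.decH x) ?_
  rintro _ ⟨cM, hc, rfl⟩
  obtain ⟨h1, h2, e01, e23⟩ := G.colM hc
  have par := fun X => (G.glue gadM).parity (G.glue_fpf _ (by
    rintro (i | x)
    · fin_cases i <;> simp [gadM]
    · exact x.elim)) (CG.gX_mem _ hc X) (Sum.elim x Empty.elim) (by
      rintro (d | z)
      · exact hx d
      · exact z.elim)
  simp only [CG.gX, glue_r_inl] at par
  set c : O → ℕ := cM ∘ Sum.inl with hcdef
  have hcM : ∀ d, cM (Sum.inl d) = c d := fun d => rfl
  have n0 := h1 (G.r (G.q 0))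
  have n2 := h1 (G.r (G.q 2))
  have α0 : (G.glue gadM).α (Sum.inl (G.q 0)) = Sum.inl (G.q 1) := G.glue_α_q gadM 0
  have α1 : (G.glue gadM).α (Sum.inl (G.q 1)) = Sum.inl (G.q 0) := G.glue_α_q gadM 1
  have α2 : (G.glue gadM).α (Sum.inl (G.q 2)) = Sum.inl (G.q 3) := G.glue_α_q gadM 2
  have α3 : (G.glue gadM).α (Sum.inl (G.q 3)) = Sum.inl (G.q 2) := G.glue_α_q gadM 3
  have q02 : (Sum.inl (G.q 0) : O ⊕ Empty) ≠ Sum.inl (G.q 2) := by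
    simp [G.q_inj.eq_iff]
  by_cases hcase : ∃ f0, (∀ i, f0 ≠ G.q i) ∧ x f0 = true ∧ x (G.α f0) = false
  · obtain ⟨f0, hfp, hf1, hf2⟩ := hcase
    have huniq : ∀ d, (∀ i, d ≠ G.q i) → x d = true → x (G.α d) = false → d = f0 := by
      intro d hp hd ha
      have a := hf d hp (by simp [hd, ha])
      have b := hf f0 hfp (by simp [hf1, hf2])
      rcases a with rfl | rfl <;> rcases b with rfl | rfl
      · rfl
      · exact absurd (hf1.symm.trans ha) (by decide)
      · exact absurd (hd.symm.trans hf2) (by decide)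
      · rfl
    have hF : Finset.univ.filter (fun d => (Sum.elim x Empty.elim : O ⊕ Empty → Bool) d = true ∧
        (Sum.elim x Empty.elim : O ⊕ Empty → Bool) ((G.glue gadM).α d) = false) =
        {Sum.inl (G.q 0), Sum.inl (G.q 2), Sum.inl f0} := by
      ext z
      simp only [Finset.mem_filter, Finset.mem_univ, true_and, Finset.mem_insert, Finset.mem_singleton]
      constructor
      · rintro ⟨z1, z2⟩
        rcases G.cases_emb z with ⟨p, rfl⟩ | ⟨d, rfl, hd⟩
        · rcases p with i | z
          · fin_cases i
            · exact Or.inl rfl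
            · exact absurd (z1.symm.trans x1) (by decide)
            · exact Or.inr (Or.inl rfl)
            · exact absurd (z1.symm.trans x3) (by decide)
          · exact z.elim
        · rw [glue_α_inl _ _ _ hd] at z2
          right; right; rw [huniq d hd z1 z2]
      · rintro (rfl | rfl | rfl)
        · rw [α0]; exact ⟨x0, x1⟩
        · rw [α2]; exact ⟨x2, x3⟩
        · rw [glue_α_inl _ _ _ hfp]; exact ⟨hf1, hf2⟩
    have par' : ∀ X, ((if c (G.r (G.q 0)) = X ∨ c (G.r (G.r (G.q 0))) = X then 1 else 0) +
        (if c (G.r (G.q 2)) = X ∨ c (G.r (G.r (G.q 2))) = X then 1 else 0) +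
        (if c (G.r f0) = X ∨ c (G.r (G.r f0)) = X then 1 else 0) : ZMod 2) = 0 := by
      intro X
      have := par X
      rw [hF, Finset.sum_insert (by simp [G.q_inj.eq_iff, (hfp 0).symm]),
        Finset.sum_insert (by simp [(hfp 2).symm]), Finset.sum_singleton] at this
      simp only [glue_r_inl, hcM] at this
      rw [add_assoc]
      exact this
    obtain ⟨p, a, w, haw, ea, ew, ef⟩ := three_pairs n0 n2 (h1 (G.r f0)) par'
    have hpa : p ≠ a := ea.ne n0
    have hpw : p ≠ w := ew.ne n2
    obtain ⟨t, ht, -, u0, u2, uh, un⟩ := G.splitA c x hx x0 x1 x2 x3 h1 h2 e01 e23 p a w ea ew (by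
      intro d hp hd ha
      rw [huniq d hp hd ha]
      rcases ef with ⟨e, e'⟩ | ⟨e, e'⟩ <;> rw [e, e']
      · exact ⟨hpa.symm, hpw.symm⟩
      · exact ⟨hpw.symm, hpa.symm⟩)
    obtain ⟨t', ht', u0', u2', uh', un'⟩ := G.swapB c x hx x0 x1 x2 x3 h1 h2 e01 e23 p a w haw ea ew (by
      intro d hp hd ha
      rw [huniq d hp hd ha]
      exact ef)
    refine ⟨t, ht, t', ht', ?_, ?_, ?_⟩
    · intro h; rw [h, uh'] at uh; cases uh
    · exact G.dec_eq x t cM c hcM u0 u2 (by intro d hp; rw [uh]; simpa using un d hp)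
    · exact G.dec_eq x t' cM c hcM u0' u2' (by intro d hp; rw [uh']; simpa using un' d hp)
  · have hF : Finset.univ.filter (fun d => (Sum.elim x Empty.elim : O ⊕ Empty → Bool) d = true ∧
        (Sum.elim x Empty.elim : O ⊕ Empty → Bool) ((G.glue gadM).α d) = false) =
        {Sum.inl (G.q 0), Sum.inl (G.q 2)} := by
      ext z
      simp only [Finset.mem_filter, Finset.mem_univ, true_and, Finset.mem_insert, Finset.mem_singleton]
      constructor
      · rintro ⟨z1, z2⟩
        rcases G.cases_emb z with ⟨p, rfl⟩ | ⟨d, rfl, hd⟩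
        · rcases p with i | z
          · fin_cases i
            · exact Or.inl rfl
            · exact absurd (z1.symm.trans x1) (by decide)
            · exact Or.inr rfl
            · exact absurd (z1.symm.trans x3) (by decide)
          · exact z.elim
        · rw [glue_α_inl _ _ _ hd] at z2
          exact absurd ⟨d, hd, z1, z2⟩ hcase
      · rintro (rfl | rfl)
        · rw [α0]; exact ⟨x0, x1⟩
        · rw [α2]; exact ⟨x2, x3⟩
    have par' : ∀ X, ((if c (G.r (G.q 0)) = X ∨ c (G.r (G.r (G.q 0))) = X then 1 else 0) +
        (if c (G.r (G.q 2)) = X ∨ c (G.r (G.r (G.q 2))) = X then 1 else 0) : ZMod 2) = 0 := by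
      intro X
      have := par X
      rw [hF, Finset.sum_insert (by simp [G.q_inj.eq_iff]), Finset.sum_singleton] at this
      simp only [glue_r_inl, hcM] at this
      exact this
    have ew := two_pairs n0 par'
    have hno : ∀ d, (∀ i, d ≠ G.q i) → x d = true → x (G.α d) = false → False :=
      fun d hp hd ha => hcase ⟨d, hp, hd, ha⟩
    obtain ⟨t, ht, w0, u0, u2, uh, un⟩ := G.splitA c x hx x0 x1 x2 x3 h1 h2 e01 e23 _ _ _
      (Or.inl ⟨rfl, rfl⟩) ew (fun d hp hd ha => (hno d hp hd ha).elim)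
    obtain ⟨t', ht', w0', u0', u2', uh', un'⟩ := G.splitA c x hx x0 x1 x2 x3 h1 h2 e01 e23 _ _ _
      (Or.inr ⟨rfl, rfl⟩) ew.swap (fun d hp hd ha => (hno d hp hd ha).elim)
    refine ⟨t, ht, t', ht', ?_, ?_, ?_⟩
    · intro h
      rw [← h, w0] at w0'
      rw [decide_eq_false n0] at w0'
      simp at w0'
    · exact G.dec_eq x t cM c hcM u0 u2 (by intro d hp; rw [uh]; simpa using un d hp)
    · exact G.dec_eq x t' cM c hcM u0' u2' (by intro d hp; rw [uh']; simpa using un' d hp)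

end OG
end CiDC

namespace CiDC
namespace OG
variable {O : Type*}

/-- Extension of a vertex set over the two vertices of `gadH`. -/
def extV (y : O → Bool) (a b : Bool) : O ⊕ (Fin 2 × Fin 3) → Bool :=
  Sum.elim y (fun p => if p.1 = 0 then a else b)

theorem extV_inv (G : OG O 4) (y : O → Bool) (hy : ∀ d, y (G.r d) = y d) (a b : Bool) (z) :
    extV y a b ((G.glue gadH).r z) = extV y a b z := by
  rcases z with d | ⟨i, j⟩
  · exact hy d
  · rfl

theorem Hcut (G : OG O 4) (hH : (G.glue gadH).Good) (y : O → Bool) (hy : ∀ d, y (G.r d) = y d)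
    (a b : Bool) (z0 : O ⊕ (Fin 2 × Fin 3))
    (h : ∀ d, (∀ i, d ≠ G.q i) → y d ≠ y (G.α d) →
      Sum.inl d = z0 ∨ Sum.inl d = (G.glue gadH).α z0)
    (h0 : y (G.q 0) ≠ a → z0 = Sum.inl (G.q 0)) (h1 : y (G.q 1) ≠ a → z0 = Sum.inl (G.q 1))
    (h2 : y (G.q 2) ≠ b → z0 = Sum.inl (G.q 2)) (h3 : y (G.q 3) ≠ b → z0 = Sum.inl (G.q 3))
    (hh : a ≠ b → z0 = Sum.inr (0, 1)) (d : O) : y d = a := by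
  refine hH.cut (extV y a b) (G.extV_inv y hy a b) z0 ?_ (Sum.inl d) (Sum.inr (0, 0))
  intro z hz
  have key : ∀ z z' : O ⊕ (Fin 2 × Fin 3), (G.glue gadH).α z = z' → z0 = z → 
      (z = z0 ∨ z = (G.glue gadH).α z0) ∧ (z' = z0 ∨ z' = (G.glue gadH).α z0) := by
    rintro z z' h rfl
    exact ⟨Or.inl rfl, Or.inr h.symm⟩
  rcases G.cases_emb z with ⟨p, rfl⟩ | ⟨d, rfl, hd⟩
  · rw [glue_α_emb] at hz
    rcases p with i | ⟨i, j⟩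
    · fin_cases i
      · exact Or.inl (h0 hz).symm
      · exact Or.inl (h1 hz).symm
      · exact Or.inl (h2 hz).symm
      · exact Or.inl (h3 hz).symm
    · fin_cases i <;> fin_cases j
      · exact (key _ _ (G.glue_α_q gadH 0) (h0 (Ne.symm hz))).2
      · exact Or.inl (hh hz).symm
      · exact (key _ _ (G.glue_α_q gadH 1) (h1 (Ne.symm hz))).2
      · exact (key _ _ (G.glue_α_q gadH 2) (h2 (Ne.symm hz))).2
      · exact (key _ _ (G.glue_α_q gadH 3) (h3 (Ne.symm hz))).2
      · exact (key _ _ (G.glue_α_emb gadH (Sum.inr (0, 1))) (hh (Ne.symm hz))).2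
  · rw [glue_α_inl _ _ _ hd] at hz
    exact h d hd hz

theorem macU (G : OG O 4) (hH : (G.glue gadH).Good) : Mac (G.glue gadM).cyc := by
  refine (hH.mac.inf (Sum.inr (0, 1))).map (Sum.elim Sum.inl Empty.elim) _ ?_ ?_
  · rintro g ⟨hg, hz⟩
    rw [mem_cyc_glue]
    rw [SetLike.mem_coe, mem_cyc_glue] at hg
    have hz : g (Sum.inr (0, 1)) = 0 := hz
    obtain ⟨g1, g2, g3, g4⟩ := hg
    have a0 : g (Sum.inr (0, 0)) = g (Sum.inl (G.q 0)) := g3 (Sum.inl 0)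
    have a1 : g (Sum.inr (0, 2)) = g (Sum.inl (G.q 1)) := g3 (Sum.inl 1)
    have a2 : g (Sum.inr (1, 0)) = g (Sum.inl (G.q 2)) := g3 (Sum.inl 2)
    have a3 : g (Sum.inr (1, 1)) = g (Sum.inl (G.q 3)) := g3 (Sum.inl 3)
    have a4 : g (Sum.inr (0, 1)) = g (Sum.inr (1, 2)) := g3 (Sum.inr (1, 2))
    have b0 : g (Sum.inr (0, 0)) + g (Sum.inr (0, 1)) + g (Sum.inr (0, 2)) = 0 := g4 (0, 0)
    have b1 : g (Sum.inr (1, 0)) + g (Sum.inr (1, 1)) + g (Sum.inr (1, 2)) = 0 := g4 (1, 0)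
    rw [← a4] at b1
    rw [hz, a0, a1] at b0
    rw [hz, a2, a3] at b1
    have e1 : g (Sum.inl (G.q 0)) = g (Sum.inl (G.q 1)) := by
      linear_combination b0 - zz (g (Sum.inl (G.q 1)))
    have e2 : g (Sum.inl (G.q 2)) = g (Sum.inl (G.q 3)) := by
      linear_combination b1 - zz (g (Sum.inl (G.q 3)))
    refine ⟨g1, g2, ?_, fun z => z.elim⟩
    rintro (i | z)
    · fin_cases i
      · exact e1.symm
      · exact e1
      · exact e2.symm
      · exact e2
    · exact z.elim
  · intro g' hg'
    rw [mem_cyc_glue] at hg'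
    obtain ⟨g1, g2, g3, -⟩ := hg'
    have e1 : g' (Sum.inl (G.q 1)) = g' (Sum.inl (G.q 0)) := g3 (Sum.inl 0)
    have e2 : g' (Sum.inl (G.q 3)) = g' (Sum.inl (G.q 2)) := g3 (Sum.inl 2)
    let b : Fin 2 × Fin 3 → ZMod 2 := fun p => match p with
      | (0, 0) => g' (Sum.inl (G.q 0))
      | (0, 1) => 0
      | (0, 2) => g' (Sum.inl (G.q 0))
      | (1, 0) => g' (Sum.inl (G.q 2))
      | (1, 1) => g' (Sum.inl (G.q 2))
      | (1, 2) => 0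
    refine ⟨Sum.elim (fun d => g' (Sum.inl d)) b, ⟨?_, rfl⟩, ?_⟩
    · rw [SetLike.mem_coe, mem_cyc_glue]
      refine ⟨g1, g2, ?_, ?_⟩
      · rintro (i | ⟨i, j⟩)
        · fin_cases i
          · rfl
          · exact e1.symm
          · rfl
          · exact e2.symm
        · fin_cases i <;> fin_cases j
          · rfl
          · rfl
          · exact e1
          · rfl
          · exact e2
          · rfl
      · rintro ⟨i, j⟩
        fin_cases i <;> fin_cases j <;> simp [b, gadH, zz]
    · funext z
      rcases z with d | z
      · rfl
      · exact z.elim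

theorem goodU [Finite O] (G : OG O 4) (hH : (G.glue gadH).Good) (x : O → Bool) (hx : ∀ d, x (G.r d) = x d)
    (x0 : x (G.q 0) = true) (x1 : x (G.q 1) = false) (x2 : x (G.q 2) = true)
    (x3 : x (G.q 3) = false) (f : O)
    (hf : ∀ d, (∀ i, d ≠ G.q i) → x d ≠ x (G.α d) → d = f ∨ d = G.α f)
    (g : O ⊕ (Fin 2 × Fin 3) → ZMod 2) (hg : g ∈ (G.glue gadH).cyc) (gh : g (Sum.inr (0, 1)) = 1)
    (gx : ∀ d, x d = true → g (Sum.inl d) = 0) : (G.glue gadM).Good := by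
  classical
  have : Fintype O := Fintype.ofFinite O
  refine ⟨G.glue_fpf _ (by
    rintro (i | x)
    · fin_cases i <;> simp [gadM]
    · exact x.elim), ?_, G.macU hH⟩
  intro y' hy' z0 hz0
  set y : O → Bool := fun d => y' (Sum.inl d) with hyd
  have hy : ∀ d, y (G.r d) = y d := fun d => hy' (Sum.inl d)
  suffices hs : ∃ v, ∀ d, y d = v by
    obtain ⟨v, hv⟩ := hs
    rintro (d | z) (d' | z')
    · exact (hv d).trans (hv d').symm
    · exact z'.elim
    · exact z.elim
    · exact z.elim
  have main : ∀ d0 : O, (∀ d, (∀ i, d ≠ G.q i) → y d ≠ y (G.α d) → d = d0 ∨ d = G.α d0) →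
      y (G.q 0) = y (G.q 1) → y (G.q 2) = y (G.q 3) → (∀ i, d0 ≠ G.q i) → ∃ v, ∀ d, y d = v := by
    intro d0 hd0 e1 e2 hp0
    by_cases hab : y (G.q 0) = y (G.q 2)
    · refine ⟨_, G.Hcut hH y hy (y (G.q 0)) (y (G.q 0)) (Sum.inl d0) ?_ (by simp) (by simp [e1])
        (by simp [hab]) (by simp [hab, e2]) (by simp)⟩
      intro d hd hne
      rw [glue_α_inl _ _ _ hp0]
      rcases hd0 d hd hne with h | h
      · exact Or.inl (by rw [h])
      · exact Or.inr (by rw [h])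
    · exfalso
      have hgα := (G.mem_cyc_glue _ _).1 hg
      obtain ⟨g1, -, g3, -⟩ := hgα
      have gh' : g (Sum.inr (1, 2)) = 1 := (g3 (Sum.inr (0, 1))).trans gh
      have hcr : ∃ d1, (∀ i, d1 ≠ G.q i) ∧ y d1 ≠ y (G.α d1) ∧ g (Sum.inl d1) ≠ 0 := by
        by_contra hno
        push Not at hno
        have par := (G.glue gadH).parity hH.fpf hg (extV y (y (G.q 0)) (y (G.q 2)))
          (G.extV_inv y hy _ _)
        have hb : y (G.q 2) = !y (G.q 0) := by
          revert hab; cases y (G.q 0) <;> cases y (G.q 2) <;> simp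
        let w : O ⊕ (Fin 2 × Fin 3) := if y (G.q 0) then Sum.inr (0, 1) else Sum.inr (1, 2)
        have gw : g w = 1 := by simp only [w]; split_ifs <;> assumption
        rw [Finset.sum_eq_single w] at par
        · rw [gw] at par; exact absurd par (by decide)
        · intro z hz hzw
          rw [Finset.mem_filter] at hz
          obtain ⟨-, hz1, hz2⟩ := hz
          rcases G.cases_emb z with ⟨p, rfl⟩ | ⟨d, rfl, hd⟩
          · exfalso
            rw [glue_α_emb] at hz2
            rcases p with i | ⟨i, j⟩
            · fin_cases i
              · exact absurd (hz1.symm.trans hz2) (by decide)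
              · exact absurd ((e1.trans hz1).symm.trans hz2) (by decide)
              · exact absurd (hz1.symm.trans hz2) (by decide)
              · exact absurd ((e2.trans hz1).symm.trans hz2) (by decide)
            · fin_cases i <;> fin_cases j
              · exact absurd (hz1.symm.trans hz2) (by decide)
              · have : y (G.q 0) = true := hz1
                apply hzw; simp [w, this]; rfl
              · exact absurd ((e1.symm.trans hz1).symm.trans hz2) (by decide)
              · exact absurd (hz1.symm.trans hz2) (by decide)
              · exact absurd ((e2.symm.trans hz1).symm.trans hz2) (by decide)
              · have : y (G.q 0) = false := hz2
                apply hzw; simp [w, this]; rfl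
          · rw [glue_α_inl _ _ _ hd] at hz2
            refine hno d hd ?_
            have h1 : y d = true := hz1
            have h2 : y (G.α d) = false := hz2
            rw [h1, h2]; decide
        · intro hw
          exfalso; apply hw
          rw [Finset.mem_filter]
          refine ⟨Finset.mem_univ _, ?_⟩
          cases h : y (G.q 0)
          · have : w = G.emb (Sum.inr (1, 2)) := by simp [w, h]; rfl
            rw [this, glue_α_emb]
            rw [h] at hb
            exact ⟨hb, rfl⟩
          · have : w = G.emb (Sum.inr (0, 1)) := by simp [w, h]; rfl
            rw [this, glue_α_emb]
            rw [h] at hb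
            exact ⟨rfl, hb⟩
      obtain ⟨d1, hp1, hy1, hg1⟩ := hcr
      have xd1 : x d1 = false := by
        by_contra hh; exact hg1 (gx _ (by simpa using hh))
      have xd1' : x (G.α d1) = false := by
        by_contra hh; exact hg1 ((g1 d1 hp1).symm.trans (gx _ (by simpa using hh)))
      have yx : ∀ d, (∀ i, d ≠ G.q i) → x d = true → y d = y (G.α d) := by
        intro d hd hxd
        by_contra hne
        rcases hd0 d hd hne with rfl | rfl <;> rcases hd0 d1 hp1 hy1 with rfl | rfl
        · rw [hxd] at xd1; cases xd1
        · rw [G.α_inv, hxd] at xd1'; cases xd1'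
        · rw [hxd] at xd1'; cases xd1'
        · rw [hxd] at xd1; cases xd1
      -- find a boolean `v` such that `x && (y == v)` has no crossing
      have hv : ∃ v : Bool, ∀ d, (∀ i, d ≠ G.q i) → x d = true → x (G.α d) = false → y d ≠ v := by
        by_cases hc : ∃ d, (∀ i, d ≠ G.q i) ∧ x d = true ∧ x (G.α d) = false
        · obtain ⟨d2, hp2, hx2, hx2'⟩ := hc
          refine ⟨!y d2, fun d hd hxd hxd' => ?_⟩
          have : d = d2 := by
            have a := hf d hd (by simp [hxd, hxd'])
            have b := hf d2 hp2 (by simp [hx2, hx2'])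
            rcases a with rfl | rfl <;> rcases b with rfl | rfl
            · rfl
            · exact absurd (hx2.symm.trans hxd') (by decide)
            · exact absurd (hxd.symm.trans hx2') (by decide)
            · rfl
          rw [this]; cases y d2 <;> decide
        · exact ⟨true, fun d hd h1 h2 => absurd ⟨d, hd, h1, h2⟩ hc⟩
      obtain ⟨v, hv⟩ := hv
      let s : O → Bool := fun d => x d && (y d == v)
      have hs : ∀ d, s (G.r d) = s d := fun d => by simp only [s, hx, hy]
      have hs1 : ∀ d, (∀ i, d ≠ G.q i) → s d = true → s (G.α d) = true := by
        intro d hd hsd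
        simp only [s, Bool.and_eq_true, beq_iff_eq] at hsd ⊢
        refine ⟨?_, (yx d hd hsd.1).symm.trans hsd.2⟩
        by_contra hh
        exact hv d hd hsd.1 (by simpa using hh) hsd.2
      have hs2 : ∀ d, (∀ i, d ≠ G.q i) → s d ≠ s (G.α d) → False := by
        intro d hd hne
        have a := hs1 d hd
        have b := hs1 (G.α d) (fun i => G.α_not_port hd i)
        rw [G.α_inv] at b
        revert hne a b; cases s d <;> cases s (G.α d) <;> simp
      have s1 : s (G.q 1) = false := by simp [s, x1]
      have s3 : s (G.q 3) = false := by simp [s, x3]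
      by_cases hva : y (G.q 0) = v
      · have s0 : s (G.q 0) = true := by simp [s, x0, hva]
        have s2 : s (G.q 2) = false := by
          rw [hva] at hab; simp [s, Ne.symm hab]
        have := G.Hcut hH s hs false false (Sum.inl (G.q 0)) (fun d hd hne => (hs2 d hd hne).elim)
          (fun _ => rfl) (by simp [s1]) (by simp [s2]) (by simp [s3]) (by simp) (G.q 0)
        rw [s0] at this; cases this
      · have s0 : s (G.q 0) = false := by simp [s, hva]
        have s2 : s (G.q 2) = true := by
          simp only [s, x2, Bool.true_and, beq_iff_eq]
          revert hab hva; cases y (G.q 0) <;> cases y (G.q 2) <;> cases v <;> simp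
        have := G.Hcut hH s hs false false (Sum.inl (G.q 2)) (fun d hd hne => (hs2 d hd hne).elim)
          (by simp [s0]) (by simp [s1]) (fun _ => rfl) (by simp [s3]) (by simp) (G.q 2)
        rw [s2] at this; cases this
  have noc : (∀ d, (∀ i, d ≠ G.q i) → y d = y (G.α d)) → ∃ v, ∀ d, y d = v := by
    intro hn
    by_cases e1 : y (G.q 0) = y (G.q 1)
    · by_cases e2 : y (G.q 2) = y (G.q 3)
      · exact ⟨_, G.Hcut hH y hy (y (G.q 0)) (y (G.q 2)) (Sum.inr (0, 1))
          (fun d hd hne => absurd (hn d hd) hne) (by simp) (by simp [e1]) (by simp) (by simp [e2])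
          (fun _ => rfl)⟩
      · exact ⟨_, G.Hcut hH y hy (y (G.q 0)) (y (G.q 0))
          (if y (G.q 2) = y (G.q 0) then Sum.inl (G.q 3) else Sum.inl (G.q 2))
          (fun d hd hne => absurd (hn d hd) hne) (by simp) (by simp [e1]) (fun h => if_neg h)
          (fun h => if_pos (by
            revert h e2; cases y (G.q 0) <;> cases y (G.q 2) <;> cases y (G.q 3) <;> simp))
          (by simp)⟩
    · by_cases e2 : y (G.q 2) = y (G.q 3)
      · exact ⟨_, G.Hcut hH y hy (y (G.q 2)) (y (G.q 2))
          (if y (G.q 0) = y (G.q 2) then Sum.inl (G.q 1) else Sum.inl (G.q 0))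
          (fun d hd hne => absurd (hn d hd) hne) (fun h => if_neg h)
          (fun h => if_pos (by
            revert h e1; cases y (G.q 0) <;> cases y (G.q 2) <;> cases y (G.q 1) <;> simp))
          (by simp) (by simp [e2]) (by simp)⟩
      · exfalso
        have q : ∀ i j : Fin 4, (Sum.inl (G.q i) : O ⊕ Empty) = Sum.inl (G.q j) ↔ i = j := by
          intro i j; simp [G.q_inj.eq_iff]
        have c0 := hz0 (G.emb (Sum.inl 0)) (by rw [glue_α_emb]; exact e1)
        have c2 := hz0 (G.emb (Sum.inl 2)) (by rw [glue_α_emb]; exact e2)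
        have α0 : (G.glue gadM).α (G.emb (Sum.inl 0)) = Sum.inl (G.q 1) := G.glue_α_q gadM 0
        have : G.emb (I := Empty) (Sum.inl 2) = G.emb (Sum.inl 0) ∨ G.emb (I := Empty) (Sum.inl 2) = Sum.inl (G.q 1) := by
          rcases c0 with c0 | c0 <;> rcases c2 with c2 | c2
          · left; rw [c0, c2]
          · right; rw [c2, ← c0, α0]
          · right
            rw [c2, ← α0, c0, CG.α_inv]
          · left; rw [c0, c2]
        rcases this with h | h
        · exact absurd ((q 2 0).1 h) (by decide)
        · exact absurd ((q 2 1).1 h) (by decide)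
  rcases G.glue_cut_cases gadM y' z0 hz0 with ⟨d0, hd0, hp⟩ | ⟨p0, hn, -⟩
  · by_cases hc : ∃ i, d0 = G.q i
    · refine noc fun d hd => ?_
      by_contra hne
      obtain ⟨i, rfl⟩ := hc
      rcases hd0 d hd hne with h | h
      · exact hd i h
      · exact hd i (h.trans ((G.fix_iff _).2 ⟨i, rfl⟩))
    · exact main d0 hd0 (hp (Sum.inl 0)) (hp (Sum.inl 2)) (fun i h => hc ⟨i, h⟩)
  · exact noc hn

end OG
end CiDC

namespace CiDC

theorem WIso.inv_symm {D D' : Type*} {G : CG D} {G' : CG D'} (w : WIso G G') {γ : Type*} (x : D → γ)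
    (hx : ∀ d, x (G.r d) = x d) (z : D') : x (w.e.symm (G'.r z)) = x (w.e.symm z) := by
  rcases w.symm.hr z with h | h
  · exact (congrArg x h).trans (hx _)
  · exact (congrArg x h).trans ((hx _).trans (hx _))

theorem WIso.cyc_symm {D D' : Type*} {G : CG D} {G' : CG D'} (w : WIso G G') {g : D → ZMod 2}
    (hg : g ∈ G.cyc) : (fun z => g (w.e.symm z)) ∈ G'.cyc := by
  rw [CG.mem_cyc] at hg ⊢
  refine ⟨fun d => ?_, fun d => ?_⟩
  · exact (congrArg g (w.symm.hα d)).trans (hg.1 _)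
  · have h2 := hg.2 (w.e.symm d)
    rcases w.symm.hrr d with ⟨h, h'⟩ | ⟨h, h'⟩
    · rw [← h2]
      exact congrArg₂ _ (congrArg₂ _ rfl (congrArg g h)) (congrArg g h')
    · rw [← h2, add_right_comm]
      exact congrArg₂ _ (congrArg₂ _ rfl (congrArg g h')) (congrArg g h)

universe u
namespace OG
variable {O : Type u}

theorem lemmaA [Finite O] {k : ℕ} [NeZero k] (G : OG O k) (hK : (G.glue (cycG k)).Good)
    (hc : G.Conf) (h1 : (0 - 1 : Fin k) ≠ 0) (h2 : (0 - 1 : Fin k) ≠ 1) (h3 : (1 + 1 : Fin k) ≠ 0)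
    (h4 : (1 + 1 : Fin k) ≠ 1) (h10 : (1 : Fin k) ≠ 0) (h11 : (1 + 1 : Fin k) = 2) :
    ∃ (D' : Type u) (G' : CG D'), Finite D' ∧ G'.Good ∧ 2 * G'.nu ≤ (G.glue (cycG k)).nu ∧
      Nat.card D' + 6 = Nat.card (O ⊕ (Fin k × Fin 3)) := by
  classical
  obtain ⟨x, f, hx, X0, X1, X2, Xq0, Xq1, hf⟩ := hc
  let ι : Fin 2 × Fin 3 → O ⊕ (Fin k × Fin 3) := fun p => Sum.inr (if p.1 = 0 then 0 else 1, p.2)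
  have ι0 : ∀ j, ι (0, j) = Sum.inr (0, j) := fun j => rfl
  have ι1 : ∀ j, ι (1, j) = Sum.inr (1, j) := fun j => rfl
  have nr : ∀ i j, i ≠ 0 → i ≠ 1 → (Sum.inr (i, j) : O ⊕ (Fin k × Fin 3)) ∉ Set.range ι := by
    rintro i j hi0 hi1 ⟨⟨a, b⟩, hab⟩
    simp only [ι, Sum.inr.injEq, Prod.mk.injEq] at hab
    obtain ⟨hab, -⟩ := hab
    split_ifs at hab
    · exact hi0 hab.symm
    · exact hi1 hab.symm
  have nl : ∀ d, (Sum.inl d : O ⊕ (Fin k × Fin 3)) ∉ Set.range ι := by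
    rintro d ⟨p, hp⟩; cases hp
  have hι : Function.Injective ι := by
    rintro ⟨a, b⟩ ⟨a', b'⟩ h
    simp only [ι, Sum.inr.injEq, Prod.mk.injEq] at h
    obtain ⟨h, rfl⟩ := h
    fin_cases a <;> fin_cases a' <;> simp_all
  have e00 : (G.glue (cycG k)).α (Sum.inr (0, 0)) = Sum.inl (G.q 0) := G.glue_α_inr (cycG k) (0, 0)
  have e02 : (G.glue (cycG k)).α (Sum.inr (0, 2)) = Sum.inr (0 - 1, 1) := G.glue_α_inr (cycG k) (0, 2)
  have e01 : (G.glue (cycG k)).α (Sum.inr (0, 1)) = Sum.inr (1, 2) := by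
    refine (G.glue_α_inr (cycG k) (0, 1)).trans ?_
    simp [cycG, emb]
  have e10 : (G.glue (cycG k)).α (Sum.inr (1, 0)) = Sum.inl (G.q 1) := G.glue_α_inr (cycG k) (1, 0)
  have e11 : (G.glue (cycG k)).α (Sum.inr (1, 1)) = Sum.inr (1 + 1, 2) := G.glue_α_inr (cycG k) (1, 1)
  have e12 : (G.glue (cycG k)).α (Sum.inr (1, 2)) = Sum.inr (0, 1) := by
    rw [← e01, CG.α_inv]
  obtain ⟨G', w, w1, w2⟩ := extract (G.glue (cycG k)) hK.fpf gadH ι hι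
    (by
      intro i; fin_cases i
      · exact ⟨_, rfl⟩
      · exact ⟨_, rfl⟩
      · exact ⟨_, rfl⟩
      · exact ⟨_, rfl⟩)
    (by rintro ⟨a, b⟩; left; rfl)
    (by
      rintro ⟨a, b⟩ y hy
      fin_cases a <;> fin_cases b
      · cases hy
      · cases hy; exact e01
      · cases hy
      · cases hy
      · cases hy
      · cases hy; exact e12)
    (by
      rintro ⟨a, b⟩ i hi
      fin_cases a <;> fin_cases b
      · exact e00 ▸ nl _
      · cases hi
      · exact e02 ▸ nr _ _ h1 h2
      · exact e10 ▸ nl _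
      · exact e11 ▸ nr _ _ h3 h4
      · cases hi)
  have s1 : ∀ p, w.e.symm (Sum.inr p) = ι p := fun p => by rw [← w1, Equiv.symm_apply_apply]
  have s2 : ∀ d : {d // d ∉ Set.range ι}, w.e.symm (Sum.inl d) = d.1 := fun d => by
    rw [← w2 d.1 d.2, Equiv.symm_apply_apply]
  have pq : ∀ (p : Fin 2 × Fin 3) i, gadH.θ (Sum.inr p) = Sum.inl i →
      (G'.q i).1 = (G.glue (cycG k)).α (ι p) := by
    intro p i hp
    rw [← s2, ← s1]
    have := w.symm.hα (Sum.inr p)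
    rw [glue_α_inr, hp] at this
    exact this
  have q0 : (G'.q 0).1 = Sum.inl (G.q 0) := (pq (0, 0) 0 rfl).trans e00
  have q1 : (G'.q 1).1 = Sum.inr (0 - 1, 1) := (pq (0, 2) 1 rfl).trans e02
  have q2 : (G'.q 2).1 = Sum.inl (G.q 1) := (pq (1, 0) 2 rfl).trans e10
  have q3 : (G'.q 3).1 = Sum.inr (1 + 1, 2) := (pq (1, 1) 3 rfl).trans e11
  let x' : {d // d ∉ Set.range ι} → Bool := fun d => x d.1
  have hx' : ∀ d, x' (G'.r d) = x' d := by
    intro d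
    have := w.inv_symm x hx (Sum.inl d)
    rw [glue_r_inl, s2, s2] at this
    exact this
  have x0 : x' (G'.q 0) = true := by simp only [x', q0, Xq0]
  have x1 : x' (G'.q 1) = false := by simp only [x', q1, X2 _ _ h1 h2]
  have x2 : x' (G'.q 2) = true := by simp only [x', q2, Xq1]
  have x3 : x' (G'.q 3) = false := by simp only [x', q3, X2 _ _ h3 h4]
  have hαO : ∀ d, (∀ i, d ≠ G'.q i) → (G'.α d).1 = (G.glue (cycG k)).α d.1 := by
    intro d hd
    have := w.symm.hα (Sum.inl d)
    rw [glue_α_inl _ _ _ hd] at this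
    exact (s2 _).symm.trans (this.trans (congrArg _ (s2 _)))
  have hf1 : ∀ d, (∀ i, d ≠ G'.q i) → x' d ≠ x' (G'.α d) →
      d.1 = f ∨ d.1 = (G.glue (cycG k)).α f := by
    intro d hd hne
    simp only [x', hαO d hd] at hne
    rcases hf d.1 hne with h | h | h | h | h | h
    · exact absurd ⟨(1, 1), h.symm⟩ d.2
    · exact absurd (Subtype.ext (h.trans (by rw [q3, h11]))) (hd 3)
    · exact absurd ⟨(0, 2), h.symm⟩ d.2
    · exact absurd (Subtype.ext (h.trans q1.symm)) (hd 1)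
    · exact Or.inl h
    · exact Or.inr h
  obtain ⟨f', hf'⟩ : ∃ f', ∀ d, (∀ i, d ≠ G'.q i) → x' d ≠ x' (G'.α d) → d = f' ∨ d = G'.α f' := by
    by_cases hex : ∃ d, (∀ i, d ≠ G'.q i) ∧ x' d ≠ x' (G'.α d)
    · obtain ⟨d1, hd1, hne1⟩ := hex
      refine ⟨d1, fun d hd hne => ?_⟩
      have : d.1 = d1.1 ∨ d.1 = (G.glue (cycG k)).α d1.1 := by
        rcases hf1 d hd hne with h | h <;> rcases hf1 d1 hd1 hne1 with h' | h' <;> rw [h, h']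
        · exact Or.inl rfl
        · exact Or.inr ((G.glue (cycG k)).α_inv f).symm
        · exact Or.inr rfl
        · exact Or.inl rfl
      rcases this with h | h
      · exact Or.inl (Subtype.ext h)
      · exact Or.inr (Subtype.ext (h.trans (hαO d1 hd1).symm))
    · exact ⟨G'.q 0, fun d hd hne => absurd ⟨d, hd, hne⟩ hex⟩
  have hH : (G'.glue gadH).Good := w.symm.good hK
  let g := G.mkCyc (fun _ => 0) (fun _ => 1)
  have hg : g ∈ (G.glue (cycG k)).cyc := G.mkCyc_mem _ _ (fun _ _ => rfl) (fun _ => by simp)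
    (fun _ => (zz 1).symm)
  have hU := G'.goodU hH x' hx' x0 x1 x2 x3 f' hf' _ (w.cyc_symm hg) (by
    show g (w.e.symm _) = 1
    rw [s1]; rfl) (by
    intro d hd
    show g (w.e.symm _) = 0
    rw [s2]
    obtain ⟨y, hy⟩ := d
    rcases y with y | ⟨i, j⟩
    · rfl
    · exfalso
      by_cases hi0 : i = 0
      · exact hy ⟨(0, j), by rw [ι0, hi0]⟩
      · by_cases hi1 : i = 1
        · exact hy ⟨(1, j), by rw [ι1, hi1]⟩
        · exact absurd (hd.symm.trans (X2 i j hi0 hi1)) (by decide))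
  have hnu := G'.nuH x' hx' x0 x1 x2 x3 f' hf'
  refine ⟨_, G'.glue gadM, inferInstance, hU, ?_, ?_⟩
  · rw [← nu_eq_of_wiso w]; exact hnu
  · rw [Nat.card_congr w.e, Nat.card_sum, Nat.card_sum]
    simp

end OG
end CiDC

namespace CiDC

/-- The bound as a function of the number of darts. -/
noncomputable def bnd (n : ℕ) : ℝ := (5 / 2 : ℝ) ^ ((n : ℝ) / 12 - 1 / 2)

theorem bnd_pos (n : ℕ) : 0 < bnd n := Real.rpow_pos_of_pos (by norm_num) _

theorem bnd_le_one {n : ℕ} (h : n ≤ 6) : bnd n ≤ 1 := by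
  apply Real.rpow_le_one_of_one_le_of_nonpos (by norm_num)
  have : (n : ℝ) ≤ 6 := by exact_mod_cast h
  linarith

theorem bnd12 (n : ℕ) : bnd (n + 12) = 5 / 2 * bnd n := by
  unfold bnd
  rw [mul_comm, ← Real.rpow_add_one (by norm_num)]
  congr 1; push_cast; ring

theorem bnd6 (n : ℕ) : bnd (n + 6) ≤ 2 * bnd n := by
  have e : bnd (n + 6) = (5 / 2 : ℝ) ^ (1 / 2 : ℝ) * bnd n := by
    unfold bnd
    rw [← Real.rpow_add (by norm_num)]
    congr 1; push_cast; ring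
  rw [e]
  apply mul_le_mul_of_nonneg_right _ (bnd_pos n).le
  rw [← Real.sqrt_eq_rpow, Real.sqrt_le_left (by norm_num)]
  norm_num

theorem fin_fact1 : (0 - 1 : Fin 4) ≠ 0 := by decide
theorem fin_fact2 : (0 - 1 : Fin 5) ≠ 0 := by decide
theorem fin_fact3 : (0 - 1 : Fin 4) ≠ 1 := by decide
theorem fin_fact4 : (0 - 1 : Fin 5) ≠ 1 := by decide
theorem fin_fact5 : (1 + 1 : Fin 4) ≠ 0 := by decide
theorem fin_fact6 : (1 + 1 : Fin 5) ≠ 0 := by decide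
theorem fin_fact7 : (1 + 1 : Fin 4) ≠ 1 := by decide
theorem fin_fact8 : (1 + 1 : Fin 5) ≠ 1 := by decide
theorem fin_fact9 : (1 : Fin 4) ≠ 0 := by decide
theorem fin_fact10 : (1 : Fin 5) ≠ 0 := by decide
theorem fin_fact11 : (1 + 1 : Fin 4) = 2 := by decide
theorem fin_fact12 : (1 + 1 : Fin 5) = 2 := by decide

universe u

def ShortCyc : Prop := ∀ (D : Type u) [Finite D] (G : CG D), G.Good → Nonempty D →
  (Nat.card D = 6 ∧ 1 ≤ G.nu) ∨ ∃ (k : ℕ) (_ : NeZero k) (O : Type u) (G' : OG O k), 2 ≤ k ∧ k ≤ 5 ∧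
    Nonempty (WIso G (G'.glue (cycG k)))

theorem bound (hS : ShortCyc.{u}) (n : ℕ) : ∀ (D : Type u) [Finite D] (G : CG D), Nonempty D → G.Good →
    Nat.card D = n → bnd n ≤ G.nu := by
  induction n using Nat.strong_induction_on with
  | _ n ih =>
  intro D _ G hne hG hn
  have step6 : ∀ (D' : Type u) [Finite D'] (G' : CG D'), Nonempty D' → G'.Good → 2 * G'.nu ≤ G.nu →
      Nat.card D' + 6 = n → bnd n ≤ G.nu := by
    intro D' _ G' hne' hG' h2 hn'
    have := ih (Nat.card D') (by omega) D' G' hne' hG' rfl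
    have h6 := bnd6 (Nat.card D')
    rw [hn'] at h6
    have h2' : (2 : ℝ) * G'.nu ≤ G.nu := by exact_mod_cast h2
    linarith
  rcases hS D G hG hne with ⟨h6, h1⟩ | ⟨k, hk0, O, G', hk2, hk5, ⟨w⟩⟩
  · have : (1 : ℝ) ≤ G.nu := by exact_mod_cast h1
    exact (bnd_le_one (by omega)).trans this
  have hfin : Finite (O ⊕ (Fin k × Fin 3)) := Finite.of_equiv _ w.e
  have hfO : Finite O := Finite.sum_left (Fin k × Fin 3)
  have hcard : Nat.card O + 3 * k = n := by
    rw [← hn, Nat.card_congr w.e, Nat.card_sum, Nat.card_prod]; simp [mul_comm]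
  have hnu := nu_eq_of_wiso w
  have hK : ∀ ρ, ((G'.rot ρ).glue (cycG k)).Good := fun ρ => (G'.rotIso ρ).good (w.symm.good hG)
  have hne' : ∀ I : Type, Nonempty (O ⊕ I) := fun I => ⟨Sum.inl (G'.q 0)⟩
  have hA : (∃ ρ, (G'.rot ρ).Conf) → 4 ≤ k → bnd n ≤ G.nu := by
    rintro ⟨ρ, hc⟩ hk4
    have hk : k = 4 ∨ k = 5 := by omega
    have h1 : (0 - 1 : Fin k) ≠ 0 := by
      rcases hk with rfl | rfl
      · exact fin_fact1
      · exact fin_fact2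
    have h2 : (0 - 1 : Fin k) ≠ 1 := by
      rcases hk with rfl | rfl
      · exact fin_fact3
      · exact fin_fact4
    have h3 : (1 + 1 : Fin k) ≠ 0 := by
      rcases hk with rfl | rfl
      · exact fin_fact5
      · exact fin_fact6
    have h4 : (1 + 1 : Fin k) ≠ 1 := by
      rcases hk with rfl | rfl
      · exact fin_fact7
      · exact fin_fact8
    have h5 : (1 : Fin k) ≠ 0 := by
      rcases hk with rfl | rfl
      · exact fin_fact9
      · exact fin_fact10
    have h6 : (1 + 1 : Fin k) = 2 := by
      rcases hk with rfl | rfl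
      · exact fin_fact11
      · exact fin_fact12
    obtain ⟨D', G₁, hf, hg, hle, hcc⟩ := (G'.rot ρ).lemmaA (hK ρ) hc h1 h2 h3 h4 h5 h6
    rw [← nu_eq_of_wiso (G'.rotIso ρ), hnu] at hle
    rw [Nat.card_congr w.e.symm, hn] at hcc
    refine step6 D' G₁ ?_ hg hle hcc
    have : 0 < Nat.card D' := by omega
    exact (Nat.card_pos_iff.1 this).1
  have hk : k = 2 ∨ k = 3 ∨ k = 4 ∨ k = 5 := by omega
  rcases hk with rfl | rfl | rfl | rfl
  · refine step6 _ ((G'.rot 0).glue gadJ) (hne' _) ((G'.rot 0).goodJ (hK 0)) ?_ ?_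
    · rw [← hnu]; exact G'.nuJ
    · rw [Nat.card_sum]; simpa using hcard
  · refine step6 _ ((G'.rot 0).glue gadW) (hne' _) ((G'.rot 0).goodW (hK 0)) ?_ ?_
    · rw [← hnu]; exact G'.nuW
    · rw [Nat.card_sum]; simp; omega
  · by_cases hc : ∃ ρ, (G'.rot ρ).Conf
    · exact hA hc (by omega)
    · have hM : ∀ ρ, bnd (Nat.card O) ≤ ((G'.rot ρ).glue gadM).nu := by
        intro ρ
        refine ih _ (by omega) _ _ (hne' _) (((G'.rot ρ).goodM (hK ρ)).resolve_right (fun h => hc ⟨ρ, h⟩)) ?_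
        rw [Nat.card_sum]; simp
      have h0 := hM 0
      have h1 := hM 1
      have h2 := G'.nuM
      rw [hnu] at h2
      have h2' : (2 : ℝ) * (((G'.rot 0).glue gadM).nu + ((G'.rot 1).glue gadM).nu) ≤ G.nu := by exact_mod_cast h2
      rw [← hcard]
      have := bnd12 (Nat.card O)
      have := bnd_pos (Nat.card O)
      show bnd (Nat.card O + 12) ≤ _
      linarith
  · by_cases hc : ∃ ρ, (G'.rot ρ).Conf
    · exact hA hc (by omega)
    · have hM : ∀ ρ, bnd (Nat.card O + 3) ≤ ((G'.rot ρ).glue gadN).nu := by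
        intro ρ
        refine ih _ (by omega) _ _ (hne' _) (((G'.rot ρ).goodN (hK ρ)).resolve_right (fun h => hc ⟨ρ, h⟩)) ?_
        rw [Nat.card_sum]; simp
      have h2 := G'.nuN
      rw [hnu] at h2
      have h2' : ∑ ρ : Fin 5, (((G'.rot ρ).glue gadN).nu : ℝ) ≤ 2 * G.nu := by exact_mod_cast h2
      have h3 : ∑ _ρ : Fin 5, bnd (Nat.card O + 3) ≤ ∑ ρ : Fin 5, (((G'.rot ρ).glue gadN).nu : ℝ) :=
        Finset.sum_le_sum fun ρ _ => hM ρ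
      simp at h3
      rw [← hcard]
      have := bnd12 (Nat.card O + 3)
      show bnd (Nat.card O + 3 + 12) ≤ _
      linarith

end CiDC

namespace CiDC
namespace CG
open Module
variable {D : Type*}

/-- same vertex -/
def Vr (G : CG D) (d e : D) : Prop := e = d ∨ e = G.r d ∨ e = G.r (G.r d)

theorem Vr.refl (G : CG D) (d : D) : G.Vr d d := Or.inl rfl

theorem Vr.symm {G : CG D} {d e : D} (h : G.Vr d e) : G.Vr e d := by
  rcases h with rfl | rfl | rfl
  · exact Or.inl rfl
  · right; right; rw [G.r3]
  · right; left; rw [G.r3]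

theorem Vr.trans {G : CG D} {d e f : D} (h : G.Vr d e) (h' : G.Vr e f) : G.Vr d f := by
  rcases h with rfl | rfl | rfl <;> rcases h' with rfl | rfl | rfl <;> simp [Vr, G.r3]

def vset (G : CG D) : Setoid D := ⟨G.Vr, Vr.refl G, Vr.symm, Vr.trans⟩

/-- a transversal labelling -/
theorem exists_label (G : CG D) : ∃ s : D → Fin 3, ∀ d, s (G.r d) = s d + 1 := by
  classical
  let o : D → D := fun d => (Quotient.mk G.vset d).out
  have ho : ∀ d, d = o d ∨ d = G.r (o d) ∨ d = G.r (G.r (o d)) :=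
    fun d => Quotient.mk_out (s := G.vset) d
  have hor : ∀ d, o (G.r d) = o d := by
    intro d
    have : Quotient.mk G.vset (G.r d) = Quotient.mk G.vset d := 
      Quotient.sound (Vr.symm (show G.Vr d (G.r d) from Or.inr (Or.inl rfl)))
    simp only [o, this]
  refine ⟨fun d => if d = o d then 0 else if d = G.r (o d) then 1 else 2, fun d => ?_⟩
  have hd := ho d
  have a1 := G.r_ne (o d)
  have a2 := G.rr_ne (o d)
  have a3 := G.r_ne_rr (o d)
  simp only [hor]
  generalize o d = e at hd a1 a2 a3 ⊢
  rcases hd with rfl | rfl | rfl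
  · simp [a1]
  · simp [a2, a3.symm, a1]
  · simp [a2, a3.symm, G.r3]

def EE (G : CG D) : (D → ZMod 2) →ₗ[ZMod 2] (D → ZMod 2) where
  toFun g d := g (G.α d) + g d
  map_add' a b := by funext d; simp; ring
  map_smul' c a := by funext d; simp; ring

def BB (G : CG D) : (D → ZMod 2) →ₗ[ZMod 2] (D → ZMod 2) where
  toFun g d := g d + g (G.r d) + g (G.r (G.r d))
  map_add' a b := by funext d; simp; ring
  map_smul' c a := by funext d; simp; ring

/-- functions of vertices -/
def FF (G : CG D) : Submodule (ZMod 2) (D → ZMod 2) where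
  carrier := {h | ∀ d, h (G.r d) = h d}
  add_mem' := fun ha hb d => by simp [ha d, hb d]
  zero_mem' := by simp
  smul_mem' := fun c a ha d => by simp [ha d]

def SS (D : Type*) [Fintype D] : (D → ZMod 2) →ₗ[ZMod 2] ZMod 2 where
  toFun g := ∑ d, g d
  map_add' a b := by simp [Finset.sum_add_distrib]
  map_smul' c a := by simp [Finset.mul_sum]

theorem three_FF [Fintype D] (G : CG D) : 3 * finrank (ZMod 2) G.FF ≤ Fintype.card D := by
  obtain ⟨s, hs⟩ := G.exists_label
  let L : (Fin 3 → G.FF) →ₗ[ZMod 2] (D → ZMod 2) :=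
    { toFun := fun h d => (h (s d)).1 d
      map_add' := fun a b => by funext d; simp
      map_smul' := fun c a => by funext d; simp }
  have hL : Function.Injective L := by
    rw [← LinearMap.ker_eq_bot, LinearMap.ker_eq_bot']
    intro h hh
    funext i
    apply Subtype.ext
    funext d
    have hF : ∀ i d, (h i).1 (G.r d) = (h i).1 d := fun i d => (h i).2 d
    have h0 : ∀ d, (h (s d)).1 d = 0 := fun d => congrFun hh d
    have e1 := h0 (G.r d)
    have e2 := h0 (G.r (G.r d))
    rw [hF, hs] at e1
    rw [hF, hF, hs, hs] at e2
    have : i = s d ∨ i = s d + 1 ∨ i = s d + 1 + 1 := by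
      generalize s d = j; revert i j; decide
    rcases this with rfl | rfl | rfl
    · exact h0 d
    · exact e1
    · exact e2
  have := LinearMap.finrank_le_finrank_of_injective hL
  rw [Module.finrank_pi_fintype] at this
  simpa using this

theorem dim_cyc [Fintype D] (G : CG D) (fpf : ∀ d, G.α d ≠ d) [Nonempty D] :
    Fintype.card D + 6 ≤ 6 * finrank (ZMod 2) G.cyc := by
  classical
  -- α-invariant functions
  have hE : Fintype.card D ≤ 2 * finrank (ZMod 2) (LinearMap.ker G.EE) := by
    have h1 := LinearMap.finrank_range_add_finrank_ker G.EE
    have h2 : LinearMap.range G.EE ≤ LinearMap.ker G.EE := by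
      rintro _ ⟨g, rfl⟩
      rw [LinearMap.mem_ker]
      funext d
      show (g (G.α (G.α d)) + g (G.α d)) + (g (G.α d) + g d) = 0
      rw [G.α_inv]
      linear_combination OG.zz (g d) + OG.zz (g (G.α d))
    have h3 := Submodule.finrank_mono h2
    simp at h1
    omega
  have hR : finrank (ZMod 2) ↥(G.FF ⊓ LinearMap.ker (SS D)) + 1 ≤ finrank (ZMod 2) G.FF := by
    apply Nat.succ_le_of_lt
    apply Submodule.finrank_lt_finrank_of_lt
    refine lt_of_le_of_ne inf_le_left fun h => ?_
    obtain ⟨d0⟩ := ‹Nonempty D›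
    let h0 : D → ZMod 2 := fun d => if G.Vr d0 d then 1 else 0
    have m : h0 ∈ G.FF := by
      intro d
      have : G.Vr d0 (G.r d) ↔ G.Vr d0 d :=
        ⟨fun h => h.trans (Vr.symm (Or.inr (Or.inl rfl))), fun h => h.trans (Or.inr (Or.inl rfl))⟩
      simp only [h0, this]
    rw [← h] at m
    have m2 : ∑ d, h0 d = 0 := m.2
    simp only [h0, Finset.sum_boole] at m2
    have : (Finset.univ.filter (fun d => G.Vr d0 d)) = {d0, G.r d0, G.r (G.r d0)} := by
      ext d
      rw [Finset.mem_filter]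
      simp [Vr]
    rw [this, Finset.card_insert_of_notMem, Finset.card_insert_of_notMem, Finset.card_singleton] at m2
    · exact absurd m2 (by decide)
    · simpa using G.r_ne_rr d0
    · simp only [Finset.mem_insert, Finset.mem_singleton, not_or]
      exact ⟨(G.r_ne d0).symm, (G.rr_ne d0).symm⟩
  have h3 := G.three_FF
  let L := G.BB.domRestrict (LinearMap.ker G.EE)
  have hL := LinearMap.finrank_range_add_finrank_ker L
  have hr : LinearMap.range L ≤ G.FF ⊓ LinearMap.ker (SS D) := by
    rintro _ ⟨⟨g, hg⟩, rfl⟩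
    have hg' : ∀ d, g (G.α d) + g d = 0 := fun d => congrFun hg d
    refine ⟨fun d => ?_, ?_⟩
    · show g (G.r d) + g (G.r (G.r d)) + g (G.r (G.r (G.r d))) = g d + g (G.r d) + g (G.r (G.r d))
      rw [G.r3]; ring
    · show ∑ d, (g d + g (G.r d) + g (G.r (G.r d))) = 0
      have b : Function.Bijective G.r := Finite.injective_iff_bijective.1 (fun _ _ h => G.r_inj h)
      have e1 : ∑ d, g (G.r d) = ∑ d, g d := b.sum_comp g
      have e2 : ∑ d, g (G.r (G.r d)) = ∑ d, g d := (b.sum_comp (fun d => g (G.r d))).trans e1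
      have e0 : ∑ d, g d = 0 := by
        refine Finset.sum_involution (fun d _ => G.α d) ?_ ?_ ?_ ?_
        · intro d _; rw [add_comm]; exact hg' d
        · intro d _ _; exact fpf d
        · intro d _; exact Finset.mem_univ _
        · intro d _; exact G.α_inv d
      rw [Finset.sum_add_distrib, Finset.sum_add_distrib, e1, e2, e0]; simp
  have hr' := Submodule.finrank_mono hr
  have hk : finrank (ZMod 2) (LinearMap.ker L) ≤ finrank (ZMod 2) G.cyc := by
    let M : LinearMap.ker L →ₗ[ZMod 2] G.cyc :=
      ((LinearMap.ker G.EE).subtype.comp (LinearMap.ker L).subtype).codRestrict G.cyc (by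
        rintro ⟨⟨g, hg⟩, hgL⟩
        refine ⟨fun d => ?_, fun d => congrFun hgL d⟩
        have : g (G.α d) + g d = 0 := congrFun hg d
        show g (G.α d) = g d
        linear_combination this - OG.zz (g d))
    refine LinearMap.finrank_le_finrank_of_injective (f := M) ?_
    intro a b h
    apply Subtype.ext; apply Subtype.ext
    exact congrArg (fun z : G.cyc => z.1) h
  omega

theorem exists_short [Fintype D] [DecidableEq D] (G : CG D) (fpf : ∀ d, G.α d ≠ d) [Nonempty D] (hm : Mac G.cyc) :
    ∃ f ∈ G.cyc, f ≠ 0 ∧ (Finset.univ.filter (fun d => f d ≠ 0)).card < 12 := by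
  classical
  by_contra hno
  push Not at hno
  obtain ⟨l, hl, hc⟩ := hm
  set l' := l.filter (fun f => decide (f ≠ 0)) with hl'
  have h1 : finrank (ZMod 2) G.cyc ≤ l'.length := by
    rw [← hl]
    have : Submodule.span (ZMod 2) {f | f ∈ l} ≤ Submodule.span (ZMod 2) (l'.toFinset : Set (D → ZMod 2)) := by
      rw [Submodule.span_le]
      intro f hf
      by_cases h0 : f = 0
      · rw [h0]; exact Submodule.zero_mem _
      · apply Submodule.subset_span
        simp only [List.coe_toFinset, hl']
        simpa [h0] using hf
    exact (Submodule.finrank_mono this).trans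
      ((finrank_span_finset_le_card _).trans (List.toFinset_card_le _))
  have h2 : 12 * l'.length ≤ (l'.map (fun f => (Finset.univ.filter (fun d => f d ≠ 0)).card)).sum := by
    have : ∀ f ∈ l', 12 ≤ (Finset.univ.filter (fun d => f d ≠ 0)).card := by
      intro f hf
      rw [hl', List.mem_filter] at hf
      exact hno f (by rw [← hl]; exact Submodule.subset_span hf.1) (by simpa using hf.2)
    clear_value l'
    clear h1 hl'
    induction l' with
    | nil => simp
    | cons f t ih =>
      have a := this f (by simp)
      have b := ih (fun g hg => this g (by simp [hg]))
      simp only [List.length_cons, List.map_cons, List.sum_cons]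
      omega
  have h3 : ∀ m : List (D → ZMod 2), (m.map (fun f => (Finset.univ.filter (fun d => f d ≠ 0)).card)).sum =
      ∑ d, m.countP (fun f => decide (f d ≠ 0)) := by
    intro m
    induction m with
    | nil => simp
    | cons f t ih =>
      simp only [List.map_cons, List.sum_cons, List.countP_cons, Finset.sum_add_distrib, ih]
      rw [add_comm, Finset.card_filter]
      simp
  have h4 : ∑ d, l'.countP (fun f => decide (f d ≠ 0)) ≤ ∑ _d : D, 2 := by
    refine Finset.sum_le_sum fun d _ => le_trans ?_ (hc d)
    exact (List.filter_sublist (l := l)).countP_le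
  rw [h3] at h2
  simp only [Finset.sum_const, Finset.card_univ, smul_eq_mul] at h4
  have := G.dim_cyc fpf
  omega

end CG
end CiDC

namespace CiDC
namespace CG
variable {D : Type*}

/-- A circuit of length `k`, given by its outgoing darts. -/
def Lcyc (G : CG D) (k : ℕ) (δ : ℕ → D) : Prop :=
  0 < k ∧ (∀ i j, i < j → j < k → ¬ G.Vr (δ i) (δ j)) ∧
  (∀ i, i + 1 < k → G.Vr (δ (i + 1)) (G.α (δ i)) ∧ G.α (δ i) ≠ δ (i + 1)) ∧
  G.Vr (δ 0) (G.α (δ (k - 1))) ∧ G.α (δ (k - 1)) ≠ δ 0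

theorem exists_lcyc [Fintype D] [DecidableEq D] (G : CG D) (fpf : ∀ d, G.α d ≠ d) (f : D → ZMod 2)
    (hf : f ∈ G.cyc) (hf0 : f ≠ 0) (hc : (Finset.univ.filter (fun d => f d ≠ 0)).card < 12) :
    ∃ k ≤ 5, ∃ δ, G.Lcyc k δ := by
  rw [mem_cyc] at hf
  obtain ⟨hα, hv⟩ := hf
  let other : D → D := fun d => if f (G.r d) ≠ 0 then G.r d else G.r (G.r d)
  have o1 : ∀ d, f d ≠ 0 → f (other d) ≠ 0 := by
    intro d hd
    simp only [other]
    split_ifs with h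
    · exact h
    · have := hv d
      rw [not_not] at h
      rw [h] at this
      intro h2
      rw [h2] at this
      simp at this; exact hd this
  have o2 : ∀ d, other d ≠ d := by
    intro d
    simp only [other]
    split_ifs
    · exact G.r_ne d
    · exact G.rr_ne d
  have o3 : ∀ d, G.Vr d (other d) := by
    intro d
    simp only [other]
    split_ifs
    · exact Or.inr (Or.inl rfl)
    · exact Or.inr (Or.inr rfl)
  obtain ⟨d0, hd0⟩ := Function.ne_iff.1 hf0
  let δ : ℕ → D := fun n => (fun d => other (G.α d))^[n] d0
  have δs : ∀ n, δ (n + 1) = other (G.α (δ n)) := fun n => Function.iterate_succ_apply' _ _ _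
  have δf : ∀ n, f (δ n) ≠ 0 := by
    intro n
    induction n with
    | zero => exact hd0
    | succ n ih => rw [δs]; exact o1 _ (by rw [hα]; exact ih)
  have st1 : ∀ n, G.Vr (δ (n + 1)) (G.α (δ n)) := fun n => by rw [δs]; exact (o3 _).symm
  have st2 : ∀ n, G.α (δ n) ≠ δ (n + 1) := fun n => by rw [δs]; exact (o2 _).symm
  have hpig : ∃ g, 1 ≤ g ∧ g ≤ 5 ∧ ∃ i, G.Vr (δ i) (δ (i + g)) := by
    by_contra hno
    push Not at hno
    have hno' : ∀ i j, i < j → j < 6 → ¬ G.Vr (δ i) (δ j) := by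
      intro i j hij hj h
      exact hno (j - i) (by omega) (by omega) i (by rwa [Nat.add_sub_cancel' hij.le])
    let φ : Fin 6 × Bool → D := fun p => if p.2 then δ p.1 else other (δ p.1)
    have φv : ∀ p, G.Vr (δ p.1) (φ p) := by
      rintro ⟨i, b⟩; cases b
      · exact o3 _
      · exact Vr.refl _ _
    have φinj : Function.Injective φ := by
      rintro ⟨i, b⟩ ⟨j, c⟩ h
      have hij : i = j := by
        have hV : G.Vr (δ i) (δ j) := (φv (i, b)).trans (h ▸ (φv (j, c)).symm)
        rcases lt_trichotomy i j with hl | hl | hl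
        · exact absurd hV (hno' i j hl j.2)
        · exact hl
        · exact absurd hV.symm (hno' j i hl i.2)
      subst hij
      cases b <;> cases c
      · rfl
      · exact absurd h (o2 _)
      · exact absurd h.symm (o2 _)
      · rfl
    have := Finset.card_le_card_of_injOn (s := Finset.univ) (t := Finset.univ.filter (fun d => f d ≠ 0)) φ
      (by
        rintro ⟨i, b⟩ -
        simp only [Finset.coe_filter, Finset.mem_univ, true_and]
        cases b
        · exact o1 _ (δf _)
        · exact δf _) φinj.injOn
    simp at this
    simp at hc
    omega
  classical
  have hex : ∃ g, 1 ≤ g ∧ ∃ i, G.Vr (δ i) (δ (i + g)) := by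
    obtain ⟨g, h1, -, h2⟩ := hpig; exact ⟨g, h1, h2⟩
  have hle : Nat.find hex ≤ 5 := by
    obtain ⟨g, h1, h5, h2⟩ := hpig
    exact (Nat.find_min' hex ⟨h1, h2⟩).trans h5
  obtain ⟨hg1, i, hi⟩ := Nat.find_spec hex
  have hmin : ∀ g, 1 ≤ g → g < Nat.find hex → ∀ i, ¬ G.Vr (δ i) (δ (i + g)) := 
    fun g h1 h2 i h => Nat.find_min hex h2 ⟨h1, i, h⟩
  generalize Nat.find hex = g at *
  refine ⟨g, hle, fun a => δ (i + a), hg1, ?_, fun a _ => ⟨st1 _, st2 _⟩, ?_, ?_⟩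
  · intro a b hab hb h
    refine hmin (b - a) (by omega) (by omega) (i + a) ?_
    rwa [show i + a + (b - a) = i + b by omega]
  · have := st1 (i + (g - 1))
    rw [show i + (g - 1) + 1 = i + g by omega] at this
    exact hi.trans this
  · show G.α (δ (i + (g - 1))) ≠ δ i
    intro h
    have h' : δ (i + (g - 1)) = G.α (δ i) := by rw [← h, G.α_inv]
    by_cases g1 : g = 1
    · subst g1; exact fpf _ h
    by_cases g2 : g = 2
    · subst g2; exact st2 i h'.symm
    refine hmin (g - 2) (by omega) (by omega) (i + 1) ?_
    rw [show i + 1 + (g - 2) = i + (g - 1) by omega, h']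
    exact st1 i

theorem third (G : CG D) {a b : D} (h : G.Vr a b) (hne : b ≠ a) :
    ∃ c, G.Vr a c ∧ c ≠ a ∧ c ≠ b := by
  rcases h with rfl | rfl | rfl
  · exact absurd rfl hne
  · exact ⟨_, Or.inr (Or.inr rfl), G.rr_ne a, (G.r_ne_rr a).symm⟩
  · exact ⟨_, Or.inr (Or.inl rfl), G.r_ne a, G.r_ne_rr a⟩

theorem vr_rr (G : CG D) {a b c : D} (h : G.Vr a b) (h' : G.Vr a c) (h1 : b ≠ a) (h2 : c ≠ a)
    (h3 : b ≠ c) : (b = G.r a ∧ c = G.r (G.r a)) ∨ (b = G.r (G.r a) ∧ c = G.r a) := by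
  rcases h with h | h | h <;> rcases h' with h' | h' | h' <;> simp_all

/-- the incoming dart -/
def inn (G : CG D) (k : ℕ) (δ : ℕ → D) (i : ℕ) : D := if i = 0 then G.α (δ (k - 1)) else G.α (δ (i - 1))

theorem inn_prop (G : CG D) {k : ℕ} {δ : ℕ → D} (h : G.Lcyc k δ) {i : ℕ} (hi : i < k) :
    G.Vr (δ i) (G.inn k δ i) ∧ G.inn k δ i ≠ δ i := by
  obtain ⟨h0, h1, h2, h3⟩ := h
  unfold inn
  split_ifs with hz
  · rw [hz]; exact h3
  · have := h2 (i - 1) (by omega)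
    rwa [show i - 1 + 1 = i by omega] at this

theorem lcyc_min (G : CG D) (fpf : ∀ d, G.α d ≠ d) (hex : ∃ k ≤ 5, ∃ δ, G.Lcyc k δ) :
    ∃ k ≤ 5, ∃ (δ P : ℕ → D), G.Lcyc k δ ∧
      (∀ i, i < k → G.Vr (δ i) (P i) ∧ P i ≠ δ i ∧ P i ≠ G.inn k δ i) ∧
      (k = 1 ∨ k = 2 ∨ (∀ i j, i < j → j < k → G.α (P i) ≠ P j)) := by
  classical
  have hex2 : ∃ k, ∃ δ, G.Lcyc k δ := by obtain ⟨k, -, h⟩ := hex; exact ⟨k, h⟩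
  have hle : Nat.find hex2 ≤ 5 := by
    obtain ⟨k, h5, h⟩ := hex
    exact (Nat.find_min' hex2 h).trans h5
  obtain ⟨δ, hδ⟩ := Nat.find_spec hex2
  have hmin : ∀ m < Nat.find hex2, ∀ δ, ¬ G.Lcyc m δ := fun m hm δ h => Nat.find_min hex2 hm ⟨δ, h⟩
  generalize Nat.find hex2 = k at *
  have hP : ∀ i, ∃ p, i < k → G.Vr (δ i) p ∧ p ≠ δ i ∧ p ≠ G.inn k δ i := by
    intro i
    by_cases hi : i < k
    · obtain ⟨a, b⟩ := G.inn_prop hδ hi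
      obtain ⟨c, hc⟩ := G.third a b
      exact ⟨c, fun _ => hc⟩
    · exact ⟨δ i, fun h => absurd h hi⟩
  choose P hP using hP
  refine ⟨k, hle, δ, P, hδ, hP, ?_⟩
  by_cases k1 : k = 1
  · exact Or.inl k1
  by_cases k2 : k = 2
  · exact Or.inr (Or.inl k2)
  right; right
  intro i j hij hj hch
  have hin := fun i (hi : i < k) => G.inn_prop hδ hi
  obtain ⟨h0, h1, h2, h3, h4⟩ := hδ
  by_cases hs : j - i ≤ k - 2
  · refine hmin (j - i + 1) (by omega) (fun a => if a < j - i then δ (i + a) else P j) ⟨by omega, ?_, ?_, ?_⟩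
    · intro a b hab hb
      have hbj : b ≤ j - i := by omega
      simp only [if_pos (show a < j - i by omega)]
      split_ifs with hb2
      · exact h1 _ _ (by omega) (by omega)
      · intro hV
        exact h1 (i + a) j (by omega) hj (hV.trans (hP j hj).1.symm)
    · intro a ha
      simp only [if_pos (show a < j - i by omega)]
      split_ifs with hb2
      · exact h2 (i + a) (by omega)
      · have e : G.inn k δ j = G.α (δ (i + a)) := by
          unfold inn
          rw [if_neg (by omega), show j - 1 = i + a by omega]
        rw [← e]
        exact ⟨(hP j hj).1.symm.trans (hin j hj).1, (hP j hj).2.2.symm⟩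
    · have e1 : ¬ (j - i + 1 - 1 < j - i) := by omega
      simp only [if_pos (show 0 < j - i by omega), if_neg e1]
      rw [← hch, G.α_inv]
      exact ⟨(hP i (by omega)).1, (hP i (by omega)).2.1⟩
  · have hi0 : i = 0 := by omega
    have hjk : j = k - 1 := by omega
    subst hi0; subst hjk
    have e0 : G.inn k δ 0 = G.α (δ (k - 1)) := rfl
    refine hmin 2 (by omega) (fun a => if a = 0 then P 0 else δ (k - 1)) ⟨by omega, ?_, ?_, ?_⟩
    · intro a b hab hb hV
      have : a = 0 := by omega
      subst this
      have : b = 1 := by omega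
      subst this
      exact h1 0 (k - 1) hij hj ((hP 0 h0).1.trans hV)
    · intro a ha
      have : a = 0 := by omega
      subst this
      show G.Vr (δ (k - 1)) (G.α (P 0)) ∧ G.α (P 0) ≠ δ (k - 1)
      rw [hch]
      exact ⟨(hP _ hj).1, (hP _ hj).2.1⟩
    · show G.Vr (P 0) (G.α (δ (k - 1))) ∧ G.α (δ (k - 1)) ≠ P 0
      rw [← e0]
      exact ⟨(hP 0 h0).1.symm.trans (hin 0 h0).1, (hP 0 h0).2.2.symm⟩

theorem no_loop (G : CG D) (hG : G.Good) (δ : ℕ → D) : ¬ G.Lcyc 1 δ := by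
  classical
  rintro ⟨-, -, -, h1, h2⟩
  have h1 : G.Vr (δ 0) (G.α (δ 0)) := h1
  have h2 : G.α (δ 0) ≠ δ 0 := h2
  obtain ⟨p, hp1, hp2, hp3⟩ := G.third h1 h2
  have all : ∀ d, G.Vr (δ 0) d → d = δ 0 ∨ d = G.α (δ 0) ∨ d = p := by
    intro d hd
    rcases G.vr_rr h1 hp1 h2 hp2 hp3.symm with ⟨a, b⟩ | ⟨a, b⟩ <;> rw [a, b] <;>
      rcases hd with h | h | h <;> simp [h]
  let x : D → Bool := fun d => decide (G.Vr (δ 0) d)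
  have hx : ∀ d, x (G.r d) = x d := by
    intro d
    simp only [x, decide_eq_decide]
    exact ⟨fun h => h.trans (Vr.symm (Or.inr (Or.inl rfl))), fun h => h.trans (Or.inr (Or.inl rfl))⟩
  have key : ∀ d, x d = true → x (G.α d) = false → d = p := by
    intro d h3 h4
    rcases all d (by simpa [x] using h3) with rfl | rfl | rfl
    · exfalso; simp only [x, decide_eq_false_iff_not] at h4; exact h4 h1
    · exfalso; simp only [x, decide_eq_false_iff_not, G.α_inv] at h4; exact h4 (Vr.refl _ _)
    · rfl
  have hcut := hG.cut x hx p (by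
    intro d hne
    cases hd : x d
    · right
      have h3 : x (G.α d) = true := by rw [hd] at hne; simpa using hne.symm
      rw [← key (G.α d) h3 (by rw [G.α_inv, hd]), G.α_inv]
    · left
      exact key d hd (by rw [hd] at hne; simpa using hne.symm)) p (G.α p)
  have xp : x p = true := by simpa [x] using hp1
  rw [xp] at hcut
  rcases all (G.α p) (by simpa [x] using hcut.symm) with h | h | h
  · exact hp3 (by rw [← h, G.α_inv])
  · exact hp2 (by rw [← G.α_inv p, h, G.α_inv])
  · exact hG.fpf _ h

end CG
end CiDC

namespace CiDC
namespace CG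

theorem vr_all {D : Type*} (G : CG D) {a b c : D} (h : G.Vr a b) (h' : G.Vr a c) (h1 : b ≠ a) (h2 : c ≠ a)
    (h3 : b ≠ c) {d : D} (hd : G.Vr a d) : d = a ∨ d = b ∨ d = c := by
  rcases G.vr_rr h h' h1 h2 h3 with ⟨a, b⟩ | ⟨a, b⟩ <;> rw [a, b] <;>
      rcases hd with h | h | h <;> simp [h]

theorem theta {D : Type*} [Finite D] (G : CG D) (hG : G.Good) (a b p : D) (hab : ¬ G.Vr a b)
    (h1 : G.Vr a (G.α b)) (h1' : G.α b ≠ a) (h2 : G.Vr b (G.α a)) (h2' : G.α a ≠ b)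
    (hp : G.Vr a p) (hp1 : p ≠ a) (hp2 : p ≠ G.α b)
    (hq : G.Vr b (G.α p)) (hq1 : G.α p ≠ b) (hq2 : G.α p ≠ G.α a) : Nat.card D = 6 ∧ 1 ≤ G.nu := by
  classical
  have := Fintype.ofFinite D
  have A : ∀ d, G.Vr a d → d = a ∨ d = G.α b ∨ d = p := fun d hd => G.vr_all h1 hp h1' hp1 hp2.symm hd
  have B : ∀ d, G.Vr b d → d = b ∨ d = G.α a ∨ d = G.α p := 
    fun d hd => G.vr_all h2 hq h2' hq1 hq2.symm hd
  let x : D → Bool := fun d => decide (G.Vr a d ∨ G.Vr b d)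
  have hx : ∀ d, x (G.r d) = x d := by
    intro d
    have : ∀ e, G.Vr e (G.r d) ↔ G.Vr e d := fun e =>
      ⟨fun h => h.trans (Vr.symm (Or.inr (Or.inl rfl))), fun h => h.trans (Or.inr (Or.inl rfl))⟩
    simp only [x, this]
  have hxα : ∀ d, x d = true → x (G.α d) = true := by
    intro d hd
    simp only [x, decide_eq_true_eq] at hd ⊢
    rcases hd with hd | hd
    · right
      rcases A d hd with rfl | rfl | rfl
      · exact h2
      · rw [G.α_inv]; exact Vr.refl _ _
      · exact hq
    · left
      rcases B d hd with rfl | rfl | rfl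
      · exact h1
      · rw [G.α_inv]; exact Vr.refl _ _
      · rw [G.α_inv]; exact hp
  have hall : ∀ d, G.Vr a d ∨ G.Vr b d := by
    intro d
    have := hG.cut x hx a (by
      intro d hne
      exfalso
      have h1 := hxα d
      have h2 := hxα (G.α d)
      rw [G.α_inv] at h2
      revert h1 h2 hne
      cases x d <;> cases x (G.α d) <;> simp) a d
    have xa : x a = true := by simp only [x, decide_eq_true_eq]; exact Or.inl (Vr.refl _ _)
    rw [xa] at this
    simpa [x] using this.symm
  have nAB : ∀ d e, G.Vr a d → G.Vr b e → d ≠ e := by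
    rintro d _ h h' rfl
    exact hab (h.trans h'.symm)
  have va := Vr.refl G a
  have vb := Vr.refl G b
  constructor
  · have : (Finset.univ : Finset D) = {a, G.α b, p, b, G.α a, G.α p} := by
      ext d
      simp only [Finset.mem_univ, Finset.mem_insert, Finset.mem_singleton, true_iff]
      rcases hall d with h | h
      · rcases A d h with h | h | h <;> simp [h]
      · rcases B d h with h | h | h <;> simp [h]
    rw [Nat.card_eq_fintype_card, ← Finset.card_univ, this]
    rw [Finset.card_insert_of_notMem, Finset.card_insert_of_notMem, Finset.card_insert_of_notMem,
      Finset.card_insert_of_notMem, Finset.card_insert_of_notMem, Finset.card_singleton]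
    · simpa using hq2.symm
    · simp only [Finset.mem_insert, Finset.mem_singleton, not_or]
      exact ⟨h2'.symm, hq1.symm⟩
    · simp only [Finset.mem_insert, Finset.mem_singleton, not_or]
      exact ⟨nAB _ _ hp vb, nAB _ _ hp h2, nAB _ _ hp hq⟩
    · simp only [Finset.mem_insert, Finset.mem_singleton, not_or]
      exact ⟨hp2.symm, nAB _ _ h1 vb, nAB _ _ h1 h2, nAB _ _ h1 hq⟩
    · simp only [Finset.mem_insert, Finset.mem_singleton, not_or]
      exact ⟨h1'.symm, hp1.symm, nAB _ _ va vb, nAB _ _ va h2, nAB _ _ va hq⟩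
  · let c : D → ℕ := fun d => if d = a ∨ d = G.α a then 0 else if d = b ∨ d = G.α b then 1 else 2
    have inv : ∀ d e, G.α d = e ↔ d = G.α e := fun d e =>
      ⟨fun h => by rw [← h, G.α_inv], fun h => by rw [h, G.α_inv]⟩
    have cα : ∀ d, c (G.α d) = c d := by
      intro d
      simp only [c, inv, G.α_inv, or_comm]
    have c3 : ∀ d, c d < 3 := by
      intro d; simp only [c]; split_ifs <;> omega
    have ca : c a = 0 := by simp [c]
    have cb : c b = 1 := by
      have e1 := (nAB _ _ va vb).symm
      simp [c, e1, h2'.symm]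
    have cp : c p = 2 := by
      have e1 := nAB _ _ hp h2
      have e2 := nAB _ _ hp vb
      simp [c, hp1, e1, hp2, e2]
    have cαa := (cα a).trans ca
    have cαb := (cα b).trans cb
    have cαp := (cα p).trans cp
    have hne : ∀ d, c d ≠ c (G.r d) := by
      intro d
      have hd := G.r_ne d
      rcases hall d with h | h
      · have h' : G.Vr a (G.r d) := h.trans (Or.inr (Or.inl rfl))
        rcases A _ h with e | e | e <;> rcases A _ h' with e' | e' | e' <;>
          rw [e'] at hd ⊢ <;> rw [e] at hd ⊢ <;> simp_all
      · have h' : G.Vr b (G.r d) := h.trans (Or.inr (Or.inl rfl))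
        rcases B _ h with e | e | e <;> rcases B _ h' with e' | e' | e' <;>
          rw [e'] at hd ⊢ <;> rw [e] at hd ⊢ <;> simp_all
    have hcol : G.Col c := by
      refine ⟨hne, fun d => ?_⟩
      have a1 := hne d
      have a2 := hne (G.r d)
      have a3 := hne (G.r (G.r d))
      have b1 := hne (G.α d)
      have b2 := hne (G.r (G.α d))
      have b3 := hne (G.r (G.r (G.α d)))
      rw [G.r3] at a3 b3
      have e := cα d
      have := c3 d
      have := c3 (G.r d)
      have := c3 (G.r (G.r d))
      have := c3 (G.r (G.α d))
      have := c3 (G.r (G.r (G.α d)))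
      unfold EdgeOK
      omega
    have : G.T.Nonempty := ⟨_, c, hcol, rfl⟩
    exact (Set.ncard_pos (Set.toFinite _)).2 this

end CG

universe u

theorem shortCyc : ShortCyc.{u} := by
  classical
  intro D _ G hG hne
  have f1 : ∀ j : Fin 3, j + 1 ≠ j := by decide
  have f2 : ∀ j : Fin 3, j + 1 + 1 ≠ j := by decide
  have f3 : ∀ j : Fin 3, j + 1 ≠ j + 1 + 1 := by decide
  have := Fintype.ofFinite D
  obtain ⟨f, hf, hf0, hc⟩ := G.exists_short hG.fpf hG.mac
  obtain ⟨k, hk5, δ, P, hL, hP, hch⟩ := G.lcyc_min hG.fpf (G.exists_lcyc hG.fpf f hf hf0 hc)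
  have hk1 : k ≠ 1 := by
    rintro rfl; exact G.no_loop hG δ hL
  have hin := fun i (hi : i < k) => G.inn_prop hL hi
  by_cases hchord : ∃ i j, i < j ∧ j < k ∧ G.α (P i) = P j
  · left
    obtain ⟨i, j, hij, hj, hc⟩ := hchord
    have hk2 : k = 2 := by
      rcases hch with h | h | h
      · exact absurd h hk1
      · exact h
      · exact absurd hc (h i j hij hj)
    subst hk2
    have : i = 0 := by omega
    subst this
    have : j = 1 := by omega
    subst this
    obtain ⟨-, h1, h2, h3, h4⟩ := hL
    obtain ⟨s1, s2⟩ := h2 0 (by omega)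
    have p0 := hP 0 (by omega)
    have p1 := hP 1 (by omega)
    refine G.theta hG (δ 0) (δ 1) (P 0) (h1 0 1 (by omega) (by omega)) h3 h4 s1 s2 p0.1 p0.2.1 p0.2.2
      ?_ ?_ ?_ <;> rw [hc]
    · exact p1.1
    · exact p1.2.1
    · exact p1.2.2
  · right
    push Not at hchord
    obtain ⟨m, rfl⟩ : ∃ m, k = m + 1 := ⟨k - 1, by have := hL.1; omega⟩
    have hin2 : ∀ i : Fin (m + 1), G.inn (m + 1) δ i.val = G.α (δ (i - 1).val) := by
      intro i
      rw [Fin.coe_sub_one]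
      unfold CG.inn
      by_cases hi : i = 0
      · simp [hi]
      · have : i.val ≠ 0 := fun h => hi (Fin.ext h)
        simp [hi]
    have hdist : ∀ i j : Fin (m + 1), G.Vr (δ i.val) (δ j.val) → i = j := by
      intro i j h
      rcases lt_trichotomy i j with hl | hl | hl
      · exact absurd h (hL.2.1 _ _ hl j.2)
      · exact hl
      · exact absurd h.symm (hL.2.1 _ _ hl i.2)
    let ι : Fin (m + 1) × Fin 3 → D := fun p => match p with
      | (i, 0) => P i.val
      | (i, 1) => δ i.val
      | (i, 2) => G.α (δ (i - 1).val)
    have ιv : ∀ i j, G.Vr (δ i.val) (ι (i, j)) := by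
      intro i j
      fin_cases j
      · exact (hP i.val i.2).1
      · exact CG.Vr.refl _ _
      · show G.Vr _ (G.α (δ (i - 1).val))
        rw [← hin2]; exact (hin i.val i.2).1
    have e01 : ∀ i : Fin (m + 1), P i.val ≠ δ i.val := fun i => (hP i.val i.2).2.1
    have e02 : ∀ i : Fin (m + 1), P i.val ≠ G.α (δ (i - 1).val) := fun i => by
      rw [← hin2]; exact (hP i.val i.2).2.2
    have e21 : ∀ i : Fin (m + 1), G.α (δ (i - 1).val) ≠ δ i.val := fun i => by
      rw [← hin2]; exact (hin i.val i.2).2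
    have hι : Function.Injective ι := by
      rintro ⟨i, a⟩ ⟨j, b⟩ h
      have hij : i = j := hdist i j ((ιv i a).trans (h ▸ (ιv j b).symm))
      subst hij
      fin_cases a <;> fin_cases b
      · rfl
      · exact absurd h (e01 i)
      · exact absurd h (e02 i)
      · exact absurd h.symm (e01 i)
      · rfl
      · exact absurd h.symm (e21 i)
      · exact absurd h.symm (e02 i)
      · exact absurd h (e21 i)
      · rfl
    have hr3 : ∀ {a b c : D}, G.Vr a b → G.Vr a c → b ≠ a → c ≠ a → b ≠ c → G.r a = b ∨ G.r a = c := by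
      intro a b c h h' h1 h2 h3
      rcases G.vr_rr h h' h1 h2 h3 with ⟨x, y⟩ | ⟨x, y⟩
      · exact Or.inl x.symm
      · exact Or.inr y.symm
    obtain ⟨G', w, -, -⟩ := extract G hG.fpf (cycG (m + 1)) ι hι (fun i => ⟨_, rfl⟩)
      (by
        rintro ⟨i, j⟩
        have hh : ∀ a b, G.Vr (ι (i, a)) (ι (i, b)) := fun a b => (ιv i a).symm.trans (ιv i b)
        have hn : ∀ a b, a ≠ b → ι (i, a) ≠ ι (i, b) := fun a b hab h => hab (by
          have := hι h; simpa using this)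
        refine hr3 (hh _ _) (hh _ _) (hn _ _ (f1 j)) (hn _ _ (f2 j)) (hn _ _ (f3 j)))
      (by
        rintro ⟨i, j⟩ y hy
        fin_cases j
        · cases hy
        · cases hy
          show G.α (δ i.val) = G.α (δ (i + 1 - 1).val)
          rw [add_sub_cancel_right]
        · cases hy
          exact G.α_inv _)
      (by
        rintro ⟨i, j⟩ i' hy
        fin_cases j
        · rintro ⟨⟨a, b⟩, hb⟩
          have hb : ι (a, b) = G.α (P i.val) := hb
          have hb' : G.α (ι (a, b)) = P i.val := by rw [hb, G.α_inv]
          fin_cases b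
          · have hb : P a.val = G.α (P i.val) := hb
            have hb' : G.α (P a.val) = P i.val := hb'
            rcases lt_trichotomy a i with hl | hl | hl
            · exact hchord _ _ hl i.2 hb'
            · rw [hl] at hb; exact hG.fpf _ hb.symm
            · exact hchord _ _ hl a.2 hb.symm
          · have hb' : G.α (δ a.val) = P i.val := hb'
            have h1 : ι (a + 1, 2) = ι (i, 0) := by
              show G.α (δ (a + 1 - 1).val) = P i.val
              rw [add_sub_cancel_right, hb']
            have h2 := @hι (a + 1, 2) (i, 0) h1
            have h3 := congrArg Prod.snd h2
            exact absurd (show (2 : Fin 3) = 0 from h3) (by decide)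
          · have hb' : G.α (G.α (δ (a - 1).val)) = P i.val := hb'
            have h1 : ι (a - 1, 1) = ι (i, 0) := by
              show δ (a - 1).val = P i.val
              rw [← hb', G.α_inv]
            have h2 := @hι (a - 1, 1) (i, 0) h1
            have h3 := congrArg Prod.snd h2
            exact absurd (show (1 : Fin 3) = 0 from h3) (by decide)
        · cases hy
        · cases hy)
    exact ⟨m + 1, inferInstance, _, G', by have := hL.1; omega, hk5, ⟨w⟩⟩

end CiDC

namespace CiDC
open SimpleGraph
open Module

section initial
set_option linter.unusedSectionVars false
variable {V : Type*} [Fintype V] {G : SimpleGraph V}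

theorem span_singleton_le_one {X : Type*} [Finite X] (v : X → ZMod 2) :
    finrank (ZMod 2) (Submodule.span (ZMod 2) {v}) ≤ 1 := by
  refine (finrank_span_le_card ({v} : Set (X → ZMod 2))).trans ?_
  simp

theorem darts_at_ncard (hc : IsCubic G) (v : V) : {e : G.Dart | e.fst = v}.ncard = 3 := by
  rw [← hc v]
  refine Set.ncard_congr (fun e _ => e.snd) ?_ ?_ ?_
  · rintro e rfl; exact e.adj
  · rintro e f he hf h
    apply Dart.ext
    exact Prod.ext (he.trans hf.symm) h
  · intro w hw
    exact ⟨⟨(v, w), hw⟩, rfl, rfl⟩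

theorem pow_fst (rs : RotationSystem G) (n : ℕ) (d : G.Dart) : ((rs.σ ^ n) d).fst = d.fst := by
  induction n with
  | zero => rfl
  | succ n ih => rw [pow_succ', Equiv.Perm.mul_apply, rs.fst_eq, ih]

theorem sigma_facts (hc : IsCubic G) (rs : RotationSystem G) (d : G.Dart) :
    rs.σ d ≠ d ∧ rs.σ (rs.σ (rs.σ d)) = d ∧
      ∀ e : G.Dart, e.fst = d.fst → e = d ∨ e = rs.σ d ∨ e = rs.σ (rs.σ d) := by
  classical
  have h3 := darts_at_ncard hc d.fst
  have two : rs.σ (rs.σ d) ≠ d := by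
    intro h
    have hp : ∀ n : ℕ, (rs.σ ^ n) d = d ∨ (rs.σ ^ n) d = rs.σ d := by
      intro n
      induction n with
      | zero => left; rfl
      | succ n ih =>
        rw [pow_succ', Equiv.Perm.mul_apply]
        rcases ih with ih | ih <;> rw [ih]
        · right; rfl
        · left; exact h
    have hs : {e : G.Dart | e.fst = d.fst} ⊆ {d, rs.σ d} := by
      intro e he
      obtain ⟨n, rfl⟩ := rs.cyclic d e he.symm
      exact hp n
    have := Set.ncard_le_ncard hs
    have : ({d, rs.σ d} : Set G.Dart).ncard ≤ 2 := by
      refine (Set.ncard_insert_le _ _).trans ?_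
      rw [Set.ncard_singleton]
    omega
  have one : rs.σ d ≠ d := fun h => two (by rw [h, h])
  have hne : rs.σ d ≠ rs.σ (rs.σ d) := fun h => one (rs.σ.injective h).symm
  have hsub : ({d, rs.σ d, rs.σ (rs.σ d)} : Set G.Dart) ⊆ {e : G.Dart | e.fst = d.fst} := by
    rintro e (rfl | rfl | rfl)
    · rfl
    · exact rs.fst_eq _
    · exact (rs.fst_eq _).trans (rs.fst_eq _)
  have hcard : ({d, rs.σ d, rs.σ (rs.σ d)} : Set G.Dart).ncard = 3 := by
    rw [Set.ncard_eq_three]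
    exact ⟨_, _, _, one.symm, two.symm, hne, rfl⟩
  have heq := Set.eq_of_subset_of_ncard_le hsub (by omega)
  have hall : ∀ e : G.Dart, e.fst = d.fst → e = d ∨ e = rs.σ d ∨ e = rs.σ (rs.σ d) := by
    intro e he
    have : e ∈ {e : G.Dart | e.fst = d.fst} := he
    rw [← heq] at this
    exact this
  refine ⟨one, ?_, hall⟩
  rcases hall (rs.σ (rs.σ (rs.σ d))) (by rw [rs.fst_eq, rs.fst_eq, rs.fst_eq]) with h | h | h
  · exact h
  · exact absurd (rs.σ.injective h) two
  · exact absurd (rs.σ.injective (rs.σ.injective h)) one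

/-- The dart description of an embedded cubic graph. -/
def toCG (hc : IsCubic G) (rs : RotationSystem G) : CG G.Dart where
  α := Dart.symm
  r := rs.σ
  α_inv := Dart.symm_symm
  r3 := fun d => (sigma_facts hc rs d).2.1
  r_ne := fun d => (sigma_facts hc rs d).1

theorem card_darts (hc : IsCubic G) : Nat.card G.Dart = 3 * Fintype.card V := by
  classical
  rw [Nat.card_eq_fintype_card, dart_card_eq_sum_degrees]
  have : ∀ v, G.degree v = 3 := by
    intro v
    rw [← hc v, ← card_neighborSet_eq_degree, ← Nat.card_eq_fintype_card]; rfl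
  simp [this, mul_comm]

theorem toCG_cut (hc : IsCubic G) (rs : RotationSystem G) (hconn : G.Connected)
    (hb : ∀ e : Sym2 V, ¬ G.IsBridge e) (x : G.Dart → Bool) (hx : ∀ d, x (rs.σ d) = x d)
    (d0 : G.Dart) (h0 : ∀ d, x d ≠ x d.symm → d = d0 ∨ d = d0.symm) (d d' : G.Dart) : x d = x d' := by
  have hv : ∀ d d' : G.Dart, d.fst = d'.fst → x d = x d' := by
    intro d d' h
    rcases (sigma_facts hc rs d).2.2 d' h.symm with rfl | rfl | rfl
    · rfl
    · rw [hx]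
    · rw [hx, hx]
  have hr := hb s(d0.fst, d0.snd)
  rw [isBridge_iff, not_not] at hr
  -- x is preserved along walks avoiding the edge of d0
  have key : ∀ u v : V, (G.deleteEdges {s(d0.fst, d0.snd)}).Reachable u v →
      ∀ e e' : G.Dart, e.fst = u → e'.fst = v → x e = x e' := by
    intro u v ⟨w⟩
    induction w with
    | nil => intro e e' h h'; exact hv _ _ (h.trans h'.symm)
    | @cons a b c hab w ih =>
      intro e e' h h'
      rw [deleteEdges_adj] at hab
      let f : G.Dart := ⟨(a, b), hab.1⟩
      have e1 : x e = x f := hv _ _ h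
      have e2 : x f.symm = x e' := ih _ _ rfl h'
      have e3 : x f = x f.symm := by
        by_contra hne
        apply hab.2
        rcases h0 f hne with hf | hf
        · rw [← hf]; rfl
        · have : d0 = f.symm := by rw [hf, Dart.symm_symm]
          rw [this]; exact Sym2.eq_swap
      rw [e1, e3, e2]
  have hd0 : x d0 = x d0.symm := key _ _ hr _ _ rfl rfl
  have hall : ∀ f : G.Dart, x f = x f.symm := by
    intro f
    by_contra hne
    rcases h0 f hne with rfl | rfl
    · exact hne hd0
    · rw [Dart.symm_symm] at hne; exact hne hd0.symm
  obtain ⟨w⟩ := hconn.preconnected d.fst d'.fst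
  have : ∀ u v : V, G.Walk u v → ∀ e e' : G.Dart, e.fst = u → e'.fst = v → x e = x e' := by
    intro u v w
    induction w with
    | nil => intro e e' h h'; exact hv _ _ (h.trans h'.symm)
    | @cons a b c hab w ih =>
      intro e e' h h'
      let f : G.Dart := ⟨(a, b), hab⟩
      have e1 : x e = x f := hv _ _ h
      have e2 : x f.symm = x e' := ih _ _ rfl h'
      rw [e1, hall, e2]
  exact this _ _ w d d' rfl rfl

/-- upper bound for the cycle space of a connected graph -/
theorem dim_cyc_le (hc : IsCubic G) (rs : RotationSystem G) (hconn : G.Connected) :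
    finrank (ZMod 2) (toCG hc rs).cyc + Fintype.card V ≤ G.edgeSet.ncard + 1 := by
  classical
  let L : (G.edgeSet → ZMod 2) →ₗ[ZMod 2] (V → ZMod 2) :=
    { toFun := fun g v => ∑ d : G.Dart, if d.fst = v then g ⟨d.edge, d.edge_mem⟩ else 0
      map_add' := fun a b => by
        funext v
        simp only [Pi.add_apply]
        rw [← Finset.sum_add_distrib]
        refine Finset.sum_congr rfl fun d _ => ?_
        split_ifs <;> simp
      map_smul' := fun c a => by
        funext v
        simp [Finset.mul_sum] }
  have hL := LinearMap.finrank_range_add_finrank_ker L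
  obtain ⟨v0⟩ := hconn.nonempty
  let R := LinearMap.range L ⊔ Submodule.span (ZMod 2) {(Pi.single v0 1 : V → ZMod 2)}
  have hedge : ∀ d : G.Dart, (Pi.single d.fst 1 + Pi.single d.snd 1 : V → ZMod 2) ∈ LinearMap.range L := by
    intro d
    refine ⟨Pi.single ⟨d.edge, d.edge_mem⟩ 1, ?_⟩
    funext v
    show (∑ e : G.Dart, if e.fst = v then (Pi.single ⟨d.edge, d.edge_mem⟩ 1 : G.edgeSet → ZMod 2) ⟨e.edge, e.edge_mem⟩ else 0) = _
    have : ∀ e : G.Dart, (if e.fst = v then (Pi.single ⟨d.edge, d.edge_mem⟩ 1 : G.edgeSet → ZMod 2) ⟨e.edge, e.edge_mem⟩ else 0)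
        = (if e = d then (if e.fst = v then 1 else 0) else 0) + (if e = d.symm then (if e.fst = v then 1 else 0) else 0) := by
      intro e
      have h1 : (⟨e.edge, e.edge_mem⟩ : G.edgeSet) = ⟨d.edge, d.edge_mem⟩ ↔ e = d ∨ e = d.symm := by
        rw [Subtype.mk.injEq, dart_edge_eq_iff]
      have h2 := d.symm_ne
      rw [Pi.single_apply]
      simp only [h1]
      by_cases a : e = d
      · subst a
        simp [h2.symm]
      · simp [a]
        split_ifs <;> rfl
    rw [Finset.sum_congr rfl (fun e _ => this e), Finset.sum_add_distrib]
    simp [Pi.single_apply, eq_comm]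
  have hsingle : ∀ v, (Pi.single v 1 : V → ZMod 2) ∈ R := by
    intro v
    obtain ⟨w⟩ := hconn.preconnected v v0
    induction w with
    | nil => exact Submodule.mem_sup_right (Submodule.subset_span rfl)
    | @cons a b c hab w ih =>
      have h1 : (Pi.single a 1 + Pi.single b 1 : V → ZMod 2) ∈ R :=
        Submodule.mem_sup_left (hedge ⟨(a, b), hab⟩)
      have h2 := R.sub_mem h1 ih
      simpa using h2
  have htop : R = ⊤ := by
    rw [eq_top_iff]
    intro f _
    rw [pi_eq_sum_univ f]
    refine R.sum_mem fun i _ => R.smul_mem _ ?_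
    have : (fun j => if i = j then (1 : ZMod 2) else 0) = Pi.single i 1 := by
      funext j; simp [Pi.single_apply, eq_comm]
    rw [this]; exact hsingle i
  have hR : Fintype.card V ≤ finrank (ZMod 2) (LinearMap.range L) + 1 := by
    have h1 : finrank (ZMod 2) R = Fintype.card V := by rw [htop]; simp
    have h2 := Submodule.finrank_add_le_finrank_add_finrank (LinearMap.range L) (Submodule.span (ZMod 2) {(Pi.single v0 1 : V → ZMod 2)})
    have h3 := span_singleton_le_one (Pi.single v0 1 : V → ZMod 2)
    change finrank (ZMod 2) R ≤ _ at h2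
    omega
  have hex : ∀ e : G.edgeSet, ∃ d : G.Dart, d.edge = e.1 := by
    rintro ⟨e, he⟩
    induction e using Sym2.ind with
    | _ a b => exact ⟨⟨(a, b), he⟩, rfl⟩
  choose pk hpk using hex
  have hker : finrank (ZMod 2) (toCG hc rs).cyc ≤ finrank (ZMod 2) (LinearMap.ker L) := by
    have hpkval : ∀ g ∈ (toCG hc rs).cyc, ∀ d : G.Dart, g (pk ⟨d.edge, d.edge_mem⟩) = g d := by
      intro g hg d
      have := hpk ⟨d.edge, d.edge_mem⟩
      rw [dart_edge_eq_iff] at this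
      rcases this with h | h
      · rw [h]
      · rw [h]; exact hg.1 d
    let M0 : (toCG hc rs).cyc →ₗ[ZMod 2] (G.edgeSet → ZMod 2) :=
      { toFun := fun g e => g.1 (pk e)
        map_add' := fun a b => rfl
        map_smul' := fun a b => rfl }
    have hM0 : ∀ g, M0 g ∈ LinearMap.ker L := by
      rintro ⟨g, hg⟩
      rw [LinearMap.mem_ker]
      funext v
      show (∑ d : G.Dart, if d.fst = v then g (pk ⟨d.edge, d.edge_mem⟩) else 0) = 0
      simp only [hpkval g hg]
      rw [← Finset.sum_filter]
      have h3 := darts_at_ncard hc v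
      obtain ⟨d, hd⟩ : {e : G.Dart | e.fst = v}.Nonempty := by
        rw [← Set.ncard_pos]; omega
      have hd : d.fst = v := hd
      subst hd
      obtain ⟨f1, f2, f3⟩ := sigma_facts hc rs d
      have : Finset.univ.filter (fun e : G.Dart => e.fst = d.fst) = {d, rs.σ d, rs.σ (rs.σ d)} := by
        ext e
        simp only [Finset.mem_filter, Finset.mem_univ, true_and, Finset.mem_insert, Finset.mem_singleton]
        refine ⟨f3 e, ?_⟩
        rintro (rfl | rfl | rfl)
        · rfl
        · exact rs.fst_eq _
        · exact (rs.fst_eq _).trans (rs.fst_eq _)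
      rw [this, Finset.sum_insert, Finset.sum_insert, Finset.sum_singleton, ← add_assoc]
      · exact hg.2 d
      · rw [Finset.mem_singleton]; exact (toCG hc rs).r_ne_rr d
      · simp only [Finset.mem_insert, Finset.mem_singleton, not_or]
        exact ⟨f1.symm, ((toCG hc rs).rr_ne d).symm⟩
    refine LinearMap.finrank_le_finrank_of_injective (f := M0.codRestrict _ hM0) ?_
    intro a b h
    apply Subtype.ext
    funext d
    have := congrFun (congrArg Subtype.val h) ⟨d.edge, d.edge_mem⟩
    change a.1 (pk _) = b.1 (pk _) at this
    rw [hpkval _ a.2, hpkval _ b.2] at this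
    exact this
  have hm : finrank (ZMod 2) (G.edgeSet → ZMod 2) = G.edgeSet.ncard := by
    rw [finrank_fintype_fun_eq_card, ← Nat.card_eq_fintype_card]; rfl
  omega

theorem toCG_mac (hc : IsCubic G) (rs : RotationSystem G) (hconn : G.Connected)
    (hE : Fintype.card V + rs.numFaces = 2 + G.edgeSet.ncard) : Mac (toCG hc rs).cyc := by
  classical
  let Q := Quotient rs.faceSetoid
  let q : G.Dart → Q := Quotient.mk rs.faceSetoid
  have hq : ∀ d, q (rs.σ d) = q d.symm := by
    intro d
    apply Quotient.sound
    refine Equiv.Perm.SameCycle.symm (⟨1, ?_⟩ : rs.faceMap.SameCycle _ _)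
    show rs.σ (d.symm.symm) = rs.σ d
    rw [Dart.symm_symm]
  haveI : Finite Q := Quotient.finite _
  letI : Fintype Q := Fintype.ofFinite Q
  let L : (Q → ZMod 2) →ₗ[ZMod 2] (G.Dart → ZMod 2) :=
    { toFun := fun y d => y (q d) + y (q d.symm)
      map_add' := fun a b => by funext d; simp; ring
      map_smul' := fun c a => by funext d; simp; ring }
  have hL := LinearMap.finrank_range_add_finrank_ker L
  have hle : LinearMap.range L ≤ (toCG hc rs).cyc := by
    rintro _ ⟨y, rfl⟩
    refine ⟨fun d => ?_, fun d => ?_⟩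
    · show y (q d.symm) + y (q d.symm.symm) = y (q d) + y (q d.symm)
      rw [Dart.symm_symm, add_comm]
    · show (y (q d) + y (q d.symm)) + (y (q (rs.σ d)) + y (q (rs.σ d).symm))
        + (y (q (rs.σ (rs.σ d))) + y (q (rs.σ (rs.σ d)).symm)) = 0
      rw [← hq, ← hq, ← hq, (sigma_facts hc rs d).2.1]
      linear_combination OG.zz (y (q d)) + OG.zz (y (q (rs.σ d))) + OG.zz (y (q (rs.σ (rs.σ d))))
  have hker : finrank (ZMod 2) (LinearMap.ker L) ≤ 1 := by
    have : LinearMap.ker L ≤ Submodule.span (ZMod 2) {(fun _ => 1 : Q → ZMod 2)} := by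
      intro y hy
      have hy' : ∀ d, y (q d) = y (q d.symm) := by
        intro d
        have : y (q d) + y (q d.symm) = 0 := congrFun hy d
        linear_combination this - OG.zz (y (q d.symm))
      have hr : ∀ d, y (q (rs.σ d)) = y (q d) := fun d => by rw [hq, ← hy']
      have hv : ∀ d d' : G.Dart, d.fst = d'.fst → y (q d) = y (q d') := by
        intro d d' h
        rcases (sigma_facts hc rs d).2.2 d' h.symm with rfl | rfl | rfl
        · rfl
        · rw [hr]
        · rw [hr, hr]
      have hw : ∀ u v : V, G.Walk u v → ∀ e e' : G.Dart, e.fst = u → e'.fst = v → y (q e) = y (q e') := by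
        intro u v w
        induction w with
        | nil => intro e e' h h'; exact hv _ _ (h.trans h'.symm)
        | @cons a b c hab w ih =>
          intro e e' h h'
          let f : G.Dart := ⟨(a, b), hab⟩
          have e1 : y (q e) = y (q f) := hv _ _ h
          have e2 : y (q f.symm) = y (q e') := ih _ _ rfl h'
          rw [e1, hy', e2]
      have hconst : ∀ p p' : Q, y p = y p' := by
        intro p p'
        induction p using Quotient.inductionOn with
        | _ d =>
        induction p' using Quotient.inductionOn with
        | _ d' =>
        obtain ⟨w⟩ := hconn.preconnected d.fst d'.fst
        exact hw _ _ w d d' rfl rfl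
      rw [Submodule.mem_span_singleton]
      by_cases hne : Nonempty Q
      · obtain ⟨p⟩ := hne
        refine ⟨y p, ?_⟩
        funext p'
        simp [hconst p p']
      · refine ⟨0, ?_⟩
        funext p'
        exact absurd ⟨p'⟩ hne
    exact (Submodule.finrank_mono this).trans (span_singleton_le_one _)
  have hF : finrank (ZMod 2) (Q → ZMod 2) = rs.numFaces := by
    rw [finrank_fintype_fun_eq_card, ← Nat.card_eq_fintype_card]; rfl
  have hcyc := dim_cyc_le hc rs hconn
  have heq : LinearMap.range L = (toCG hc rs).cyc :=
    Submodule.eq_of_le_of_finrank_le hle (by omega)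
  refine ⟨(Finset.univ : Finset Q).toList.map (fun p => L (Pi.single p 1)), ?_, ?_⟩
  · rw [← heq]
    apply le_antisymm
    · rw [Submodule.span_le]
      intro f hf
      simp only [List.mem_map, Set.mem_ofPred_eq] at hf
      obtain ⟨p, -, rfl⟩ := hf
      exact ⟨_, rfl⟩
    · rintro _ ⟨y, rfl⟩
      rw [pi_eq_sum_univ y, map_sum]
      refine Submodule.sum_mem _ fun i _ => ?_
      rw [map_smul]
      refine Submodule.smul_mem _ _ (Submodule.subset_span ?_)
      have : (fun j => if i = j then (1 : ZMod 2) else 0) = Pi.single i 1 := by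
        funext j; simp [Pi.single_apply, eq_comm]
      rw [this]
      simp only [List.mem_map, Set.mem_ofPred_eq]
      exact ⟨i, by simp, rfl⟩
  · intro d
    rw [List.countP_map, List.countP_eq_length_filter]
    have hnd : ((Finset.univ : Finset Q).toList.filter ((fun f : G.Dart → ZMod 2 => decide (f d ≠ 0)) ∘ fun p => L (Pi.single p 1))).Nodup :=
      (Finset.nodup_toList _).filter _
    rw [← List.toFinset_card_of_nodup hnd]
    refine (Finset.card_le_card (t := {q d, q d.symm}) ?_).trans Finset.card_le_two
    intro p hp
    simp only [List.mem_toFinset, List.mem_filter, Function.comp, decide_eq_true_eq] at hp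
    by_contra hno
    simp only [Finset.mem_insert, Finset.mem_singleton, not_or] at hno
    apply hp.2
    show (Pi.single p 1 : Q → ZMod 2) (q d) + (Pi.single p 1 : Q → ZMod 2) (q d.symm) = 0
    rw [Pi.single_apply, Pi.single_apply, if_neg (fun h => hno.1 h.symm), if_neg (fun h => hno.2 h.symm), add_zero]

theorem toCG_good (hc : IsCubic G) (rs : RotationSystem G) (hconn : G.Connected)
    (hb : ∀ e : Sym2 V, ¬ G.IsBridge e)
    (hE : Fintype.card V + rs.numFaces = 2 + G.edgeSet.ncard) : (toCG hc rs).Good where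
  fpf := fun d => d.symm_ne
  cut := fun x hx d0 h0 d d' => toCG_cut hc rs hconn hb x hx d0 h0 d d'
  mac := toCG_mac hc rs hconn hE

end initial
end CiDC

namespace CiDC
open SimpleGraph

section strands
set_option linter.unusedSectionVars false
variable {V : Type*} [Fintype V] {G : SimpleGraph V} (hc : IsCubic G) (rs : RotationSystem G)

/-- continuation of a strand across an edge -/
def SJ (c : G.Dart → ℕ) (d d' : G.Dart) : Prop :=
  ∃ b : G.Dart, (d = rs.σ b ∨ d = rs.σ (rs.σ b)) ∧
    (d' = rs.σ b.symm ∨ d' = rs.σ (rs.σ b.symm)) ∧ c d = c d'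

/-- the strands of a colouring -/
def SQ (c : G.Dart → ℕ) : Type _ := Quotient (Relation.EqvGen.setoid (SJ rs c))

/-- the strand of a corner -/
def smk (c : G.Dart → ℕ) (d : G.Dart) : SQ rs c := Quotient.mk (Relation.EqvGen.setoid (SJ rs c)) d

theorem smk_col {c : G.Dart → ℕ} {d d' : G.Dart} (h : smk rs c d = smk rs c d') : c d = c d' := by
  have hh : Relation.EqvGen (SJ rs c) d d' := Quotient.exact h
  clear h
  induction hh with
  | rel _ _ h => obtain ⟨_, _, _, h⟩ := h; exact h
  | refl => rfl
  | symm _ _ _ ih => exact ih.symm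
  | trans _ _ _ _ _ ih1 ih2 => exact ih1.trans ih2

theorem smk_J {c : G.Dart → ℕ} {d d' : G.Dart} (h : SJ rs c d d') : smk rs c d = smk rs c d' :=
  Quotient.sound (Relation.EqvGen.rel _ _ h)

theorem smk_cross {c : G.Dart → ℕ} (hcol : (toCG hc rs).Col c) (b : G.Dart) :
    (smk rs c (rs.σ b) = smk rs c (rs.σ b.symm) ∧
      smk rs c (rs.σ (rs.σ b)) = smk rs c (rs.σ (rs.σ b.symm))) ∨
    (smk rs c (rs.σ b) = smk rs c (rs.σ (rs.σ b.symm)) ∧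
      smk rs c (rs.σ (rs.σ b)) = smk rs c (rs.σ b.symm)) := by
  rcases hcol.2 b with ⟨h1, h2⟩ | ⟨h1, h2⟩
  · exact Or.inl ⟨smk_J rs ⟨b, Or.inl rfl, Or.inl rfl, h1⟩, smk_J rs ⟨b, Or.inr rfl, Or.inr rfl, h2⟩⟩
  · exact Or.inr ⟨smk_J rs ⟨b, Or.inl rfl, Or.inr rfl, h1⟩, smk_J rs ⟨b, Or.inr rfl, Or.inl rfl, h2⟩⟩

theorem smk_ne1 {c : G.Dart → ℕ} (hcol : (toCG hc rs).Col c) (b : G.Dart) :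
    smk rs c b ≠ smk rs c (rs.σ b) := fun h => hcol.1 b (smk_col rs h)

theorem smk_ne2 {c : G.Dart → ℕ} (hcol : (toCG hc rs).Col c) (b : G.Dart) :
    smk rs c b ≠ smk rs c (rs.σ (rs.σ b)) := fun h => by
  have := hcol.1 (rs.σ (rs.σ b))
  have e : (toCG hc rs).r (rs.σ (rs.σ b)) = b := (sigma_facts hc rs b).2.1
  rw [e] at this
  exact this (smk_col rs h).symm

/-- the subgraph traced by a strand -/
def strandSub {c : G.Dart → ℕ} (hcol : (toCG hc rs).Col c) (p : SQ rs c) : G.Subgraph where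
  verts := {v | ∃ d : G.Dart, smk rs c d = p ∧ d.fst = v}
  Adj u v := ∃ b : G.Dart, b.fst = u ∧ b.snd = v ∧
    (smk rs c (rs.σ b) = p ∨ smk rs c (rs.σ (rs.σ b)) = p)
  adj_sub := by
    rintro u v ⟨b, rfl, rfl, -⟩
    exact b.adj
  edge_vert := by
    rintro u v ⟨b, rfl, rfl, h | h⟩
    · exact ⟨_, h, rs.fst_eq _⟩
    · exact ⟨_, h, (rs.fst_eq _).trans (rs.fst_eq _)⟩
  symm := by
    constructor
    rintro u v ⟨b, rfl, rfl, h⟩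
    refine ⟨b.symm, rfl, rfl, ?_⟩
    rcases smk_cross hc rs hcol b with ⟨h1, h2⟩ | ⟨h1, h2⟩ <;> rw [h1, h2] at h
    · exact h
    · exact h.symm

theorem strand_adj {c : G.Dart → ℕ} (hcol : (toCG hc rs).Col c) (p : SQ rs c) (b : G.Dart) :
    (strandSub hc rs hcol p).Adj b.fst b.snd ↔
      (smk rs c (rs.σ b) = p ∨ smk rs c (rs.σ (rs.σ b)) = p) := by
  constructor
  · rintro ⟨b', h1, h2, h⟩
    have : b' = b := Dart.ext _ _ (Prod.ext h1 h2)
    rwa [this] at h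
  · intro h
    exact ⟨b, rfl, rfl, h⟩

theorem strand_circuit {c : G.Dart → ℕ} (hcol : (toCG hc rs).Col c) (p : SQ rs c) :
    IsCircuit (strandSub hc rs hcol p) := by
  constructor
  · have key : ∀ d d' : G.Dart, Relation.EqvGen (SJ rs c) d d' →
        ∀ (h : smk rs c d = p) (h' : smk rs c d' = p),
        (strandSub hc rs hcol p).coe.Reachable ⟨d.fst, ⟨d, h, rfl⟩⟩ ⟨d'.fst, ⟨d', h', rfl⟩⟩ := by
      intro d d' hdd
      induction hdd with
      | rel d d' hJ =>
        intro h h'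
        apply Adj.reachable
        obtain ⟨b, h1, h2, h3⟩ := hJ
        show (strandSub hc rs hcol p).Adj d.fst d'.fst
        have e1 : d.fst = b.fst := by
          rcases h1 with rfl | rfl
          · exact rs.fst_eq _
          · exact (rs.fst_eq _).trans (rs.fst_eq _)
        have e2 : d'.fst = b.snd := by
          rcases h2 with rfl | rfl
          · exact rs.fst_eq _
          · exact (rs.fst_eq _).trans (rs.fst_eq _)
        rw [e1, e2, strand_adj]
        rcases h1 with rfl | rfl
        · exact Or.inl h
        · exact Or.inr h
      | refl d => intro h h'; exact Reachable.refl _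
      | symm d d' _ ih => intro h h'; exact (ih h' h).symm
      | trans d e f h1 h2 ih1 ih2 =>
        intro h h'
        have he : smk rs c e = p := (Quotient.sound h1 : smk rs c d = smk rs c e).symm.trans h
        exact (ih1 h he).trans (ih2 he h')
    have hne : (strandSub hc rs hcol p).verts.Nonempty := by
      obtain ⟨d, hd⟩ := Quotient.exists_rep p
      exact ⟨d.fst, d, hd, rfl⟩
    rw [Subgraph.connected_iff]
    refine ⟨⟨?_⟩, hne⟩
    rintro ⟨_, d, hd, rfl⟩ ⟨_, d', hd', rfl⟩
    exact key d d' (Quotient.exact (hd.trans hd'.symm)) hd hd'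
  · rintro _ ⟨d, hd, rfl⟩
    obtain ⟨f1, f2, f3⟩ := sigma_facts hc rs d
    have : (strandSub hc rs hcol p).neighborSet d.fst = {(rs.σ d).snd, (rs.σ (rs.σ d)).snd} := by
      ext w
      rw [Subgraph.mem_neighborSet]
      constructor
      · rintro ⟨b, h1, rfl, h⟩
        rcases f3 b h1 with rfl | rfl | rfl
        · exfalso
          rcases h with h | h
          · exact smk_ne1 hc rs hcol _ (hd.trans h.symm)
          · exact smk_ne2 hc rs hcol _ (hd.trans h.symm)
        · left; rfl
        · right; rfl
      · rintro (rfl | rfl)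
        · exact ⟨_, rs.fst_eq _, rfl, Or.inr (by rw [f2]; exact hd)⟩
        · exact ⟨_, (rs.fst_eq _).trans (rs.fst_eq _), rfl, Or.inl (by rw [f2]; exact hd)⟩
    rw [this, Set.ncard_pair]
    intro h
    have : rs.σ d = rs.σ (rs.σ d) := Dart.ext _ _ (Prod.ext (rs.fst_eq _).symm h)
    exact (toCG hc rs).r_ne_rr d this

instance (c : G.Dart → ℕ) : Finite (SQ rs c) := by
  classical
  exact Quotient.finite _

/-- the multiset of strands -/
noncomputable def strands {c : G.Dart → ℕ} (hcol : (toCG hc rs).Col c) : Multiset G.Subgraph :=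
  letI := Fintype.ofFinite (SQ rs c)
  (Finset.univ : Finset (SQ rs c)).val.map (strandSub hc rs hcol)

theorem mem_strands {c : G.Dart → ℕ} (hcol : (toCG hc rs).Col c) (H : G.Subgraph) :
    H ∈ strands hc rs hcol ↔ ∃ p, strandSub hc rs hcol p = H := by
  simp [strands]

theorem strands_cover {c : G.Dart → ℕ} (hcol : (toCG hc rs).Col c) : IsCiDC G (strands hc rs hcol) := by
  classical
  constructor
  · intro H hH
    obtain ⟨p, rfl⟩ := (mem_strands hc rs hcol H).1 hH
    exact strand_circuit hc rs hcol p
  · intro e he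
    induction e using Sym2.ind with
    | _ a b =>
    let d : G.Dart := ⟨(a, b), he⟩
    letI := Fintype.ofFinite (SQ rs c)
    rw [strands, Multiset.countP_map]
    have : (Finset.univ : Finset (SQ rs c)).filter (fun p => s(a, b) ∈ (strandSub hc rs hcol p).edgeSet)
        = {smk rs c (rs.σ d), smk rs c (rs.σ (rs.σ d))} := by
      ext p
      rw [Finset.mem_filter, Subgraph.mem_edgeSet, Finset.mem_insert, Finset.mem_singleton]
      have := strand_adj hc rs hcol p d
      simp only [Finset.mem_univ, true_and]
      refine Iff.trans this ?_
      rw [eq_comm, @eq_comm _ _ p]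
    have h2 := Finset.card_pair (smk_ne1 hc rs hcol (rs.σ d))
    rw [← this] at h2
    convert h2 using 1
    rw [Finset.card_def, Finset.filter_val]

theorem tw_iff {c : G.Dart → ℕ} (hcol : (toCG hc rs).Col c) (b : G.Dart) :
    (toCG hc rs).tw c b = true ↔ ∃ H ∈ strands hc rs hcol, H.Adj b.fst b.snd ∧
      H.Adj (rs.σ (rs.σ b)).fst (rs.σ (rs.σ b)).snd ∧
      H.Adj (rs.σ (rs.σ b.symm)).fst (rs.σ (rs.σ b.symm)).snd := by
  have f2 := (sigma_facts hc rs b).2.1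
  have g2 := (sigma_facts hc rs b.symm).2.1
  have htw : (toCG hc rs).tw c b = true ↔ c (rs.σ b) = c (rs.σ b.symm) := by
    unfold CG.tw; rw [decide_eq_true_iff]; rfl
  rw [htw]
  constructor
  · intro h
    refine ⟨_, (mem_strands hc rs hcol _).2 ⟨smk rs c (rs.σ b), rfl⟩, ?_, ?_, ?_⟩
    · rw [strand_adj]; left; rfl
    · rw [strand_adj]; right; rw [f2]
    · rw [strand_adj]; right; rw [g2]
      exact (smk_J rs ⟨b, Or.inl rfl, Or.inl rfl, h⟩).symm
  · rintro ⟨H, hH, h1, h2, h3⟩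
    obtain ⟨p, rfl⟩ := (mem_strands hc rs hcol H).1 hH
    have h4 := h1.symm
    rw [strand_adj] at h1 h2 h3
    have h4 := (strand_adj hc rs hcol p b.symm).1 h4
    rw [f2] at h2
    rw [g2] at h3
    have aux : ∀ e : G.Dart, (smk rs c (rs.σ e) = p ∨ smk rs c (rs.σ (rs.σ e)) = p) →
        (smk rs c e = p ∨ smk rs c (rs.σ e) = p) → smk rs c (rs.σ e) = p := by
      intro e he he'
      rcases he' with he' | he'
      · rcases he with he | he
        · exact he
        · exact absurd (he'.trans he.symm) (smk_ne2 hc rs hcol e)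
      · exact he'
    exact smk_col rs ((aux b h1 h2).trans (aux b.symm h4 h3).symm)

theorem cidc_finite : {C : Multiset G.Subgraph | IsCiDC G C}.Finite := by
  classical
  letI := Fintype.ofFinite G.Subgraph
  refine (Set.finite_Icc (⊥ : Multiset G.Subgraph) (2 • (Finset.univ : Finset G.Subgraph).val)).subset ?_
  intro C hC
  refine ⟨bot_le, ?_⟩
  rw [Multiset.le_iff_count]
  intro H
  rw [Multiset.count_nsmul, Multiset.count_eq_one_of_mem Finset.univ.nodup (Finset.mem_univ H)]
  by_cases hH : H ∈ C
  · obtain ⟨hcon, h2⟩ := hC.1 H hH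
    obtain ⟨v, hv⟩ := hcon.nonempty
    have h2 := h2 v hv
    obtain ⟨w, hw⟩ : (H.neighborSet v).Nonempty := by rw [← Set.ncard_pos]; omega
    have hcv := hC.2 s(v, w) (H.adj_sub hw)
    have : C.count H ≤ C.countP (fun H => s(v, w) ∈ H.edgeSet) := by
      rw [Multiset.count, Multiset.countP_eq_card_filter, Multiset.countP_eq_card_filter]
      apply Multiset.card_le_card
      apply Multiset.monotone_filter_right
      rintro K rfl
      exact hw
    have h3 : C.countP (fun H => s(v, w) ∈ H.edgeSet) = 2 := by convert hcv
    omega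
  · rw [Multiset.count_eq_zero_of_notMem hH]; omega

theorem nu_ge : (toCG hc rs).nu ≤ nu G := by
  classical
  let f : (G.Dart → Bool) → Multiset G.Subgraph := fun t =>
    if h : t ∈ (toCG hc rs).T then strands hc rs (Classical.choose_spec h).1 else 0
  refine Set.ncard_le_ncard_of_injOn f ?_ ?_ cidc_finite
  · intro t ht
    simp only [f, dif_pos ht]
    exact strands_cover hc rs _
  · intro t ht t' ht' h
    simp only [f, dif_pos ht, dif_pos ht'] at h
    funext b
    rw [← (Classical.choose_spec ht).2, ← (Classical.choose_spec ht').2, Bool.eq_iff_iff,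
      tw_iff hc rs (Classical.choose_spec ht).1, tw_iff hc rs (Classical.choose_spec ht').1, h]

end strands

/-- Every connected bridgeless cubic planar simple graph with `n` vertices has at least
`(5/2)^(n/4 - 1/2)` circuit double covers. -/
theorem stmt14 {V : Type*} [Fintype V] (G : SimpleGraph V)
    (hconn : G.Connected) (hbridgeless : ∀ e : Sym2 V, ¬ G.IsBridge e)
    (hcubic : IsCubic G) (hplanar : HasPlanarEmbedding G) :
    ((5 : ℝ) / 2) ^ ((Fintype.card V : ℝ) / 4 - 1 / 2) ≤ (nu G : ℝ) := by
  classical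
  obtain ⟨rs, hE⟩ := hplanar
  have hcard := card_darts hcubic
  have hne : Nonempty G.Dart := by
    obtain ⟨v⟩ := hconn.nonempty
    have h3 := darts_at_ncard hcubic v
    obtain ⟨d, -⟩ : {e : G.Dart | e.fst = v}.Nonempty := by
      rw [← Set.ncard_pos]; omega
    exact ⟨d⟩
  have hb := bound shortCyc _ G.Dart (toCG hcubic rs) hne
    (toCG_good hcubic rs hconn hbridgeless hE) hcard
  have hn : ((toCG hcubic rs).nu : ℝ) ≤ (nu G : ℝ) := by exact_mod_cast nu_ge hcubic rs
  refine le_trans (le_of_eq ?_) (hb.trans hn)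
  unfold bnd
  congr 1
  push_cast
  ring

end CiDC
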